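/- There is no ribbon a with σ(a) < 0 and γ(a) = 2 − σ(a)/2; that is, for every ribbon a with σ(a) < 0 one has γ(a) ≠ 2 − σ(a)/2. -/

import Mathlib

open scoped RealInnerProductSpace

noncomputable section

abbrev E2 : Type := EuclideanSpace ℝ (Fin 2)

/-- The point (cos t, sin t) on the unit circle in ℝ². -/
def sphPt (t : ℝ) : E2 := (EuclideanSpace.equiv (Fin 2) ℝ).symm ![Real.cos t, Real.sin t]

/-- A ribbon with `n` nodes, encoded via the angle parametrization `g = φ ∘ (cos, sin)`
of a C^∞ function `φ : S¹ → ℝ` whose critical points on the circle are exactly the `n`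
nondegenerate local extrema (nodes) at angles `θ 0 < θ 1 < ⋯ < θ (n-1)` in `[0, 2π)`,
with pairwise distinct critical values, together with a marking `ν` of the nodes by `±1`. -/
structure Ribbon (n : ℕ) : Type where
  g : ℝ → ℝ
  θ : Fin n → ℝ
  ν : Fin n → ℤ
  n_even : Even n
  n_pos : 0 < n
  smooth_g : ContDiff ℝ (⊤ : ℕ∞) g
  periodic_g : Function.Periodic g (2 * Real.pi)
  theta_mem : ∀ i, θ i ∈ Set.Ico (0 : ℝ) (2 * Real.pi)
  theta_mono : StrictMono θ
  node_crit : ∀ i, deriv g (θ i) = 0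
  node_nondeg : ∀ i, deriv (deriv g) (θ i) ≠ 0
  crit_only : ∀ t ∈ Set.Ico (0 : ℝ) (2 * Real.pi), deriv g t = 0 → ∃ i, t = θ i
  values_distinct : ∀ i j, g (θ i) = g (θ j) → i = j
  nu_sign : ∀ i, ν i = 1 ∨ ν i = -1

/-- The signature σ = s₊ − s₋ of a ribbon. -/
def Ribbon.sigma {n : ℕ} (a : Ribbon n) : ℤ := ∑ i, a.ν i

/-- Critical points of `f` in the open unit disk. -/
def critPts (f : E2 → ℝ) : Set E2 :=
  {x | x ∈ Metric.ball (0 : E2) 1 ∧ fderiv ℝ f x = 0}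

/-- `f : ℝ² → ℝ` is an extension of the ribbon `a`: it is C^∞, agrees with `φ` on the unit
circle, has nowhere-vanishing gradient on the circle, and at each node the radial derivative
`⟪∇f(p), p⟫` has sign `ν p` if `p` is a local maximum of `φ` (second derivative of `g`
negative there) and sign `−ν p` if `p` is a local minimum of `φ`. -/
def IsExtension {n : ℕ} (a : Ribbon n) (f : E2 → ℝ) : Prop :=
  ContDiff ℝ (⊤ : ℕ∞) f ∧
  (∀ t : ℝ, f (sphPt t) = a.g t) ∧
  (∀ x ∈ Metric.sphere (0 : E2) 1, fderiv ℝ f x ≠ 0) ∧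
  (∀ i : Fin n,
    (deriv (deriv a.g) (a.θ i) < 0 →
      0 < (a.ν i : ℝ) * ⟪gradient f (sphPt (a.θ i)), sphPt (a.θ i)⟫) ∧
    (0 < deriv (deriv a.g) (a.θ i) →
      (a.ν i : ℝ) * ⟪gradient f (sphPt (a.θ i)), sphPt (a.θ i)⟫ < 0))

/-- The ribbon invariant γ: the infimum, over all extensions `f` of `a`, of the number of
critical points of `f` in the open unit disk (a value in `ℕ∞`). -/
def gammaR {n : ℕ} (a : Ribbon n) : ℕ∞ :=
  sInf {k : ℕ∞ | ∃ f : E2 → ℝ, IsExtension a f ∧ (critPts f).encard = k}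

abbrev Sm {F : Type*} [NormedAddCommGroup F] [NormedSpace ℝ F] (f : F → ℝ) : Prop :=
  ContDiff ℝ (⊤ : ℕ∞) f

abbrev τ : ℝ := 2 * Real.pi

lemma tau_pos : 0 < τ := Real.two_pi_pos

lemma sphPt_zero (t : ℝ) : sphPt t 0 = Real.cos t := rfl
lemma sphPt_one (t : ℝ) : sphPt t 1 = Real.sin t := rfl

lemma E2_ext {x y : E2} (h0 : x 0 = y 0) (h1 : x 1 = y 1) : x = y := by
  ext i; fin_cases i <;> assumption

lemma E2_inner (x y : E2) : ⟪x, y⟫ = x 0 * y 0 + x 1 * y 1 := by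
  simp [PiLp.inner_apply, Fin.sum_univ_two]; ring

lemma E2_norm_sq (x : E2) : ‖x‖ ^ 2 = x 0 ^ 2 + x 1 ^ 2 := by
  rw [← real_inner_self_eq_norm_sq, E2_inner]; ring

lemma sphPt_norm (t : ℝ) : ‖sphPt t‖ = 1 := by
  have := E2_norm_sq (sphPt t)
  rw [sphPt_zero, sphPt_one, Real.cos_sq_add_sin_sq] at this
  nlinarith [norm_nonneg (sphPt t)]

lemma sphPt_ne (t : ℝ) : sphPt t ≠ 0 := by
  intro h; have := sphPt_norm t; rw [h] at this; simp at this

lemma sphPt_periodic : Function.Periodic sphPt τ := by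
  intro t; apply E2_ext <;> simp [sphPt_zero, sphPt_one, τ]

lemma rsph_norm {r : ℝ} (hr : 0 ≤ r) (t : ℝ) : ‖r • sphPt t‖ = r := by
  rw [norm_smul, sphPt_norm, Real.norm_of_nonneg hr, mul_one]

lemma sphPt_hasDerivAt (t : ℝ) : HasDerivAt sphPt (sphPt (t + Real.pi / 2)) t := by
  suffices key : HasDerivAt (fun t : ℝ => (![Real.cos t, Real.sin t] : Fin 2 → ℝ))
      ![Real.cos (t + Real.pi/2), Real.sin (t + Real.pi/2)] t
  from
     ((EuclideanSpace.equiv (Fin 2) ℝ).symm : (Fin 2 → ℝ) →L[ℝ] E2).hasFDerivAt.comp_hasDerivAt t key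
  rw [hasDerivAt_pi]
  intro i
  fin_cases i
  · change HasDerivAt (fun t => Real.cos t) (Real.cos (t + Real.pi/2)) t
    rw [Real.cos_add_pi_div_two]; exact Real.hasDerivAt_cos t
  · change HasDerivAt (fun t => Real.sin t) (Real.sin (t + Real.pi/2)) t
    rw [Real.sin_add_pi_div_two]; exact Real.hasDerivAt_sin t

lemma sphPt_contDiff : ContDiff ℝ (⊤ : ℕ∞) sphPt := by
  rw [contDiff_euclidean]
  intro i
  fin_cases i
  · exact Real.contDiff_cos
  · exact Real.contDiff_sin

lemma sphPt_continuous : Continuous sphPt := sphPt_contDiff.continuous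

lemma sphPt_inner (s t : ℝ) : ⟪sphPt s, sphPt t⟫ = Real.cos (s - t) := by
  rw [E2_inner]; simp [sphPt_zero, sphPt_one, Real.cos_sub]

lemma sphPt_eq_iff {s t : ℝ} : sphPt s = sphPt t ↔ ∃ k : ℤ, s = t + k * τ := by
  constructor
  · intro h
    have h1 : ⟪sphPt s, sphPt t⟫ = 1 := by
      rw [h, real_inner_self_eq_norm_sq, sphPt_norm]; norm_num
    rw [sphPt_inner, Real.cos_eq_one_iff] at h1
    obtain ⟨k, hk⟩ := h1
    exact ⟨k, by simp only [τ]; linarith⟩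
  · rintro ⟨k, rfl⟩
    exact sphPt_periodic.int_mul k t

lemma exists_polar (x : E2) : ∃ t ∈ Set.Ico 0 τ, x = ‖x‖ • sphPt t := by
  set z : ℂ := ⟨x 0, x 1⟩ with hz
  have hn : ‖z‖ = ‖x‖ := by
    have := E2_norm_sq x
    have h2 : ‖z‖ ^ 2 = x 0 ^ 2 + x 1 ^ 2 := by
      rw [← Complex.normSq_eq_norm_sq, Complex.normSq_apply]; ring
    nlinarith [norm_nonneg x, norm_nonneg z]
  have h0 : x = ‖x‖ • sphPt z.arg := by
    apply E2_ext
    · change x 0 = ‖x‖ * Real.cos z.arg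
      rw [← hn, Complex.norm_mul_cos_arg]
    · change x 1 = ‖x‖ * Real.sin z.arg
      rw [← hn, Complex.norm_mul_sin_arg]
  obtain ⟨y, hy, hy2⟩ := sphPt_periodic.exists_mem_Ico₀ tau_pos z.arg
  exact ⟨y, hy, by rw [← hy2]; exact h0⟩

lemma exists_sphPt {x : E2} (hx : ‖x‖ = 1) : ∃ t ∈ Set.Ico 0 τ, x = sphPt t := by
  obtain ⟨t, ht, h⟩ := exists_polar x
  exact ⟨t, ht, by rw [hx, one_smul] at h; exact h⟩

/-- radial and angular derivatives of `f` at `r • sphPt t` -/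
def pr (f : E2 → ℝ) (r t : ℝ) : ℝ := fderiv ℝ f (r • sphPt t) (sphPt t)
def pt (f : E2 → ℝ) (r t : ℝ) : ℝ := fderiv ℝ f (r • sphPt t) (r • sphPt (t + Real.pi / 2))

lemma sm_diff {F : Type*} [NormedAddCommGroup F] [NormedSpace ℝ F] {f : F → ℝ} (hf : Sm f) :
    Differentiable ℝ f := hf.differentiable (by simp)

lemma hasDerivAt_radial {f : E2 → ℝ} {r t : ℝ} (hf : DifferentiableAt ℝ f (r • sphPt t)) :
    HasDerivAt (fun r => f (r • sphPt t)) (pr f r t) r := by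
  have h1 : HasDerivAt (fun r : ℝ => r • sphPt t) (sphPt t) r := by
    simpa using (hasDerivAt_id r).smul_const (sphPt t)
  exact hf.hasFDerivAt.comp_hasDerivAt r h1

lemma hasDerivAt_angular {f : E2 → ℝ} {r t : ℝ} (hf : DifferentiableAt ℝ f (r • sphPt t)) :
    HasDerivAt (fun t => f (r • sphPt t)) (pt f r t) t := by
  have h1 : HasDerivAt (fun t : ℝ => r • sphPt t) (r • sphPt (t + Real.pi / 2)) t :=
    (sphPt_hasDerivAt t).const_smul r
  exact hf.hasFDerivAt.comp_hasDerivAt t h1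

lemma E2_decomp (t : ℝ) (v : E2) :
    v = ⟪v, sphPt t⟫ • sphPt t + ⟪v, sphPt (t + Real.pi / 2)⟫ • sphPt (t + Real.pi / 2) := by
  have h := Real.cos_sq_add_sin_sq t
  apply E2_ext
  · simp only [E2_inner, PiLp.add_apply, PiLp.smul_apply, smul_eq_mul, sphPt_zero, sphPt_one,
      Real.cos_add_pi_div_two, Real.sin_add_pi_div_two]
    linear_combination - v 0 * h
  · simp only [E2_inner, PiLp.add_apply, PiLp.smul_apply, smul_eq_mul, sphPt_zero, sphPt_one,
      Real.cos_add_pi_div_two, Real.sin_add_pi_div_two]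
    linear_combination - v 1 * h

lemma crit_iff {f : E2 → ℝ} {r t : ℝ} (hr : 0 < r) :
    fderiv ℝ f (r • sphPt t) = 0 ↔ pr f r t = 0 ∧ pt f r t = 0 := by
  constructor
  · intro h; simp [pr, pt, h]
  · rintro ⟨h1, h2⟩
    have h3 : fderiv ℝ f (r • sphPt t) (sphPt (t + Real.pi / 2)) = 0 := by
      simp only [pt, map_smul, smul_eq_mul] at h2
      rcases mul_eq_zero.1 h2 with h | h
      · exact absurd h hr.ne'
      · exact h
    ext v
    rw [E2_decomp t v]
    simp only [pr] at h1
    simp [h1, h3]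

lemma pr_cont {f : E2 → ℝ} (hf : Sm f) : Continuous (fun p : ℝ × ℝ => pr f p.1 p.2) := by
  have h := (hf.continuous_fderiv (by simp))
  have h2 := sphPt_continuous
  unfold pr
  fun_prop

lemma pt_cont {f : E2 → ℝ} (hf : Sm f) : Continuous (fun p : ℝ × ℝ => pt f p.1 p.2) := by
  have h := (hf.continuous_fderiv (by simp))
  have h2 := sphPt_continuous
  unfold pt
  fun_prop

lemma pt_one {f : E2 → ℝ} (hf : Sm f) {φ : ℝ → ℝ} (h : ∀ t, f (sphPt t) = φ t) (t : ℝ) :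
    pt f 1 t = deriv φ t := by
  have h1 := hasDerivAt_angular (f := f) (r := 1) (t := t) ((sm_diff hf) _)
  simp only [one_smul, h] at h1
  exact h1.deriv.symm

lemma pr_periodic (f : E2 → ℝ) (r : ℝ) : Function.Periodic (pr f r) τ := by
  intro t; simp only [pr, sphPt_periodic t]
lemma pt_periodic (f : E2 → ℝ) (r : ℝ) : Function.Periodic (pt f r) τ := by
  intro t
  simp only [pt, sphPt_periodic t]
  rw [show t + τ + Real.pi/2 = t + Real.pi/2 + τ by ring, sphPt_periodic]

/-- lift a periodic function to the plane -/
def lft (w : ℝ → ℝ) (x : E2) : ℝ := w (Complex.arg ⟨x 0, x 1⟩)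

lemma lft_apply {w : ℝ → ℝ} (hw : Function.Periodic w τ) {r : ℝ} (hr : 0 < r) (t : ℝ) :
    lft w (r • sphPt t) = w t := by
  have h : (⟨(r • sphPt t) 0, (r • sphPt t) 1⟩ : ℂ) = r * (Complex.cos t + Complex.sin t * Complex.I) := by
    apply Complex.ext <;> simp [sphPt_zero, sphPt_one, ← Complex.ofReal_cos, ← Complex.ofReal_sin]
  unfold lft
  rw [h, Complex.arg_mul_cos_add_sin_mul_I_eq_toIocMod hr]
  rw [← self_sub_toIocDiv_zsmul]
  rw [zsmul_eq_mul]
  exact hw.sub_int_mul_eq _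

lemma lft_smooth {w : ℝ → ℝ} (hw : Function.Periodic w τ) (hs : Sm w) {x : E2} (hx : x ≠ 0) :
    ContDiffAt ℝ (⊤ : ℕ∞) (lft w) x := by
  have hlin : ContDiff ℝ (⊤ : ℕ∞) (fun x : E2 => (⟨x 0, x 1⟩ : ℂ)) := by
    have : (fun x : E2 => (⟨x 0, x 1⟩ : ℂ)) = fun x : E2 => ((x 0 : ℝ) : ℂ) + (x 1 : ℝ) * Complex.I := by
      ext x; apply Complex.ext <;> simp
    rw [this]
    have h0 : ContDiff ℝ (⊤ : ℕ∞) (fun x : E2 => x 0) := by fun_prop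
    have h1 : ContDiff ℝ (⊤ : ℕ∞) (fun x : E2 => x 1) := by fun_prop
    exact (Complex.ofRealCLM.contDiff.comp h0).add ((Complex.ofRealCLM.contDiff.comp h1).mul contDiff_const)
  have harg : ∀ z : ℂ, z ∈ Complex.slitPlane → ContDiffAt ℝ (⊤ : ℕ∞) Complex.arg z := by
    intro z hz
    have h1 : ContDiffAt ℝ (⊤ : ℕ∞) Complex.log z := (Complex.contDiffAt_log hz).restrict_scalars ℝ
    have h2 := Complex.imCLM.contDiff.contDiffAt.comp z h1 (n := (⊤:ℕ∞))
    exact h2.congr_of_eventuallyEq (Filter.Eventually.of_forall fun z => by simp [Complex.log_im])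
  set z : ℂ := ⟨x 0, x 1⟩ with hz
  by_cases h : z ∈ Complex.slitPlane
  · exact hs.contDiffAt.comp x ((harg z h).comp x (f := fun x : E2 => (⟨x 0, x 1⟩ : ℂ)) hlin.contDiffAt)
  · have hz0 : z ≠ 0 := by
      intro h0; apply hx
      have h1 := congrArg Complex.re h0
      have h2 := congrArg Complex.im h0
      exact E2_ext h1 h2
    have hm : -z ∈ Complex.slitPlane := by
      rw [Complex.mem_slitPlane_iff] at h ⊢
      push Not at h
      left
      simp only [Complex.neg_re]
      rcases lt_or_eq_of_le h.1 with h3 | h3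
      · linarith
      · exact absurd (Complex.ext h3 h.2) hz0
    have h3 : ContDiffAt ℝ (⊤ : ℕ∞) (fun y : E2 => w (Complex.arg (-(⟨y 0, y 1⟩ : ℂ)) + Real.pi)) x := by
      apply hs.contDiffAt.comp x
      apply ContDiffAt.add _ contDiffAt_const
      exact (harg _ hm).comp x (f := fun y : E2 => -(⟨y 0, y 1⟩ : ℂ)) hlin.neg.contDiffAt
    apply h3.congr_of_eventuallyEq
    filter_upwards [isOpen_ne.mem_nhds hx] with y hy
    obtain ⟨t, -, ht⟩ := exists_polar y
    have hy0 : 0 < ‖y‖ := norm_pos_iff.2 hy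
    have e1 : lft w y = w t := by rw [ht]; exact lft_apply hw hy0 t
    have hw' : Function.Periodic (fun s => w (s + Real.pi)) τ := fun s => by
      change w (s + τ + Real.pi) = _
      rw [add_right_comm]; exact hw _
    have e2 := lft_apply hw' hy0 (t + Real.pi)
    have e3 : ‖y‖ • sphPt (t + Real.pi) = -y := by
      conv_rhs => rw [ht]
      rw [← smul_neg]; congr 1
      apply E2_ext <;> simp [sphPt_zero, sphPt_one]
    rw [e3] at e2
    rw [e1]
    simp only [lft] at e2
    have e4 : -(⟨y 0, y 1⟩ : ℂ) = ⟨(-y) 0, (-y) 1⟩ := by apply Complex.ext <;> simp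
    rw [e4, e2]
    have := hw t
    simp only [τ] at this
    rw [← this]; congr 1; ring

/-- collar function -/
def col (β w : ℝ → ℝ) (x : E2) : ℝ := β ‖x‖ * lft w x

lemma col_smooth {β w : ℝ → ℝ} (hw : Function.Periodic w τ) (hs : Sm w) (hβ : Sm β)
    (h0 : ∀ r ≤ 1/2, β r = 0) : Sm (col β w) := by
  refine contDiff_iff_contDiffAt.2 fun x => ?_
  by_cases hx : x = 0
  · have : col β w =ᶠ[nhds x] fun _ => 0 := by
      subst hx
      filter_upwards [Metric.ball_mem_nhds (0:E2) (by norm_num : (0:ℝ) < 1/2)] with y hy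
      simp only [Metric.mem_ball, dist_zero_right] at hy
      simp [col, h0 _ hy.le]
    exact contDiffAt_const.congr_of_eventuallyEq this
  · exact (hβ.contDiffAt.comp x (contDiffAt_norm ℝ hx)).mul (lft_smooth hw hs hx)

lemma col_apply {β w : ℝ → ℝ} (hw : Function.Periodic w τ) {r : ℝ} (hr : 0 < r) (t : ℝ) :
    col β w (r • sphPt t) = β r * w t := by
  rw [col, lft_apply hw hr, rsph_norm hr.le]

lemma pr_col {β w : ℝ → ℝ} (hw : Function.Periodic w τ) (hs : Sm w) (hβ : Sm β)
    (h0 : ∀ r ≤ 1/2, β r = 0) {r : ℝ} (hr : 0 < r) (t : ℝ) :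
    pr (col β w) r t = deriv β r * w t := by
  have h1 := hasDerivAt_radial (f := col β w) (r := r) (t := t) ((sm_diff (col_smooth hw hs hβ h0)) _)
  have h2 : HasDerivAt (fun r => β r * w t) (deriv β r * w t) r :=
    ((sm_diff hβ) r).hasDerivAt.mul_const _
  refine (h1.congr_of_eventuallyEq ?_).unique h2
  filter_upwards [lt_mem_nhds hr] with s hs
  exact (col_apply hw hs t).symm

lemma pt_col {β w : ℝ → ℝ} (hw : Function.Periodic w τ) (hs : Sm w) (hβ : Sm β)
    (h0 : ∀ r ≤ 1/2, β r = 0) {r : ℝ} (hr : 0 < r) (t : ℝ) :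
    pt (col β w) r t = β r * deriv w t := by
  have h1 := hasDerivAt_angular (f := col β w) (r := r) (t := t) ((sm_diff (col_smooth hw hs hβ h0)) _)
  have h2 : HasDerivAt (fun t => β r * w t) (β r * deriv w t) t :=
    ((sm_diff hs) t).hasDerivAt.const_mul _
  simp only [col_apply hw hr] at h1
  exact h1.unique h2

lemma pr_add {f g : E2 → ℝ} (hf : Sm f) (hg : Sm g) (r t : ℝ) :
    pr (fun x => f x + g x) r t = pr f r t + pr g r t := by
  simp only [pr]
  rw [fderiv_fun_add ((sm_diff hf) _) ((sm_diff hg) _)]; rfl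

lemma pt_add {f g : E2 → ℝ} (hf : Sm f) (hg : Sm g) (r t : ℝ) :
    pt (fun x => f x + g x) r t = pt f r t + pt g r t := by
  simp only [pt]
  rw [fderiv_fun_add ((sm_diff hf) _) ((sm_diff hg) _)]; rfl

lemma deriv_zero_of_Iic {β : ℝ → ℝ} (hβ : Sm β) {a : ℝ} (h : ∀ r ≤ a, β r = 0) {r : ℝ} (hr : r ≤ a) :
    deriv β r = 0 := by
  have h1 : HasDerivWithinAt β (deriv β r) (Set.Iic r) r := ((sm_diff hβ) r).hasDerivAt.hasDerivWithinAt
  have h2 : HasDerivWithinAt β 0 (Set.Iic r) r :=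
    (hasDerivWithinAt_const r (Set.Iic r) (0:ℝ)).congr (fun x hx => h x (le_trans hx hr)) (h r hr)
  exact (uniqueDiffOn_Iic r r Set.self_mem_Iic).eq_deriv _ h1 h2

lemma collar_crit {f : E2 → ℝ} (hf : Sm f) {β w : ℝ → ℝ} (hw : Function.Periodic w τ) (hs : Sm w)
    (hβ : Sm β) {δ : ℝ} (hδ : 0 < δ) (hδ2 : δ < 1/2) (h0 : ∀ r ≤ 1 - δ, β r = 0)
    {x : E2} (hx : x ∈ critPts (fun x => f x + col β w x)) :
    x ∈ critPts f ∨ ∃ r t, 1 - δ < r ∧ r < 1 ∧ t ∈ Set.Icc 0 τ ∧ x = r • sphPt t ∧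
      pr f r t + deriv β r * w t = 0 ∧ pt f r t + β r * deriv w t = 0 := by
  have h0' : ∀ r ≤ 1/2, β r = 0 := fun r hr => h0 r (by linarith)
  have hc := col_smooth hw hs hβ h0'
  obtain ⟨hx1, hx2⟩ := hx
  simp only [Metric.mem_ball, dist_zero_right] at hx1
  obtain ⟨t, ht, hxt⟩ := exists_polar x
  by_cases hx0 : x = 0
  · left
    refine ⟨by simp [hx0], ?_⟩
    have : (fun x => f x + col β w x) =ᶠ[nhds x] f := by
      subst hx0
      filter_upwards [Metric.ball_mem_nhds (0:E2) (by norm_num : (0:ℝ) < 1/2)] with y hy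
      simp only [Metric.mem_ball, dist_zero_right] at hy
      simp [col, h0' _ hy.le]
    rw [← this.fderiv_eq]; exact hx2
  have hr : 0 < ‖x‖ := norm_pos_iff.2 hx0
  have hx3 := hx2
  rw [hxt, crit_iff hr, pr_add hf hc, pt_add hf hc, pr_col hw hs hβ h0' hr, pt_col hw hs hβ h0' hr] at hx3
  by_cases hr2 : 1 - δ < ‖x‖
  · right
    exact ⟨‖x‖, t, hr2, hx1, ⟨ht.1, ht.2.le⟩, hxt, hx3.1, hx3.2⟩
  · left
    refine ⟨by simpa using hx1, ?_⟩
    push Not at hr2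
    rw [h0 _ hr2, deriv_zero_of_Iic hβ h0 hr2] at hx3
    rw [hxt, crit_iff hr]
    simpa using hx3

lemma unif_collar {P : ℝ → ℝ → Prop}
    (h : ∀ t, ∀ᶠ p : ℝ × ℝ in nhds (1, t), P p.1 p.2) :
    ∃ δ, 0 < δ ∧ δ < 1/2 ∧ ∀ δ' ≤ δ, ∀ r, 1 - δ' < r → r < 1 → ∀ t ∈ Set.Icc 0 τ, P r t := by
  have := (isCompact_Icc (a := (0:ℝ)) (b := τ)).eventually_forall_of_forall_eventually
    (x₀ := (1:ℝ)) (P := P) (fun y _ => h y)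
  rw [Metric.eventually_nhds_iff] at this
  obtain ⟨ε, hε, h1⟩ := this
  refine ⟨min ε (1/4), by positivity, by linarith [min_le_right ε (1/4)], fun δ' hδ' r hr hr1 t ht => ?_⟩
  refine h1 ?_ t ht
  rw [Real.dist_eq, abs_lt]
  constructor <;> linarith [min_le_left ε (1/4)]

/-- radial cutoff -/
def cut (δ r : ℝ) : ℝ := Real.smoothTransition ((r - 1 + δ) / δ)

lemma st_smooth : Sm Real.smoothTransition := Real.smoothTransition.contDiff

lemma cut_smooth (δ : ℝ) : Sm (cut δ) := by
  unfold cut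
  exact st_smooth.comp (by fun_prop)

lemma cut_zero {δ r : ℝ} (hδ : 0 < δ) (h : r ≤ 1 - δ) : cut δ r = 0 :=
  Real.smoothTransition.zero_of_nonpos (div_nonpos_of_nonpos_of_nonneg (by linarith) hδ.le)

lemma cut_one {δ r : ℝ} (hδ : 0 < δ) (h : 1 ≤ r) : cut δ r = 1 :=
  Real.smoothTransition.one_of_one_le (by rw [le_div_iff₀ hδ]; linarith)

lemma cut_deriv_nonneg {δ : ℝ} (hδ : 0 < δ) (r : ℝ) : 0 ≤ deriv (cut δ) r := by
  apply Monotone.deriv_nonneg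
  intro a b hab
  apply Real.smoothTransition.monotone
  gcongr

lemma cut_deriv_one {δ : ℝ} (hδ : 0 < δ) : deriv (cut δ) 1 = 0 := by
  apply IsLocalMax.deriv_eq_zero
  refine Filter.Eventually.of_forall fun x => ?_
  rw [cut_one hδ le_rfl]; exact Real.smoothTransition.le_one _

lemma deriv_sm {w : ℝ → ℝ} (hs : Sm w) : Sm (deriv w) := by
  have : ContDiff ℝ (((⊤ : ℕ∞) : WithTop ℕ∞) + 1) w := by simpa using hs
  exact (contDiff_succ_iff_deriv.1 this).2.2

lemma deriv_per {w : ℝ → ℝ} (hw : Function.Periodic w τ) : Function.Periodic (deriv w) τ := by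
  intro t
  rw [← deriv_comp_add_const]
  congr 1; ext s; exact hw s

lemma sgn_conv {a b B : ℝ} (h : 0 < a * b) (h0 : 0 ≤ B) (h1 : B ≤ 1) : a + B * (b - a) ≠ 0 := by
  intro h2
  have h3 : (1 - B) * a + B * b = 0 := by linarith
  rcases pos_and_pos_or_neg_and_neg_of_mul_pos h with ⟨ha, hb⟩ | ⟨ha, hb⟩
  · rcases eq_or_lt_of_le h0 with rfl | hB
    · simp at h3; linarith
    · nlinarith [mul_pos hB hb, mul_nonneg (sub_nonneg.2 h1) ha.le]
  · rcases eq_or_lt_of_le h0 with rfl | hB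
    · simp at h3; linarith
    · nlinarith [mul_pos hB (neg_pos.2 hb), mul_nonneg (sub_nonneg.2 h1) (neg_pos.2 ha).le]

/-- Interpolation lemma. -/
lemma lem_Int {f : E2 → ℝ} (hf : Sm f) {φ : ℝ → ℝ} (hφ : Sm φ) (hp : Function.Periodic φ τ)
    (h : ∀ t, 0 < deriv φ t * pt f 1 t ∨
      (0 < pr f 1 t ∧ ∀ᶠ s in nhds t, f (sphPt s) ≤ φ s) ∨
      (pr f 1 t < 0 ∧ ∀ᶠ s in nhds t, φ s ≤ f (sphPt s))) :
    ∃ g : E2 → ℝ, Sm g ∧ (∀ t, g (sphPt t) = φ t) ∧ (∀ t, pr g 1 t = pr f 1 t) ∧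
      critPts g ⊆ critPts f := by
  set ψ : ℝ → ℝ := fun t => f (sphPt t) with hψ
  have hψs : Sm ψ := hf.comp sphPt_contDiff
  set w : ℝ → ℝ := fun t => φ t - ψ t with hw
  have hws : Sm w := hφ.sub hψs
  have hwp : Function.Periodic w τ := fun t => by
    simp only [hw, hψ, hp t, sphPt_periodic t]
  have hwd : ∀ t, deriv w t = deriv φ t - pt f 1 t := fun t => by
    rw [hw, deriv_fun_sub ((sm_diff hφ) t) ((sm_diff hψs) t), pt_one hf (fun t => rfl)]
  have prc := pr_cont hf
  have ptc := pt_cont hf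
  have wdc : Continuous (deriv w) := (deriv_sm hws).continuous
  obtain ⟨δ, hδ, hδ2, hP⟩ := unif_collar (P := fun r t => ∀ B B' : ℝ, 0 ≤ B → B ≤ 1 → 0 ≤ B' →
      ¬ (pr f r t + B' * w t = 0 ∧ pt f r t + B * deriv w t = 0)) (by
    intro t0
    rcases h t0 with h1 | ⟨h1, h2⟩ | ⟨h1, h2⟩
    · have hc : ContinuousAt (fun p : ℝ × ℝ => pt f p.1 p.2 * (pt f p.1 p.2 + deriv w p.2)) (1, t0) := by
        fun_prop
      have hpos : 0 < pt f (1:ℝ) t0 * (pt f 1 t0 + deriv w t0) := by rw [hwd]; ring_nf at h1 ⊢; exact h1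
      filter_upwards [hc.eventually (lt_mem_nhds hpos)] with p hp B B' hB0 hB1 _ hh
      have := sgn_conv hp hB0 hB1
      apply this; have := hh.2; ring_nf at this ⊢; exact this
    · have hc : ContinuousAt (fun p : ℝ × ℝ => pr f p.1 p.2) (1, t0) := prc.continuousAt
      filter_upwards [hc.eventually (lt_mem_nhds h1),
        (continuous_snd.tendsto ((1:ℝ), t0)).eventually h2] with p hp hp2 B B' hB0 hB1 hB' hh
      have : 0 ≤ B' * w p.2 := mul_nonneg hB' (sub_nonneg.2 hp2)
      linarith [hh.1]
    · have hc : ContinuousAt (fun p : ℝ × ℝ => pr f p.1 p.2) (1, t0) := prc.continuousAt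
      filter_upwards [hc.eventually (gt_mem_nhds h1),
        (continuous_snd.tendsto ((1:ℝ), t0)).eventually h2] with p hp hp2 B B' hB0 hB1 hB' hh
      have : B' * w p.2 ≤ 0 := mul_nonpos_of_nonneg_of_nonpos hB' (sub_nonpos.2 hp2)
      linarith [hh.1])
  have hβ0 : ∀ r ≤ 1/2, cut δ r = 0 := fun r hr => cut_zero hδ (by linarith)
  have hcs := col_smooth hwp hws (cut_smooth δ) hβ0
  refine ⟨fun x => f x + col (cut δ) w x, hf.add hcs, fun t => ?_, fun t => ?_, fun x hx => ?_⟩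
  · have := col_apply (β := cut δ) hwp one_pos t
    rw [one_smul, cut_one hδ le_rfl] at this
    beta_reduce; rw [this]; simp [hw, hψ]
  · rw [pr_add hf hcs, pr_col hwp hws (cut_smooth δ) hβ0 one_pos, cut_deriv_one hδ]; simp
  · rcases collar_crit hf hwp hws (cut_smooth δ) hδ hδ2 (fun r hr => cut_zero hδ hr) hx with h1 | ⟨r, t, h1, h2, h3, h4, h5, h6⟩
    · exact h1
    · exact absurd ⟨h5, h6⟩ (hP δ le_rfl r h1 h2 t h3 _ _ (Real.smoothTransition.nonneg _)
        (Real.smoothTransition.le_one _) (cut_deriv_nonneg hδ r))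

lemma ev_zero_deriv {κ : ℝ → ℝ} {t : ℝ} (h : ∀ᶠ s in nhds t, κ s = 0) :
    ∀ᶠ s in nhds t, κ s = 0 ∧ deriv κ s = 0 := by
  filter_upwards [h, h.eventually_nhds] with s h1 h2
  exact ⟨h1, by rw [Filter.EventuallyEq.deriv_eq (f := fun _ => (0:ℝ)) h2]; simp⟩

lemma small_pert {f : E2 → ℝ} (hf : Sm f) {κ : ℝ → ℝ} (hκ : Sm κ) {t : ℝ} (C : ℝ) (h : pt f 1 t ≠ 0) :
    ∀ᶠ p : ℝ × ℝ in nhds (1, t), ∀ B, |B| ≤ C * |p.1 - 1| → pt f p.1 p.2 + B * deriv κ p.2 ≠ 0 := by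
  have ptc := pt_cont hf
  have wdc : Continuous (deriv κ) := (deriv_sm hκ).continuous
  have hc : ContinuousAt (fun p : ℝ × ℝ => |pt f p.1 p.2| - C * |p.1 - 1| * |deriv κ p.2|) (1, t) := by
    fun_prop
  have hpos : 0 < |pt f (1:ℝ) t| - C * |(1:ℝ) - 1| * |deriv κ t| := by simpa using h
  filter_upwards [hc.eventually (lt_mem_nhds hpos)] with p hp B hB hh
  have : |pt f p.1 p.2| = |B| * |deriv κ p.2| := by
    rw [← abs_mul, ← abs_neg (B * _)]; congr 1; linarith
  have : |B| * |deriv κ p.2| ≤ C * |p.1 - 1| * |deriv κ p.2| := by gcongr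
  linarith

/-- Changing the normal derivative away from the nodes. -/
lemma lem_Nor {f : E2 → ℝ} (hf : Sm f) {κ : ℝ → ℝ} (hκ : Sm κ) (hp : Function.Periodic κ τ)
    (h : ∀ t, pt f 1 t ≠ 0 ∨ ∀ᶠ s in nhds t, κ s = 0) :
    ∃ g : E2 → ℝ, Sm g ∧ (∀ t, g (sphPt t) = f (sphPt t)) ∧ (∀ t, pr g 1 t = pr f 1 t + κ t) ∧
      critPts g ⊆ critPts f := by
  obtain ⟨δ, hδ, hδ2, hP⟩ := unif_collar (P := fun r t => (κ t = 0 ∧ deriv κ t = 0) ∨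
      ∀ B, |B| ≤ 1 * |r - 1| → pt f r t + B * deriv κ t ≠ 0) (by
    intro t0
    rcases h t0 with h1 | h1
    · filter_upwards [small_pert hf hκ 1 h1] with p hp
      exact Or.inr hp
    · filter_upwards [(continuous_snd.tendsto ((1:ℝ), t0)).eventually (ev_zero_deriv h1)] with p hp
      exact Or.inl hp)
  set β : ℝ → ℝ := fun r => (r - 1) * cut δ r with hβ
  have hβs : Sm β := ContDiff.mul (by fun_prop) (cut_smooth δ)
  have hβz : ∀ r ≤ 1 - δ, β r = 0 := fun r hr => by simp [hβ, cut_zero hδ hr]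
  have hβ0 : ∀ r ≤ 1/2, β r = 0 := fun r hr => hβz r (by linarith)
  have hcs := col_smooth hp hκ hβs hβ0
  refine ⟨fun x => f x + col β κ x, hf.add hcs, fun t => ?_, fun t => ?_, fun x hx => ?_⟩
  · have := col_apply (β := β) hp one_pos t
    rw [one_smul] at this
    beta_reduce; rw [this]; simp [hβ]
  · rw [pr_add hf hcs, pr_col hp hκ hβs hβ0 one_pos]
    have : HasDerivAt β (1 * cut δ 1 + (1 - 1) * deriv (cut δ) 1) 1 :=
      ((hasDerivAt_id (1:ℝ)).sub_const 1).mul ((sm_diff (cut_smooth δ)) 1).hasDerivAt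
    rw [this.deriv, cut_one hδ le_rfl]; ring
  · rcases collar_crit hf hp hκ hβs hδ hδ2 hβz hx with h1 | ⟨r, t, h1, h2, h3, h4, h5, h6⟩
    · exact h1
    · rcases hP δ le_rfl r h1 h2 t h3 with ⟨h7, h8⟩ | h7
      · rw [h7] at h5; rw [h8] at h6
        refine ⟨by rw [h4, mem_ball_zero_iff, rsph_norm (by linarith)]; exact h2, ?_⟩
        rw [h4, crit_iff (by linarith)]
        constructor <;> linarith
      · refine absurd h6 (h7 _ ?_)
        rw [one_mul, hβ, abs_mul]
        have h8 : |cut δ r| ≤ 1 := by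
          rw [abs_of_nonneg (show 0 ≤ cut δ r from Real.smoothTransition.nonneg _)]; exact Real.smoothTransition.le_one _
        nlinarith [abs_nonneg (r - 1)]

/-- periodic bump -/
def bmp (c ε₁ ε₂ t : ℝ) : ℝ :=
  Real.smoothTransition ((Real.cos (t - c) - Real.cos ε₂) / (Real.cos ε₁ - Real.cos ε₂))

lemma bmp_smooth (c e1 e2 : ℝ) : Sm (bmp c e1 e2) := by
  unfold bmp
  refine st_smooth.comp ?_
  have := Real.contDiff_cos (n := (⊤ : ℕ∞))
  fun_prop

lemma bmp_per (c e1 e2 : ℝ) : Function.Periodic (bmp c e1 e2) τ := by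
  intro t
  simp only [bmp, τ, show t + 2 * Real.pi - c = t - c + 2 * Real.pi by ring, Real.cos_add_two_pi]

lemma bmp_nonneg (c e1 e2 t : ℝ) : 0 ≤ bmp c e1 e2 t := Real.smoothTransition.nonneg _
lemma bmp_le_one (c e1 e2 t : ℝ) : bmp c e1 e2 t ≤ 1 := Real.smoothTransition.le_one _

lemma cos_lt_of_lt {e1 e2 : ℝ} (h0 : 0 ≤ e1) (h1 : e1 < e2) (h2 : e2 ≤ Real.pi) :
    Real.cos e2 < Real.cos e1 := Real.cos_lt_cos_of_nonneg_of_le_pi h0 h2 h1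

lemma bmp_one {c e1 e2 t : ℝ} (h0 : 0 ≤ e1) (h1 : e1 < e2) (h2 : e2 ≤ Real.pi)
    (h : Real.cos e1 ≤ Real.cos (t - c)) : bmp c e1 e2 t = 1 := by
  have := cos_lt_of_lt h0 h1 h2
  apply Real.smoothTransition.one_of_one_le
  rw [le_div_iff₀ (by linarith)]; linarith

lemma bmp_zero {c e1 e2 t : ℝ} (h0 : 0 ≤ e1) (h1 : e1 < e2) (h2 : e2 ≤ Real.pi)
    (h : Real.cos (t - c) ≤ Real.cos e2) : bmp c e1 e2 t = 0 := by
  have := cos_lt_of_lt h0 h1 h2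
  apply Real.smoothTransition.zero_of_nonpos
  exact div_nonpos_of_nonpos_of_nonneg (by linarith) (by linarith)

lemma cos_ge_iff {c e t : ℝ} (h0 : 0 ≤ e) (h2 : e ≤ Real.pi) :
    Real.cos e ≤ Real.cos (t - c) ↔ ∃ k : ℤ, |t + k * τ - c| ≤ e := by
  constructor
  · intro h
    obtain ⟨k, hk, -⟩ := existsUnique_add_zsmul_mem_Ioc tau_pos (t - c) (-Real.pi)
    refine ⟨k, ?_⟩
    simp only [zsmul_eq_mul] at hk
    have h3 : |t + k * τ - c| ≤ Real.pi := by
      rw [abs_le]; simp only [τ] at hk ⊢; constructor <;> linarith [hk.1, hk.2]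
    have h4 : Real.cos (t - c) = Real.cos |t + k * τ - c| := by
      rw [Real.cos_abs, show t + k * τ - c = t - c + k * (2 * Real.pi) by simp only [τ]; ring, Real.cos_add_int_mul_two_pi]
    rw [h4] at h
    by_contra h5
    push Not at h5
    linarith [cos_lt_of_lt h0 h5 h3]
  · rintro ⟨k, hk⟩
    have h4 : Real.cos (t - c) = Real.cos |t + k * τ - c| := by
      rw [Real.cos_abs, show t + k * τ - c = t - c + k * (2 * Real.pi) by simp only [τ]; ring, Real.cos_add_int_mul_two_pi]
    rw [h4]
    exact Real.cos_le_cos_of_nonneg_of_le_pi (abs_nonneg _) h2 hk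

/-- flip profile -/
def flp (Λ δ r : ℝ) : ℝ :=
  Λ * ((1 - r) * ((r - 1 + δ) / δ)) * Real.smoothTransition (4 * ((r - 1 + δ) / δ))

lemma flp_smooth (Λ δ : ℝ) : Sm (flp Λ δ) := by
  unfold flp
  exact ContDiff.mul (by fun_prop) (st_smooth.comp (by fun_prop))

lemma flp_deriv {Λ δ r : ℝ} (hδ : 0 < δ) : deriv (flp Λ δ) r =
    Λ * (1 - 2 * ((r - 1 + δ) / δ)) * Real.smoothTransition (4 * ((r - 1 + δ) / δ)) +
    Λ * ((1 - r) * ((r - 1 + δ) / δ)) * (deriv Real.smoothTransition (4 * ((r - 1 + δ) / δ)) * (4 * (1 / δ))) := by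
  have hu : HasDerivAt (fun r : ℝ => (r - 1 + δ) / δ) (1 / δ) r :=
    (((hasDerivAt_id r).sub_const 1).add_const δ).div_const δ
  have h1 : HasDerivAt (fun r : ℝ => 1 - r) (-1) r := (hasDerivAt_id r).const_sub 1
  have h2 := (h1.mul hu).const_mul Λ
  have h3 : HasDerivAt Real.smoothTransition (deriv Real.smoothTransition (4 * ((r - 1 + δ) / δ))) (4 * ((r - 1 + δ) / δ)) :=
    ((sm_diff st_smooth) _).hasDerivAt
  have h4 := h3.comp r (hu.const_mul 4)
  have h5 := h2.mul h4
  have h6 : HasDerivAt (flp Λ δ) _ r := h5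
  rw [h6.deriv]
  simp only [Function.comp, Pi.mul_apply]
  congr 1
  field_simp
  ring

lemma st_deriv_nonneg (x : ℝ) : 0 ≤ deriv Real.smoothTransition x :=
  Real.smoothTransition.monotone.deriv_nonneg

lemma st_deriv_one {x : ℝ} (h : 1 ≤ x) : deriv Real.smoothTransition x = 0 := by
  apply IsLocalMax.deriv_eq_zero
  refine Filter.Eventually.of_forall fun y => ?_
  rw [Real.smoothTransition.one_of_one_le h]; exact Real.smoothTransition.le_one _

lemma subsingleton_sub {α : Type*} [Nonempty α] {S T : Set α}
    (h : ∀ x ∈ S, ∀ y ∈ S, x ∉ T → y ∉ T → x = y) : ∃ p, S ⊆ T ∪ {p} := by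
  by_cases h0 : ∃ x ∈ S, x ∉ T
  · obtain ⟨p, hp, hp2⟩ := h0
    refine ⟨p, fun x hx => ?_⟩
    by_cases hT : x ∈ T
    · exact Or.inl hT
    · exact Or.inr (h x hx p hp hT hp2)
  · push Not at h0
    exact ⟨Classical.arbitrary α, fun x hx => Or.inl (h0 x hx)⟩

lemma prt_smooth {f : E2 → ℝ} (hf : Sm f) :
    Sm (fun p : ℝ × ℝ => pr f p.1 p.2) ∧ Sm (fun p : ℝ × ℝ => pt f p.1 p.2) := by
  have h1 : ContDiff ℝ (⊤ : ℕ∞) (fderiv ℝ f) := by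
    have : ContDiff ℝ (((⊤ : ℕ∞) : WithTop ℕ∞) + 1) f := by simpa using hf
    exact (contDiff_succ_iff_fderiv.1 this).2.2
  have h2 := sphPt_contDiff
  have h3 : ContDiff ℝ (⊤ : ℕ∞) (fun p : ℝ × ℝ => fderiv ℝ f (p.1 • sphPt p.2)) :=
    h1.comp (contDiff_fst.smul (h2.comp contDiff_snd))
  refine ⟨h3.clm_apply (h2.comp contDiff_snd), h3.clm_apply (contDiff_fst.smul (h2.comp (by fun_prop)))⟩

lemma lem_Flip {f : E2 → ℝ} (hf : Sm f) {t0 : ℝ} (h1 : pt f 1 t0 = 0)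
    (h2 : deriv (pt f 1) t0 ≠ 0) (hR : 0 < pr f 1 t0) :
    ∃ g : E2 → ℝ, Sm g ∧ (∀ t, g (sphPt t) = f (sphPt t)) ∧ pr g 1 t0 < 0 ∧
      (∀ t, pt f 1 t = 0 → sphPt t ≠ sphPt t0 → pr g 1 t = pr f 1 t) ∧
      ∃ p, critPts g ⊆ critPts f ∪ {p} := by
  obtain ⟨hBs, hAs⟩ := prt_smooth hf
  set R := pr f 1 t0 with hRdef
  set Λ := 2 * R with hΛ
  have hΛ0 : 0 < Λ := by positivity
  set c := deriv (pt f 1) t0 with hc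
  set A' := fderiv ℝ (fun p : ℝ × ℝ => pt f p.1 p.2) (1, t0) with hA'
  have hAd : HasFDerivAt (fun p : ℝ × ℝ => pt f p.1 p.2) A' (1, t0) := ((sm_diff hAs) _).hasFDerivAt
  have hcd : HasDerivAt (pt f 1) (A' (0, 1)) t0 := by
    have : HasDerivAt (fun t : ℝ => ((1:ℝ), t)) (0, 1) t0 :=
      (hasDerivAt_const t0 (1:ℝ)).prodMk (hasDerivAt_id t0)
    exact hAd.comp_hasDerivAt t0 this
  have hc2 : A' (0, 1) = c := hcd.deriv.symm
  set a := A' (1, 0) with ha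
  have hlin : ∀ x y : ℝ, A' (x, y) = a * x + c * y := by
    intro x y
    have : ((x, y) : ℝ × ℝ) = x • (1, 0) + y • (0, 1) := by simp
    rw [this, map_add, map_smul, map_smul, hc2, ← ha]; simp; ring
  have hcpos : 0 < |c| := abs_pos.2 h2
  have hst : HasStrictFDerivAt (fun p : ℝ × ℝ => pt f p.1 p.2) A' (1, t0) :=
    hAs.contDiffAt.hasStrictFDerivAt (by simp)
  have hlo := hst.isLittleO.def (c := |c|/2) (by positivity)
  rw [nhds_prod_eq, Filter.Eventually, Filter.mem_prod_same_iff] at hlo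
  obtain ⟨U1, hU1, hU1'⟩ := hlo
  obtain ⟨K, U2, hU2, hLip⟩ := (hBs.contDiffAt (x := (1, t0))).of_le (m := 1) (by simp) |>.exists_lipschitzOnWith
  have hU3 : ∀ᶠ p : ℝ × ℝ in nhds (1, t0), 0 < pr f p.1 p.2 :=
    (hBs.continuous.continuousAt (x := ((1:ℝ), t0))).eventually (lt_mem_nhds hR)
  have hU4 : ∀ᶠ t in nhds t0, t ≠ t0 → pt f 1 t ≠ 0 := by
    have := hcd.eventually_ne (c := 0) (by rw [hc2]; exact h2)
    rwa [eventually_nhdsWithin_iff] at this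
  have hU := Filter.inter_mem (Filter.inter_mem hU1 hU2) hU3
  obtain ⟨e1, he1, hb1⟩ := Metric.mem_nhds_iff.1 hU
  obtain ⟨e2, he2, hb2⟩ := Metric.eventually_nhds_iff.1 hU4
  obtain ⟨ε, hε, hε1, hε2, hε3⟩ : ∃ ε, 0 < ε ∧ ε < e1 ∧ ε < e2 ∧ ε < Real.pi := by
    refine ⟨min (min (e1/2) (e2/2)) (Real.pi/2), by have := Real.pi_pos; positivity, ?_, ?_, ?_⟩
    · exact lt_of_le_of_lt ((min_le_left _ _).trans (min_le_left _ _)) (by linarith)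
    · exact lt_of_le_of_lt ((min_le_left _ _).trans (min_le_right _ _)) (by linarith)
    · exact lt_of_le_of_lt (min_le_right _ _) (by linarith [Real.pi_pos])
  have hbox : ∀ r t, |r - 1| ≤ ε → |t - t0| ≤ ε → (r, t) ∈ U1 ∧ (r, t) ∈ U2 ∧ 0 < pr f r t := by
    intro r t hr ht
    have : (r, t) ∈ Metric.ball ((1:ℝ), t0) e1 := by
      rw [Metric.mem_ball, Prod.dist_eq, Real.dist_eq, Real.dist_eq]
      exact max_lt (by linarith) (by linarith)
    obtain ⟨⟨h5, h6⟩, h7⟩ := hb1 this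
    exact ⟨h5, h6, h7⟩
  have hiso : ∀ t, |t - t0| ≤ ε → t ≠ t0 → pt f 1 t ≠ 0 := fun t ht => hb2 (by rw [Real.dist_eq]; linarith)
  set η := bmp t0 (ε/2) ε with hη
  have hηs : Sm η := bmp_smooth _ _ _
  have hηp : Function.Periodic η τ := bmp_per _ _ _
  have hηone : ∀ t, Real.cos (ε/2) < Real.cos (t - t0) → η t = 1 ∧ deriv η t = 0 := by
    intro t ht
    have hh : ∀ᶠ s in nhds t, η s = 1 := by
      have : ContinuousAt (fun s => Real.cos (s - t0)) t := by fun_prop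
      filter_upwards [this.eventually (lt_mem_nhds ht)] with s hs
      exact bmp_one (by linarith) (by linarith) hε3.le hs.le
    refine ⟨hh.self_of_nhds, ?_⟩
    rw [Filter.EventuallyEq.deriv_eq (f := fun _ => (1:ℝ)) hh]; simp
  have hηzero : ∀ t, Real.cos (t - t0) < Real.cos ε → ∀ᶠ s in nhds t, η s = 0 := by
    intro t ht
    have : ContinuousAt (fun s => Real.cos (s - t0)) t := by fun_prop
    filter_upwards [this.eventually (gt_mem_nhds ht)] with s hs
    exact bmp_zero (by linarith) (by linarith) hε3.le hs.le
  have hnode : ∀ t, Real.cos ε ≤ Real.cos (t - t0) → sphPt t ≠ sphPt t0 → pt f 1 t ≠ 0 := by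
    intro t ht hne
    obtain ⟨k, hk⟩ := (cos_ge_iff hε.le hε3.le).1 ht
    have := hiso _ hk ?_
    · rwa [(pt_periodic f 1).int_mul k t] at this
    · intro h; apply hne
      rw [← h, sphPt_periodic.int_mul k t]
  obtain ⟨δ0, hδ0, hδ02, hP⟩ := unif_collar (P := fun r t => (η t = 0 ∧ deriv η t = 0) ∨
      (∀ B, |B| ≤ Λ * |r - 1| → pt f r t + B * deriv η t ≠ 0) ∨ Real.cos (ε/2) < Real.cos (t - t0)) (by
    intro t
    by_cases h3 : Real.cos (ε/2) < Real.cos (t - t0)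
    · have : ContinuousAt (fun s => Real.cos (s - t0)) t := by fun_prop
      filter_upwards [(continuous_snd.tendsto ((1:ℝ), t)).eventually (this.eventually (lt_mem_nhds h3))] with p hp
      exact Or.inr (Or.inr hp)
    · by_cases h4 : Real.cos (t - t0) < Real.cos ε
      · filter_upwards [(continuous_snd.tendsto ((1:ℝ), t)).eventually (ev_zero_deriv (hηzero t h4))] with p hp
        exact Or.inl hp
      · push Not at h3 h4
        have : pt f 1 t ≠ 0 := by
          refine hnode t h4 ?_
          intro h5
          have h6 := sphPt_inner t t0
          rw [h5, real_inner_self_eq_norm_sq, sphPt_norm] at h6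
          have h7 := cos_lt_of_lt le_rfl (show 0 < ε/2 by linarith) (by linarith)
          rw [Real.cos_zero] at h7
          linarith
        filter_upwards [small_pert hf hηs Λ this] with p hp
        exact Or.inr (Or.inl hp))
  set C := 2 * |a| / |c| + 1 with hC
  have hC0 : 1 ≤ C := by have : 0 ≤ 2 * |a| / |c| := by positivity
                         linarith
  obtain ⟨δ, hδ, hδ1, hδ2, hδ3⟩ : ∃ δ, 0 < δ ∧ δ ≤ δ0 ∧ δ ≤ ε ∧ δ * (K * C) < 2 * Λ := by
    have hKC : 0 ≤ K * C := by positivity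
    refine ⟨min (min δ0 ε) (Λ / (K * C + 1)), by positivity, (min_le_left _ _).trans (min_le_left _ _),
      (min_le_left _ _).trans (min_le_right _ _), ?_⟩
    have h5 : min (min δ0 ε) (Λ / (K * C + 1)) * (K * C) ≤ Λ / (K * C + 1) * (K * C) := by
      gcongr; exact min_le_right _ _
    have h6 : Λ / (K * C + 1) * (K * C) ≤ Λ := by
      rw [div_mul_eq_mul_div, div_le_iff₀ (by positivity)]; nlinarith
    linarith
  have hβs := flp_smooth Λ δ
  have hβz : ∀ r ≤ 1 - δ, flp Λ δ r = 0 := by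
    intro r hr
    have : (r - 1 + δ) / δ ≤ 0 := div_nonpos_of_nonpos_of_nonneg (by linarith) hδ.le
    rw [flp, Real.smoothTransition.zero_of_nonpos (by linarith), mul_zero]
  have hβ0 : ∀ r ≤ 1/2, flp Λ δ r = 0 := fun r hr => hβz r (by linarith)
  have hcs := col_smooth hηp hηs hβs hβ0
  have hder1 : deriv (flp Λ δ) 1 = -Λ := by
    rw [flp_deriv hδ]
    have : (1 - 1 + δ) / δ = 1 := by field_simp; ring
    rw [this, Real.smoothTransition.one_of_one_le (by norm_num), st_deriv_one (by norm_num)]; ring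
  have hpr1 : ∀ t, pr (fun x => f x + col (flp Λ δ) η x) 1 t = pr f 1 t - Λ * η t := by
    intro t
    rw [pr_add hf hcs, pr_col hηp hηs hβs hβ0 one_pos, hder1]; ring
  refine ⟨fun x => f x + col (flp Λ δ) η x, hf.add hcs, fun t => ?_, ?_, fun t ht hne => ?_, ?_⟩
  · have := col_apply (β := flp Λ δ) hηp one_pos t
    rw [one_smul] at this
    beta_reduce; rw [this]; simp [flp]
  · rw [hpr1, (hηone t0 _).1]
    · linarith
    · rw [sub_self]; exact cos_lt_of_lt le_rfl (by linarith) (by linarith)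
  · rw [hpr1]
    have : Real.cos (t - t0) < Real.cos ε := by
      by_contra h5; push Not at h5; exact hnode t h5 hne ht
    rw [(hηzero t this).self_of_nhds]; ring
  · have key : ∀ x ∈ critPts (fun x => f x + col (flp Λ δ) η x), x ∉ critPts f →
        ∃ r t, 1 - δ < r ∧ r < 1 ∧ |t - t0| ≤ ε ∧ x = r • sphPt t ∧
          pt f r t = 0 ∧ pr f r t = Λ * (2 * ((r - 1 + δ) / δ) - 1) := by
      intro x hx hxf
      rcases collar_crit hf hηp hηs hβs hδ (by linarith) hβz hx with h3 | ⟨r, t, h3, h4, h5, h6, h7, h8⟩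
      · exact absurd h3 hxf
      have hu0 : 0 < (r - 1 + δ) / δ := div_pos (by linarith) hδ
      have hu1 : (r - 1 + δ) / δ < 1 := by rw [div_lt_one hδ]; linarith
      have hst0 := Real.smoothTransition.nonneg (4 * ((r - 1 + δ) / δ))
      have hst1 := Real.smoothTransition.le_one (4 * ((r - 1 + δ) / δ))
      rcases hP δ hδ1 r h3 h4 t h5 with ⟨h9, h10⟩ | h9 | h9
      · exfalso; apply hxf
        rw [h9] at h7; rw [h10] at h8
        refine ⟨by rw [h6, mem_ball_zero_iff, rsph_norm (by linarith)]; exact h4, ?_⟩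
        rw [h6, crit_iff (by linarith)]
        constructor <;> linarith
      · exfalso
        refine h9 _ ?_ h8
        have e1 : 0 ≤ 1 - r := by linarith
        rw [abs_sub_comm r 1, abs_of_nonneg e1, abs_of_nonneg (by unfold flp; positivity), flp]
        calc Λ * ((1 - r) * ((r - 1 + δ) / δ)) * _ ≤ Λ * ((1 - r) * 1) * 1 := by gcongr
          _ = _ := by ring
      · obtain ⟨k, hk⟩ := (cos_ge_iff (e := ε/2) (by linarith) (by linarith)).1 h9.le
        obtain ⟨h10, h11⟩ := hηone t h9
        rw [h10] at h7; rw [h11] at h8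
        have hper : sphPt (t + k * τ) = sphPt t := sphPt_periodic.int_mul k t
        refine ⟨r, t + k * τ, h3, h4, by linarith, by rw [hper]; exact h6, ?_, ?_⟩
        · rw [(pt_periodic f r).int_mul k t]; linarith
        · have hpos := (hbox r (t + k * τ) (by rw [abs_le]; constructor <;> linarith) (by linarith)).2.2
          have hpe : pr f r (t + k * τ) = pr f r t := (pr_periodic f r).int_mul k t
          rw [hpe] at hpos ⊢
          rw [flp_deriv hδ] at h7
          have hd0 := st_deriv_nonneg (4 * ((r - 1 + δ) / δ))
          have e1 : 0 ≤ 1 - r := by linarith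
          by_cases hu : (r - 1 + δ) / δ ≤ 1/2
          · exfalso
            have e2 : 0 ≤ 1 - 2 * ((r - 1 + δ) / δ) := by linarith
            have : 0 ≤ Λ * (1 - 2 * ((r - 1 + δ) / δ)) * Real.smoothTransition (4 * ((r - 1 + δ) / δ)) := by positivity
            have : 0 ≤ Λ * ((1 - r) * ((r - 1 + δ) / δ)) *
              (deriv Real.smoothTransition (4 * ((r - 1 + δ) / δ)) * (4 * (1 / δ))) := by positivity
            linarith
          · push Not at hu
            rw [Real.smoothTransition.one_of_one_le (by linarith), st_deriv_one (by linarith)] at h7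
            linarith
    apply subsingleton_sub
    intro x hx y hy hxf hyf
    obtain ⟨r1, t1, q1, q2, q3, q4, q5, q6⟩ := key x hx hxf
    obtain ⟨r2, t2, p1, p2, p3, p4, p5, p6⟩ := key y hy hyf
    have b1 := hbox r1 t1 (by rw [abs_le]; constructor <;> linarith) q3
    have b2 := hbox r2 t2 (by rw [abs_le]; constructor <;> linarith) p3
    have hdt : |t1 - t2| ≤ C * |r1 - r2| := by
      have h5 := hU1' (Set.mk_mem_prod b1.1 b2.1)
      simp only [Set.mem_ofPred_eq, q5, p5, Prod.mk_sub_mk, hlin, Real.norm_eq_abs, Prod.norm_def] at h5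
      have h6 : max |r1 - r2| |t1 - t2| ≤ |r1 - r2| + |t1 - t2| :=
        max_le (by linarith [abs_nonneg (t1 - t2)]) (by linarith [abs_nonneg (r1 - r2)])
      have h7 : |c * (t1 - t2)| ≤ |0 - 0 - (a * (r1 - r2) + c * (t1 - t2))| + |a * (r1 - r2)| := by
        have := abs_add_le (-(0 - 0 - (a * (r1 - r2) + c * (t1 - t2)))) (-(a * (r1 - r2)))
        rw [abs_neg, abs_neg] at this
        refine le_trans (le_of_eq ?_) this
        congr 1; ring
      rw [abs_mul, abs_mul] at h7
      have h8 : |c| / 2 * max |r1 - r2| |t1 - t2| ≤ |c| / 2 * (|r1 - r2| + |t1 - t2|) := by gcongr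
      have h9 : |c| * |t1 - t2| ≤ (2 * |a| + |c|) * |r1 - r2| := by
        have h11 := h7.trans (add_le_add_left (h5.trans h8) _)
        clear h5 h6 h7 h8
        linarith
      have h10 : C * |c| = 2 * |a| + |c| := by rw [hC]; field_simp
      rw [← h10] at h9
      refine le_of_mul_le_mul_left (h9.trans (le_of_eq (by ring))) hcpos
    have hdr : r1 = r2 := by
      by_contra hne
      have hpos : 0 < |r1 - r2| := abs_pos.2 (sub_ne_zero.2 hne)
      have h5 := hLip.dist_le_mul _ b1.2.1 _ b2.2.1
      rw [Real.dist_eq, Prod.dist_eq, Real.dist_eq, Real.dist_eq] at h5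
      simp only [q6, p6] at h5
      have h6 : max |r1 - r2| |t1 - t2| ≤ C * |r1 - r2| := max_le (by nlinarith) hdt
      have h7 : |Λ * (2 * ((r1 - 1 + δ) / δ) - 1) - Λ * (2 * ((r2 - 1 + δ) / δ) - 1)| = 2 * Λ * |r1 - r2| / δ := by
        rw [show Λ * (2 * ((r1 - 1 + δ) / δ) - 1) - Λ * (2 * ((r2 - 1 + δ) / δ) - 1) = (2 * Λ / δ) * (r1 - r2) by field_simp; ring,
          abs_mul, abs_of_pos (by positivity)]; ring
      rw [h7, div_le_iff₀ hδ] at h5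
      have h8 : (K:ℝ) * max |r1 - r2| |t1 - t2| * δ ≤ K * (C * |r1 - r2|) * δ := by gcongr
      have h9 : δ * (K * C) * |r1 - r2| < 2 * Λ * |r1 - r2| := by gcongr
      linarith
    rw [hdr] at hdt
    have : t1 = t2 := by
      simp at hdt; linarith
    rw [q4, p4, hdr, this]

lemma bmp_one' {c e1 e2 t : ℝ} (h0 : 0 ≤ e1) (h1 : e1 < e2) (h2 : e2 ≤ Real.pi)
    (h : |t - c| ≤ e1) : bmp c e1 e2 t = 1 := by
  apply bmp_one h0 h1 h2
  rw [← Real.cos_abs (t - c)]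
  exact Real.cos_le_cos_of_nonneg_of_le_pi (abs_nonneg _) (by linarith) h

lemma bmp_zero' {c e1 e2 t : ℝ} (h0 : 0 ≤ e1) (h1 : e1 < e2) (h2 : e2 ≤ Real.pi)
    (h : e2 ≤ |t - c|) (h' : |t - c| ≤ τ - e2) : bmp c e1 e2 t = 0 := by
  apply bmp_zero h0 h1 h2
  rw [← Real.cos_abs (t - c)]
  by_cases h3 : |t - c| ≤ Real.pi
  · exact Real.cos_le_cos_of_nonneg_of_le_pi (by linarith) h3 h
  · push Not at h3
    rw [← Real.cos_two_pi_sub |t - c|]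
    simp only [τ] at h'
    exact Real.cos_le_cos_of_nonneg_of_le_pi (by linarith) (by linarith) (by linarith)

lemma prim_smooth {d : ℝ → ℝ} (hd : Sm d) (a : ℝ) : Sm (fun t => ∫ s in a..t, d s) ∧
    ∀ t, deriv (fun t => ∫ s in a..t, d s) t = d t := by
  have h1 : ∀ t, HasDerivAt (fun t => ∫ s in a..t, d s) (d t) t := fun t =>
    (hd.continuous.integral_hasStrictDerivAt a t).hasDerivAt
  have h2 : deriv (fun t => ∫ s in a..t, d s) = d := funext fun t => (h1 t).deriv
  refine ⟨?_, fun t => (h1 t).deriv⟩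
  refine contDiff_infty_iff_deriv.2 ⟨fun t => (h1 t).differentiableAt, ?_⟩
  rw [h2]; exact hd

lemma pos_min {g : ℝ → ℝ} (hg : Continuous g) {a b : ℝ} (hab : a ≤ b) (h : ∀ t ∈ Set.Icc a b, 0 < g t) :
    ∃ m > 0, ∀ t ∈ Set.Icc a b, m ≤ g t := by
  obtain ⟨x, hx, hm⟩ := isCompact_Icc.exists_isMinOn (Set.nonempty_Icc.2 hab) hg.continuousOn
  exact ⟨g x, h x hx, fun t ht => hm ht⟩

lemma rem1D {φ : ℝ → ℝ} (hφ : Sm φ) (hp : Function.Periodic φ τ) {L X Y M : ℝ} (hLX : L < X)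
    (hXY : X < Y) (hYM : Y < M) (hML : M < L + τ)
    (h1 : ∀ t ∈ Set.Ioo L X, 0 < deriv φ t) (h2 : ∀ t ∈ Set.Ioo X Y, deriv φ t < 0)
    (h3 : ∀ t ∈ Set.Ioo Y M, 0 < deriv φ t) (hXM : φ X < φ M) :
    ∃ (ψ : ℝ → ℝ) (a b : ℝ), Sm ψ ∧ Function.Periodic ψ τ ∧ L < a ∧ b < M ∧
      (∀ t ∈ Set.Icc b (a + τ), ψ t = φ t) ∧ (∀ t ∈ Set.Ioo L M, 0 < deriv ψ t) ∧
      (∀ t ∈ Set.Icc X Y, ∀ᶠ s in nhds t, φ s ≤ ψ s) := by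
  have hφd : ∀ t, HasDerivAt φ (deriv φ t) t := fun t => ((sm_diff hφ) t).hasDerivAt
  have hφc := hφ.continuous
  have hdc : Continuous (deriv φ) := (deriv_sm hφ).continuous
  obtain ⟨x1, hx1L, hx1X⟩ := exists_between hLX
  obtain ⟨y1, hy1, hYy1, hy1M⟩ : ∃ y1, φ X < φ y1 ∧ Y < y1 ∧ y1 < M := by
    have e1 : ∀ᶠ s in nhdsWithin M (Set.Iio M), φ X < φ s :=
      (hφc.continuousAt.eventually (lt_mem_nhds hXM)).filter_mono nhdsWithin_le_nhds
    have e2 : ∀ᶠ s in nhdsWithin M (Set.Iio M), Y < s :=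
      (lt_mem_nhds hYM).filter_mono nhdsWithin_le_nhds
    have e3 : ∀ᶠ s in nhdsWithin M (Set.Iio M), s < M := self_mem_nhdsWithin
    obtain ⟨s, hs⟩ := (e1.and (e2.and e3)).exists
    exact ⟨s, hs.1, hs.2.1, hs.2.2⟩
  obtain ⟨m, hm, hm1, hm2⟩ : ∃ m > 0, L < x1 - 3 * m ∧ y1 + m < M := by
    refine ⟨min (x1 - L) (M - y1) / 4, by have := sub_pos.2 hx1L; have := sub_pos.2 hy1M; positivity, ?_, ?_⟩
    · linarith [min_le_left (x1 - L) (M - y1)]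
    · linarith [min_le_right (x1 - L) (M - y1)]
  set a := x1 - 3 * m with ha
  set b := y1 + m with hb
  obtain ⟨m1, hm1p, hm1'⟩ := pos_min hdc (a := a) (b := x1) (by linarith)
    (fun t ht => h1 t ⟨by linarith [ht.1], by linarith [ht.2]⟩)
  obtain ⟨m2, hm2p, hm2'⟩ := pos_min hdc (a := y1) (b := b) (by linarith)
    (fun t ht => h3 t ⟨by linarith [ht.1], by linarith [ht.2]⟩)
  obtain ⟨ε, hε, hε1, hε2, hε3⟩ : ∃ ε > 0, ε ≤ m1 ∧ ε ≤ m2 ∧ ε * (y1 - x1) ≤ φ y1 - φ X := by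
    have q1 := sub_pos.2 hy1
    have q2 : 0 < y1 - x1 := by linarith
    refine ⟨min (min m1 m2) ((φ y1 - φ X) / (y1 - x1)), by positivity,
      (min_le_left _ _).trans (min_le_left _ _), (min_le_left _ _).trans (min_le_right _ _), ?_⟩
    rw [← le_div_iff₀ q2]; exact min_le_right _ _
  set c := (x1 + y1) / 2 with hc
  set e1 := (y1 - x1) / 2 with he1
  have he0 : 0 ≤ e1 := by linarith
  have he2 : e1 + m ≤ Real.pi := by simp only [τ] at hML; linarith
  set χ := bmp c e1 (e1 + m) with hχ
  have hχ1 : ∀ t ∈ Set.Icc x1 y1, χ t = 1 := fun t ht =>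
    bmp_one' he0 (by linarith) he2 (by rw [abs_le]; constructor <;> linarith [ht.1, ht.2])
  have hχ0 : ∀ t ∈ Set.Icc a (x1 - m), χ t = 0 := fun t ht => by
    have : t - c ≤ 0 := by linarith [ht.2]
    refine bmp_zero' he0 (by linarith) he2 ?_ ?_ <;> rw [abs_of_nonpos this] <;> linarith [ht.1, ht.2]
  have hχ2 : ∀ t ∈ Set.Icc b (a + τ), χ t = 0 := fun t ht => by
    have : 0 ≤ t - c := by linarith [ht.1]
    refine bmp_zero' he0 (by linarith) he2 ?_ ?_ <;> rw [abs_of_nonneg this] <;> linarith [ht.1, ht.2]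
  set B := bmp (x1 - 2 * m) (m/4) (m/2) with hB
  have hmpi : m / 2 ≤ Real.pi := by linarith
  have hB0 : ∀ t ∈ Set.Icc (x1 - m) (a + τ), B t = 0 := fun t ht => by
    have : 0 ≤ t - (x1 - 2 * m) := by linarith [ht.1]
    refine bmp_zero' (by linarith) (by linarith) hmpi ?_ ?_ <;> rw [abs_of_nonneg this] <;> linarith [ht.1, ht.2]
  have hBc : B (x1 - 2 * m) = 1 := bmp_one' (by linarith) (by linarith) hmpi (by simp; linarith)
  have hBnn : ∀ t, 0 ≤ B t := bmp_nonneg _ _ _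
  have hχs : Sm χ := bmp_smooth _ _ _
  have hBs : Sm B := bmp_smooth _ _ _
  set u : ℝ → ℝ := fun t => χ t * (deriv φ t - ε) with hu
  have hus : Sm u := hχs.mul ((deriv_sm hφ).sub contDiff_const)
  have huc := hus.continuous
  have hBcont := hBs.continuous
  have ui : ∀ p q, IntervalIntegrable u MeasureTheory.volume p q := fun p q => huc.intervalIntegrable p q
  have Bi : ∀ p q, IntervalIntegrable B MeasureTheory.volume p q := fun p q => hBcont.intervalIntegrable p q
  have hχnn : ∀ t, 0 ≤ χ t := bmp_nonneg _ _ _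
  have hχle : ∀ t, χ t ≤ 1 := bmp_le_one _ _ _
  have H : ∀ t ∈ Set.Icc x1 y1, φ y1 - φ t - ε * (y1 - t) ≤ ∫ s in t..b, u s := by
    intro t ht
    rw [← intervalIntegral.integral_add_adjacent_intervals (ui t y1) (ui y1 b)]
    have q1 : 0 ≤ ∫ s in y1..b, u s := by
      apply intervalIntegral.integral_nonneg (by linarith)
      intro s hs
      exact mul_nonneg (hχnn s) (by linarith [hm2' s hs])
    have q2 : ∫ s in t..y1, u s = φ y1 - φ t - ε * (y1 - t) := by
      have : ∫ s in t..y1, u s = ∫ s in t..y1, (deriv φ s - ε) := by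
        apply intervalIntegral.integral_congr
        intro s hs
        rw [Set.uIcc_of_le ht.2] at hs
        simp only [hu, hχ1 s ⟨by linarith [ht.1, hs.1], hs.2⟩, one_mul]
      rw [this, intervalIntegral.integral_sub (hdc.intervalIntegrable _ _) (by simp),
        intervalIntegral.integral_eq_sub_of_hasDerivAt (fun s _ => hφd s) (hdc.intervalIntegrable _ _)]
      simp; ring
    linarith
  set IB := ∫ s in a..b, B s with hIB
  have hIBp : 0 < IB := by
    exact intervalIntegral.integral_pos (by linarith) hBcont.continuousOn (fun s _ => hBnn s)
      ⟨x1 - 2 * m, ⟨by linarith, by linarith⟩, by rw [hBc]; exact one_pos⟩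
  set Iu := ∫ s in a..b, u s with hIu
  -- values of φ on the increasing and decreasing pieces
  have mono1 : ∀ s ∈ Set.Icc x1 X, φ s ≤ φ X := by
    intro s hs
    have : MonotoneOn φ (Set.Icc x1 X) := by
      apply monotoneOn_of_deriv_nonneg (convex_Icc _ _) hφc.continuousOn (sm_diff hφ).differentiableOn
      intro t ht; rw [interior_Icc] at ht
      exact (h1 t ⟨by linarith [ht.1], ht.2⟩).le
    exact this hs ⟨hs.1.trans hs.2, le_rfl⟩ hs.2
  have anti : StrictAntiOn φ (Set.Icc X Y) := by
    apply strictAntiOn_of_deriv_neg (convex_Icc _ _) hφc.continuousOn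
    intro t ht; rw [interior_Icc] at ht; exact h2 t ht
  have hIu0 : 0 ≤ Iu := by
    rw [hIu, ← intervalIntegral.integral_add_adjacent_intervals (ui a x1) (ui x1 b)]
    have q1 : 0 ≤ ∫ s in a..x1, u s := by
      apply intervalIntegral.integral_nonneg (by linarith)
      intro s hs
      exact mul_nonneg (hχnn s) (by linarith [hm1' s hs])
    have := H x1 ⟨le_rfl, by linarith⟩
    have := mono1 x1 ⟨le_rfl, hx1X.le⟩
    linarith
  set α := Iu / IB with hα
  have hα0 : 0 ≤ α := div_nonneg hIu0 hIBp.le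
  set d : ℝ → ℝ := fun t => α * B t - u t with hd
  have hds : Sm d := (contDiff_const.mul hBs).sub hus
  have hdp : Function.Periodic d τ := by
    intro t
    simp only [hd, hu, hB, hχ, bmp_per _ _ _ t, deriv_per hp t]
  obtain ⟨hDs, hDd⟩ := prim_smooth hds a
  set D : ℝ → ℝ := fun t => ∫ s in a..t, d s with hD
  have hDform : ∀ p q, ∫ s in p..q, d s = α * (∫ s in p..q, B s) - ∫ s in p..q, u s := by
    intro p q
    rw [hd, intervalIntegral.integral_sub ((Bi p q).const_mul α) (ui p q), intervalIntegral.integral_const_mul]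
  have hDb : D b = 0 := by
    simp only [hD]; rw [hDform, ← hIB, ← hIu, hα]; field_simp; ring
  have hDout : ∀ t ∈ Set.Icc b (a + τ), D t = 0 := by
    intro t ht
    have : D t = D b + ∫ s in b..t, d s :=
      (intervalIntegral.integral_add_adjacent_intervals (hds.continuous.intervalIntegrable _ _)
        (hds.continuous.intervalIntegrable _ _)).symm
    rw [this, hDb, zero_add, intervalIntegral.integral_congr (g := fun _ => 0), intervalIntegral.integral_zero]
    intro s hs
    rw [Set.uIcc_of_le ht.1] at hs
    simp only [hd, hu, hχ2 s ⟨hs.1, hs.2.trans ht.2⟩, hB0 s ⟨by linarith [hs.1], hs.2.trans ht.2⟩]; simp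
  have hDper : Function.Periodic D τ := by
    intro t
    have e1 : D (t + τ) = D t + ∫ s in t..(t + τ), d s :=
      (intervalIntegral.integral_add_adjacent_intervals (hds.continuous.intervalIntegrable _ _)
        (hds.continuous.intervalIntegrable _ _)).symm
    rw [e1, hdp.intervalIntegral_add_eq t a]
    have := hDout (a + τ) ⟨by linarith, le_rfl⟩
    simp only [hD] at this
    rw [this, add_zero]
  refine ⟨fun t => φ t + D t, a, b, hφ.add hDs, fun t => by simp only [hp t, hDper t], hm1, hm2,
    fun t ht => by simp [hDout t ht], fun t ht => ?_, fun t ht => ?_⟩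
  · rw [deriv_fun_add ((sm_diff hφ) t) ((sm_diff hDs) t), hDd]
    simp only [hd, hu]
    have hb1 := mul_nonneg hα0 (hBnn t)
    by_cases hin : t ∈ Set.Icc x1 y1
    · rw [hχ1 t hin]; linarith
    · have hpos : 0 < deriv φ t := by
        rw [Set.mem_Icc, not_and_or] at hin
        rcases hin with h | h
        · exact h1 t ⟨ht.1, by linarith⟩
        · exact h3 t ⟨by linarith, ht.2⟩
      have hχlt := hχle t
      have := hχnn t
      by_cases hχ' : χ t = 1
      · rw [hχ']; linarith
      · have : 0 < (1 - χ t) := by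
          have := lt_of_le_of_ne hχlt hχ'; linarith
        have := mul_pos this hpos
        have := mul_nonneg (hχnn t) hε.le
        nlinarith
  · have hYlt : φ Y < φ X := anti ⟨le_rfl, hXY.le⟩ ⟨hXY.le, le_rfl⟩ hXY
    have ev : ∀ᶠ s in nhds t, s ∈ Set.Icc x1 y1 ∧ φ s ≤ φ X := by
      have hin : ∀ᶠ s in nhds t, s ∈ Set.Icc x1 y1 :=
        Icc_mem_nhds (by linarith [ht.1]) (by linarith [ht.2])
      rcases eq_or_lt_of_le ht.1 with h | h
      · filter_upwards [hin, Iio_mem_nhds (show t < Y by linarith)] with s hs hs2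
        refine ⟨hs, ?_⟩
        rcases le_total s X with h4 | h4
        · exact mono1 s ⟨hs.1, h4⟩
        · exact anti.antitoneOn ⟨le_rfl, hXY.le⟩ ⟨h4, le_of_lt hs2⟩ h4
      · have : φ t < φ X := anti ⟨le_rfl, hXY.le⟩ ht h
        filter_upwards [hin, hφc.continuousAt.eventually (gt_mem_nhds this)] with s hs hs2
        exact ⟨hs, le_of_lt hs2⟩
    filter_upwards [ev] with s hs
    have hDs' : D s = ∫ r in s..b, u r := by
      have e1 : D s + ∫ r in s..b, d r = D b :=
        intervalIntegral.integral_add_adjacent_intervals (hds.continuous.intervalIntegrable _ _)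
          (hds.continuous.intervalIntegrable _ _)
      rw [hDb, hDform, intervalIntegral.integral_congr (f := B) (g := fun _ => 0), intervalIntegral.integral_zero] at e1
      · linarith
      · intro r hr
        have hsb : s ≤ b := by linarith [hs.1.2]
        rw [Set.uIcc_of_le hsb] at hr
        exact hB0 r ⟨by linarith [hs.1.1, hr.1], by linarith [hr.2]⟩
    have h5 := H s hs.1
    have h6 : ε * (y1 - s) ≤ ε * (y1 - x1) := by
      apply mul_le_mul_of_nonneg_left _ hε.le; linarith [hs.1.1]
    rw [hDs']
    linarith [hs.2]

lemma exists_shift (a t : ℝ) : ∃ k : ℤ, t + k * τ ∈ Set.Ico a (a + τ) := by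
  obtain ⟨k, hk, -⟩ := existsUnique_add_zsmul_mem_Ico tau_pos t a
  exact ⟨k, by simpa [zsmul_eq_mul] using hk⟩

lemma ev_shift {P : ℝ → Prop} {t : ℝ} (k : ℤ) (hP : ∀ s, P (s + k * τ) → P s)
    (h : ∀ᶠ s in nhds (t + k * τ), P s) : ∀ᶠ s in nhds t, P s := by
  have : Filter.Tendsto (fun s : ℝ => s + k * τ) (nhds t) (nhds (t + k * τ)) :=
    (continuous_id.add continuous_const).tendsto t
  exact (this.eventually h).mono hP

lemma lem_Int_per {f : E2 → ℝ} (hf : Sm f) {φ : ℝ → ℝ} (hφ : Sm φ) (hp : Function.Periodic φ τ) (a : ℝ)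
    (h : ∀ t ∈ Set.Ico a (a + τ), 0 < deriv φ t * pt f 1 t ∨
      (0 < pr f 1 t ∧ ∀ᶠ s in nhds t, f (sphPt s) ≤ φ s) ∨
      (pr f 1 t < 0 ∧ ∀ᶠ s in nhds t, φ s ≤ f (sphPt s))) :
    ∃ g : E2 → ℝ, Sm g ∧ (∀ t, g (sphPt t) = φ t) ∧ (∀ t, pr g 1 t = pr f 1 t) ∧
      critPts g ⊆ critPts f := by
  apply lem_Int hf hφ hp
  intro t
  obtain ⟨k, hk⟩ := exists_shift a t
  have h1 := h _ hk
  rw [(deriv_per hp).int_mul k t, (pt_periodic f 1).int_mul k t, (pr_periodic f 1).int_mul k t] at h1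
  refine h1.imp id (Or.imp (And.imp id (ev_shift k fun s hs => ?_)) (And.imp id (ev_shift k fun s hs => ?_)))
  · rwa [hp.int_mul k s, sphPt_periodic.int_mul k s] at hs
  · rwa [hp.int_mul k s, sphPt_periodic.int_mul k s] at hs

def ExtR (φ : ℝ → ℝ) (ν : ℝ → ℤ) (f : E2 → ℝ) : Prop :=
  Sm f ∧ (∀ t, f (sphPt t) = φ t) ∧
    ∀ t, deriv φ t = 0 → 0 < (ν t : ℝ) * (-deriv (deriv φ) t) * pr f 1 t

def QQ (φ : ℝ → ℝ) (ν : ℝ → ℤ) (q : ℕ) : Prop := ∃ f, ExtR φ ν f ∧ (critPts f).encard ≤ q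

lemma QQ_congr {φ : ℝ → ℝ} {ν ν' : ℝ → ℤ} {q : ℕ} (h : ∀ t, deriv φ t = 0 → ν t = ν' t)
    (hQ : QQ φ ν q) : QQ φ ν' q := by
  obtain ⟨f, ⟨h1, h2, h3⟩, h4⟩ := hQ
  exact ⟨f, ⟨h1, h2, fun t ht => by rw [← h t ht]; exact h3 t ht⟩, h4⟩

lemma QQ_neg {φ : ℝ → ℝ} {ν : ℝ → ℤ} {q : ℕ} (hQ : QQ φ ν q) : QQ (fun t => - φ t) ν q := by
  obtain ⟨f, ⟨h1, h2, h3⟩, h4⟩ := hQ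
  have hpr : ∀ t, pr (fun x => - f x) 1 t = - pr f 1 t := fun t => by simp [pr]
  refine ⟨fun x => - f x, ⟨h1.neg, fun t => by simp [h2], fun t ht => ?_⟩, ?_⟩
  · simp only [deriv.fun_neg', neg_eq_zero] at ht ⊢
    rw [hpr]
    have := h3 t ht
    linarith
  · have : critPts (fun x => - f x) = critPts f := by
      ext x; simp [critPts]
    rw [this]; exact h4

/-- reflection of the plane -/
def rfl2 (x : E2) : E2 := (EuclideanSpace.equiv (Fin 2) ℝ).symm ![x 0, - x 1]

lemma rfl2_rfl2 (x : E2) : rfl2 (rfl2 x) = x := by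
  apply E2_ext
  · rfl
  · change - - x 1 = x 1; ring

def rflL : E2 →ₗ[ℝ] E2 where
  toFun := rfl2
  map_add' x y := by
    apply E2_ext
    · rfl
    · change -(x 1 + y 1) = - x 1 + - y 1; ring
  map_smul' c x := by
    apply E2_ext
    · rfl
    · change -(c * x 1) = c * (- x 1); ring

def rflE : E2 ≃L[ℝ] E2 :=
  (LinearEquiv.ofLinearMap rflL rflL (by ext1 x; exact rfl2_rfl2 x) (by ext1 x; exact rfl2_rfl2 x)).toContinuousLinearEquiv

lemma rflE_apply (x : E2) : rflE x = rfl2 x := rfl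

lemma rflE_sph (t : ℝ) : rflE (sphPt t) = sphPt (-t) := by
  apply E2_ext
  · change Real.cos t = Real.cos (-t); simp
  · change - Real.sin t = Real.sin (-t); simp

lemma rflE_norm (x : E2) : ‖rflE x‖ = ‖x‖ := by
  have h1 := E2_norm_sq x
  have h2 := E2_norm_sq (rflE x)
  have h3 : (rflE x) 0 = x 0 := rfl
  have h4 : (rflE x) 1 = - x 1 := rfl
  rw [h3, h4] at h2
  nlinarith [norm_nonneg x, norm_nonneg (rflE x)]

lemma deriv_refl (φ : ℝ → ℝ) (t : ℝ) : deriv (fun t => φ (-t)) t = - deriv φ (-t) := by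
  exact deriv_comp_neg φ t

lemma deriv2_refl (φ : ℝ → ℝ) (t : ℝ) : deriv (deriv (fun t => φ (-t))) t = deriv (deriv φ) (-t) := by
  have : deriv (fun t => φ (-t)) = fun t => - deriv φ (-t) := funext (deriv_refl φ)
  rw [this, deriv.fun_neg, deriv_refl]; ring

lemma QQ_refl {φ : ℝ → ℝ} {ν : ℝ → ℤ} {q : ℕ} (hQ : QQ φ ν q) :
    QQ (fun t => φ (-t)) (fun t => ν (-t)) q := by
  obtain ⟨f, ⟨h1, h2, h3⟩, h4⟩ := hQ
  have hfd : ∀ x, fderiv ℝ (fun x => f (rflE x)) x = (fderiv ℝ f (rflE x)).comp (rflE : E2 →L[ℝ] E2) :=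
    fun x => (((sm_diff h1) _).hasFDerivAt.comp x rflE.hasFDerivAt).fderiv
  refine ⟨fun x => f (rflE x), ⟨h1.comp rflE.contDiff, fun t => by beta_reduce; rw [rflE_sph]; exact h2 _, fun t ht => ?_⟩, ?_⟩
  · rw [deriv_refl, neg_eq_zero] at ht
    rw [deriv2_refl]
    have hpr : pr (fun x => f (rflE x)) 1 t = pr f 1 (-t) := by
      simp only [pr, hfd, one_smul, ContinuousLinearMap.comp_apply]
      change (fderiv ℝ f (rflE (sphPt t))) (rflE (sphPt t)) = _
      rw [rflE_sph]
    rw [hpr]; exact h3 _ ht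
  · have hsub : critPts (fun x => f (rflE x)) ⊆ rflE '' critPts f := by
      rintro x ⟨hx1, hx2⟩
      refine ⟨rflE x, ⟨by simpa [rflE_norm] using hx1, ?_⟩, rfl2_rfl2 x⟩
      rw [hfd] at hx2
      ext v
      have := congrArg (fun L : E2 →L[ℝ] ℝ => L (rflE v)) hx2
      simp only [ContinuousLinearMap.comp_apply] at this
      change (fderiv ℝ f (rflE x)) (rflE (rflE v)) = _ at this
      rwa [show rflE (rflE v) = v from rfl2_rfl2 v] at this
    exact ((Set.encard_le_encard hsub).trans (Set.encard_image_le _ _)).trans h4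

open Classical in
/-- update of a marking along a node class -/
def upd (ν : ℝ → ℤ) (t0 : ℝ) (z : ℤ) (t : ℝ) : ℤ := if sphPt t = sphPt t0 then z else ν t

lemma upd_same {ν : ℝ → ℤ} {t0 : ℝ} {z : ℤ} {t : ℝ} (h : sphPt t = sphPt t0) : upd ν t0 z t = z := if_pos h
lemma upd_ne {ν : ℝ → ℤ} {t0 : ℝ} {z : ℤ} {t : ℝ} (h : sphPt t ≠ sphPt t0) : upd ν t0 z t = ν t := if_neg h

lemma per_sph {α : Type*} {g : ℝ → α} (hg : Function.Periodic g τ) {s t : ℝ} (h : sphPt s = sphPt t) : g s = g t := by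
  obtain ⟨k, rfl⟩ := sphPt_eq_iff.1 h
  exact hg.int_mul k t

lemma QQ_flip_max {φ : ℝ → ℝ} (hp : Function.Periodic φ τ) {ν : ℝ → ℤ} {q : ℕ} {t0 : ℝ} (h1 : deriv φ t0 = 0)
    (h2 : deriv (deriv φ) t0 < 0) (hν : ν t0 = 1) (hQ : QQ φ ν q) : QQ φ (upd ν t0 (-1)) (q + 1) := by
  obtain ⟨f, ⟨hf, hb, hs⟩, hq⟩ := hQ
  have hpt : pt f 1 = deriv φ := funext fun t => pt_one hf hb t
  have hR : 0 < pr f 1 t0 := by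
    have := hs t0 h1
    rw [hν] at this
    push_cast at this
    rw [one_mul] at this
    exact pos_of_mul_pos_right this (by linarith)
  obtain ⟨g, hg, hgb, hg0, hgn, p, hgp⟩ := lem_Flip hf (t0 := t0) (by rw [hpt]; exact h1) (by rw [hpt]; exact h2.ne) hR
  refine ⟨g, ⟨hg, fun t => by rw [hgb, hb], fun t ht => ?_⟩, ?_⟩
  · by_cases hst : sphPt t = sphPt t0
    · rw [upd_same hst, per_sph (deriv_per (deriv_per hp)) hst, per_sph (pr_periodic g 1) hst]
      push_cast
      nlinarith
    · rw [upd_ne hst, hgn t (by rw [hpt]; exact ht) hst]; exact hs t ht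
  · calc (critPts g).encard ≤ (critPts f ∪ {p}).encard := Set.encard_le_encard hgp
      _ ≤ (critPts f).encard + ({p} : Set E2).encard := Set.encard_union_le _ _
      _ ≤ q + 1 := by rw [Set.encard_singleton]; gcongr
      _ = _ := by push_cast; rfl

lemma QQ_flip {φ : ℝ → ℝ} (hp : Function.Periodic φ τ) {ν : ℝ → ℤ} {q : ℕ} {t0 : ℝ} (h1 : deriv φ t0 = 0)
    (h2 : deriv (deriv φ) t0 ≠ 0) (hν : ν t0 = 1) (hQ : QQ φ ν q) : QQ φ (upd ν t0 (-1)) (q + 1) := by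
  rcases lt_or_gt_of_ne h2 with h3 | h3
  · exact QQ_flip_max hp h1 h3 hν hQ
  · have := QQ_flip_max (φ := fun t => - φ t) (fun t => by simp only [hp t]) (t0 := t0) (by simp [h1])
      (by simp only [deriv.fun_neg']; linarith) hν (QQ_neg hQ)
    have := QQ_neg this
    simpa using this

/-- allow a node to be flipped at cost one -/
lemma QQ_flip' {φ : ℝ → ℝ} (hp : Function.Periodic φ τ) {ν : ℝ → ℤ} (hνp : Function.Periodic ν τ) {q q' : ℕ} {t0 : ℝ} (h1 : deriv φ t0 = 0)
    (h2 : deriv (deriv φ) t0 ≠ 0) (hν : (ν t0 = 1 ∧ q' = q) ∨ (ν t0 = -1 ∧ q' = q + 1))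
    (hQ : QQ φ (upd ν t0 1) q) : QQ φ ν q' := by
  rcases hν with ⟨h, rfl⟩ | ⟨h, rfl⟩
  · refine QQ_congr (fun t ht => ?_) hQ
    by_cases hst : sphPt t = sphPt t0
    · rw [upd_same hst, per_sph hνp hst, h]
    · rw [upd_ne hst]
  · refine QQ_congr (fun t ht => ?_) (QQ_flip hp h1 h2 (upd_same rfl) hQ)
    by_cases hst : sphPt t = sphPt t0
    · rw [upd_same hst, per_sph hνp hst, h]
    · rw [upd_ne hst, upd_ne hst]

lemma birthA {φ ψ : ℝ → ℝ} (hφ : Sm φ) (hp : Function.Periodic φ τ) {L X Y M a b : ℝ} (hLX : L < X)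
    (hXY : X < Y) (hYM : Y < M) (hML : M < L + τ)
    (h1 : ∀ t ∈ Set.Ioo L X, 0 < deriv φ t) 
    (h3 : ∀ t ∈ Set.Ioo Y M, 0 < deriv φ t)
    (hX1 : deriv φ X = 0) (hX2 : deriv (deriv φ) X < 0) (hY1 : deriv φ Y = 0) (hY2 : 0 < deriv (deriv φ) Y)
    (hXYn : ∀ t ∈ Set.Ioo X Y, deriv φ t ≠ 0)
    (hpψ : Function.Periodic ψ τ) (hLa : L < a) (hbM : b < M)
    (he : ∀ t ∈ Set.Icc b (a + τ), ψ t = φ t) (hψ' : ∀ t ∈ Set.Ioo L M, 0 < deriv ψ t)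
    (hle : ∀ t ∈ Set.Icc X Y, ∀ᶠ s in nhds t, φ s ≤ ψ s)
    {ν : ℝ → ℤ} (hν : Function.Periodic ν τ) (hνX : ν X = -1) (hνY : ν Y = 1) {q : ℕ}
    (hQ : QQ ψ ν q) : QQ φ ν q := by
  obtain ⟨f, ⟨hf, hb, hs⟩, hq⟩ := hQ
  have hpt : pt f 1 = deriv ψ := funext fun t => pt_one hf hb t
  -- choose κ
  obtain ⟨m, hm, hm1, hm2⟩ : ∃ m > 0, L < X - 2 * m ∧ Y + 2 * m < M := by
    refine ⟨min (X - L) (M - Y) / 4, by have := sub_pos.2 hLX; have := sub_pos.2 hYM; positivity, ?_, ?_⟩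
    · have := sub_pos.2 hLX; linarith [min_le_left (X - L) (M - Y)]
    · have := sub_pos.2 hYM; linarith [min_le_right (X - L) (M - Y)]
  have hprc : Continuous (fun t => pr f 1 t) := (pr_cont hf).comp (by fun_prop : Continuous fun t : ℝ => ((1:ℝ), t))
  obtain ⟨C, hC⟩ := (isCompact_Icc (a := X) (b := Y)).exists_bound_of_continuousOn hprc.continuousOn
  have hC0 : 0 ≤ C := (norm_nonneg _).trans (hC X ⟨le_rfl, hXY.le⟩)
  set B := bmp ((X + Y) / 2) ((Y - X) / 2) ((Y - X) / 2 + m) with hB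
  have he2 : (Y - X) / 2 + m < Real.pi := by simp only [τ] at hML; linarith
  have hB1 : ∀ t ∈ Set.Icc X Y, B t = 1 := fun t ht =>
    bmp_one' (by linarith) (by linarith) he2.le (by rw [abs_le]; constructor <;> linarith [ht.1, ht.2])
  have hB0 : ∀ t ∈ Set.Icc (Y + m) (X - m + τ), B t = 0 := fun t ht => by
    have : 0 ≤ t - (X + Y) / 2 := by linarith [ht.1]
    refine bmp_zero' (by linarith) (by linarith) he2.le ?_ ?_ <;> rw [abs_of_nonneg this] <;> linarith [ht.1, ht.2]
  have hBp : Function.Periodic B τ := bmp_per _ _ _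
  set κ : ℝ → ℝ := fun t => -(C + 1) * B t with hκ
  have hκs : Sm κ := contDiff_const.mul (bmp_smooth _ _ _)
  have hκp : Function.Periodic κ τ := fun t => by simp only [hκ, hBp t]
  obtain ⟨f1, hf1, hf1b, hf1r, hf1c⟩ := lem_Nor hf hκs hκp (by
    intro t
    obtain ⟨k, hk⟩ := exists_shift L t
    by_cases hin : t + k * τ ∈ Set.Ioo L M
    · left
      rw [hpt, ← (deriv_per hpψ).int_mul k t]
      exact (hψ' _ hin).ne'
    · right
      refine ev_shift k (P := fun s => κ s = 0) (fun s hs => by rwa [hκp.int_mul k s] at hs) ?_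
      rw [Set.mem_Ioo, not_and_or] at hin
      rcases hin with h | h
      · have hL : t + k * τ = L := le_antisymm (not_lt.1 h) hk.1
        have : ∀ᶠ s in nhds (t + k * τ), s + ((1:ℤ):ℝ) * τ ∈ Set.Icc (Y + m) (X - m + τ) := by
          filter_upwards [Ioo_mem_nhds (show Y + m - τ < t + k * τ by linarith) (show t + k * τ < X - m by linarith)] with s hs
          push_cast
          constructor <;> linarith [hs.1, hs.2]
        filter_upwards [this] with s hs
        rw [← hκp.int_mul 1 s]
        simp only [hκ, hB0 _ hs, mul_zero]
      · filter_upwards [Ioo_mem_nhds (show Y + m < t + k * τ by linarith) (show t + k * τ < X - m + τ by linarith [hk.2])] with s hs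
        simp only [hκ, hB0 s ⟨hs.1.le, hs.2.le⟩, mul_zero])
  have hprneg : ∀ t ∈ Set.Icc X Y, pr f1 1 t < 0 := fun t ht => by
    rw [hf1r]; simp only [hκ, hB1 t ht]
    have := (abs_le.1 (hC t ht)).2
    linarith
  have hprsame : ∀ t ∈ Set.Icc M (L + τ), pr f1 1 t = pr f 1 t := fun t ht => by
    rw [hf1r]; simp only [hκ, hB0 t ⟨by linarith [ht.1], by linarith [ht.2]⟩]; ring
  have hpt1 : pt f1 1 = deriv ψ := funext fun t => pt_one hf1 (fun t => by rw [hf1b, hb]) t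
  have hev : ∀ t ∈ Set.Icc M (L + τ), ∀ᶠ s in nhds t, ψ s = φ s := fun t ht => by
    filter_upwards [Ioo_mem_nhds (show b < t by linarith [ht.1]) (show t < a + τ by linarith [ht.2])] with s hs
    exact he s ⟨hs.1.le, hs.2.le⟩
  have hd1 : ∀ t ∈ Set.Icc M (L + τ), deriv ψ t = deriv φ t := fun t ht => Filter.EventuallyEq.deriv_eq (hev t ht)
  have hd2 : ∀ t ∈ Set.Icc M (L + τ), deriv (deriv ψ) t = deriv (deriv φ) t := fun t ht =>
    (Filter.EventuallyEq.deriv (hev t ht)).deriv_eq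
  have hfb : ∀ t, f1 (sphPt t) = ψ t := fun t => by rw [hf1b, hb]
  obtain ⟨g, hg, hgb, hgr, hgc⟩ := lem_Int_per hf1 hφ hp X (by
    intro t ht
    rw [hpt1]
    simp only [hfb]
    rcases le_total t Y with hY | hY
    · right; right
      exact ⟨hprneg t ⟨ht.1, hY⟩, hle t ⟨ht.1, hY⟩⟩
    rcases eq_or_lt_of_le hY with hY | hY
    · right; right
      rw [← hY]
      exact ⟨hprneg Y ⟨hXY.le, le_rfl⟩, hle Y ⟨hXY.le, le_rfl⟩⟩
    rcases lt_or_ge t M with hM | hM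
    · left; exact mul_pos (h3 t ⟨hY, hM⟩) (hψ' t ⟨by linarith, hM⟩)
    rcases le_or_gt t (L + τ) with hL | hL
    · have ht' : t ∈ Set.Icc M (L + τ) := ⟨hM, hL⟩
      by_cases h0 : deriv φ t = 0
      · right
        have hne : pr f1 1 t ≠ 0 := by
          rw [hprsame t ht']
          intro h00
          have := hs t (by rw [hd1 t ht']; exact h0)
          rw [h00] at this; simp at this
        rcases lt_or_gt_of_ne hne with h | h
        · right; exact ⟨h, (hev t ht').mono fun s hs => hs.symm.le⟩
        · left; exact ⟨h, (hev t ht').mono fun s hs => hs.le⟩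
      · left; rw [hd1 t ht']; exact mul_self_pos.2 h0
    · left
      have e1 : t - τ ∈ Set.Ioo L X := ⟨by linarith, by linarith [ht.2]⟩
      have e2 := h1 _ e1
      have e3 := hψ' (t - τ) ⟨e1.1, by linarith [e1.2]⟩
      rw [(deriv_per hp).sub_eq] at e2
      rw [(deriv_per hpψ).sub_eq] at e3
      exact mul_pos e2 e3)
  refine ⟨g, ⟨hg, hgb, fun t ht => ?_⟩, (Set.encard_le_encard (hgc.trans hf1c)).trans hq⟩
  rw [hgr]
  obtain ⟨k, hk⟩ := exists_shift X t
  rw [← (pr_periodic f1 1).int_mul k t, ← (deriv_per (deriv_per hp)).int_mul k t, ← hν.int_mul k t]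
  rw [← (deriv_per hp).int_mul k t] at ht
  generalize t + k * τ = t' at ht hk
  by_cases hin : t' ∈ Set.Icc M (L + τ)
  · rw [hprsame t' hin, ← hd2 t' hin]
    exact hs t' (by rw [hd1 t' hin]; exact ht)
  have hXY' : t' = X ∨ t' = Y := by
    by_contra hne
    push Not at hne
    have g1 : X < t' := lt_of_le_of_ne hk.1 (Ne.symm hne.1)
    rcases lt_trichotomy t' Y with h | h | h
    · exact hXYn t' ⟨g1, h⟩ ht
    · exact hne.2 h
    · rcases lt_or_ge t' M with h4 | h4
      · exact (h3 t' ⟨h, h4⟩).ne' ht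
      · have h5 : L + τ < t' := by
          by_contra h6; exact hin ⟨h4, not_lt.1 h6⟩
        have := h1 (t' - τ) ⟨by linarith, by linarith [hk.2]⟩
        rw [(deriv_per hp).sub_eq] at this
        exact this.ne' ht
  rcases hXY' with rfl | rfl
  · rw [hνX]; push_cast
    have := hprneg t' ⟨le_rfl, hXY.le⟩
    nlinarith [mul_pos_of_neg_of_neg hX2 this]
  · rw [hνY]; push_cast
    have := hprneg t' ⟨hXY.le, le_rfl⟩
    nlinarith [mul_pos_of_neg_of_neg (neg_lt_zero.2 hY2) this]

structure MF (φ : ℝ → ℝ) : Prop where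
  sm : Sm φ
  per : Function.Periodic φ τ
  nd : ∀ t, deriv φ t = 0 → deriv (deriv φ) t ≠ 0
  inj : ∀ s t, deriv φ s = 0 → deriv φ t = 0 → φ s = φ t → sphPt s = sphPt t

def IsMx (φ : ℝ → ℝ) (t : ℝ) : Prop := deriv φ t = 0 ∧ deriv (deriv φ) t < 0
def IsMn (φ : ℝ → ℝ) (t : ℝ) : Prop := deriv φ t = 0 ∧ 0 < deriv (deriv φ) t

lemma isMx_neg {φ : ℝ → ℝ} {t : ℝ} : IsMx (fun t => - φ t) t ↔ IsMn φ t := by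
  simp [IsMx, IsMn]
lemma isMn_neg {φ : ℝ → ℝ} {t : ℝ} : IsMn (fun t => - φ t) t ↔ IsMx φ t := by
  simp [IsMx, IsMn]
lemma isMx_refl {φ : ℝ → ℝ} {t : ℝ} : IsMx (fun t => φ (-t)) t ↔ IsMx φ (-t) := by
  simp only [IsMx, deriv2_refl, deriv_refl, neg_eq_zero]
lemma isMn_refl {φ : ℝ → ℝ} {t : ℝ} : IsMn (fun t => φ (-t)) t ↔ IsMn φ (-t) := by
  simp only [IsMn, deriv2_refl, deriv_refl, neg_eq_zero]

lemma sph_neg_iff {s t : ℝ} : sphPt (-s) = sphPt (-t) ↔ sphPt s = sphPt t := by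
  rw [← rflE_sph, ← rflE_sph]; exact rflE.injective.eq_iff

lemma MF.neg {φ : ℝ → ℝ} (h : MF φ) : MF (fun t => - φ t) := by
  refine ⟨h.sm.neg, fun t => by simp only [h.per t], fun t ht => ?_, fun s t hs ht he => ?_⟩
  · simp only [deriv.fun_neg', neg_eq_zero] at ht ⊢; exact fun h0 => h.nd t ht (by simpa using h0)
  · simp only [deriv.fun_neg', neg_eq_zero] at hs ht; exact h.inj s t hs ht (neg_injective he)

lemma MF.refl {φ : ℝ → ℝ} (h : MF φ) : MF (fun t => φ (-t)) := by
  refine ⟨h.sm.comp contDiff_neg, fun t => by simp only [neg_add]; rw [← sub_eq_add_neg, h.per.sub_eq], fun t ht => ?_, fun s t hs ht he => ?_⟩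
  · rw [deriv_refl, neg_eq_zero] at ht; rw [deriv2_refl]; exact h.nd _ ht
  · rw [deriv_refl, neg_eq_zero] at hs ht; exact sph_neg_iff.1 (h.inj _ _ hs ht he)

lemma IsMx.shift {φ : ℝ → ℝ} (hp : Function.Periodic φ τ) {t : ℝ} (h : IsMx φ t) (k : ℤ) : IsMx φ (t + k * τ) := by
  unfold IsMx; rw [(deriv_per hp).int_mul k t, (deriv_per (deriv_per hp)).int_mul k t]; exact h
lemma IsMn.shift {φ : ℝ → ℝ} (hp : Function.Periodic φ τ) {t : ℝ} (h : IsMn φ t) (k : ℤ) : IsMn φ (t + k * τ) := by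
  unfold IsMn; rw [(deriv_per hp).int_mul k t, (deriv_per (deriv_per hp)).int_mul k t]; exact h

lemma deriv_smth {φ : ℝ → ℝ} (h : Sm φ) : Differentiable ℝ (deriv φ) := sm_diff (deriv_sm h)

lemma mx_sign {φ : ℝ → ℝ} {t : ℝ} (h : IsMx φ t) :
    ∃ ε > 0, (∀ s ∈ Set.Ioo t (t + ε), deriv φ s < 0) ∧ (∀ s ∈ Set.Ioo (t - ε) t, 0 < deriv φ s) := by
  have := eventually_nhdsWithin_sign_eq_of_deriv_neg h.2 h.1
  rw [Metric.eventually_nhds_iff] at this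
  obtain ⟨ε, hε, H⟩ := this
  refine ⟨ε, hε, fun s hs => ?_, fun s hs => ?_⟩
  · have h1 := H (y := s) (by rw [Real.dist_eq, abs_lt]; constructor <;> linarith [hs.1, hs.2])
    rw [sign_neg (by linarith [hs.1] : t - s < 0)] at h1
    exact sign_eq_neg_one_iff.1 h1
  · have h1 := H (y := s) (by rw [Real.dist_eq, abs_lt]; constructor <;> linarith [hs.1, hs.2])
    rw [sign_pos (by linarith [hs.2] : 0 < t - s)] at h1
    exact sign_eq_one_iff.1 h1

lemma neg_of_ne {h : ℝ → ℝ} (hc : Continuous h) {a b c : ℝ} (hne : ∀ s ∈ Set.Ioo a b, h s ≠ 0)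
    (hcm : c ∈ Set.Ioo a b) (hneg : h c < 0) : ∀ s ∈ Set.Ioo a b, h s < 0 := by
  intro s hs
  by_contra hcon
  have hpos : 0 ≤ h s := not_lt.1 hcon
  obtain ⟨u, hu, hu0⟩ := (isPreconnected_Ioo (a := a) (b := b)).intermediate_value hcm hs hc.continuousOn
    ⟨hneg.le, hpos⟩
  exact hne u hu hu0

lemma MF.next {φ : ℝ → ℝ} (h : MF φ) {t : ℝ} (ht : IsMx φ t) :
    ∃ u, t < u ∧ u < t + τ ∧ IsMn φ u ∧ ∀ s ∈ Set.Ioo t u, deriv φ s < 0 := by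
  obtain ⟨ε, hε, h1, -⟩ := mx_sign ht
  have hc : Continuous (deriv φ) := (deriv_smth h.sm).continuous
  have htτ : IsMx φ (t + τ) := by simpa using ht.shift h.per 1
  have hετ : ε ≤ τ := by
    by_contra hlt
    exact (h1 (t + τ) ⟨by linarith [tau_pos], by linarith⟩).ne htτ.1
  have hZc : IsCompact ({s | deriv φ s = 0} ∩ Set.Icc (t + ε / 2) (t + τ)) :=
    isCompact_Icc.inter_left (isClosed_eq hc continuous_const)
  obtain ⟨u, ⟨hu0, hu⟩, hmin⟩ := hZc.exists_isLeast ⟨t + τ, htτ.1, by linarith, le_rfl⟩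
  have hne : ∀ s ∈ Set.Ioo t u, deriv φ s ≠ 0 := by
    intro s hs h0
    rcases lt_or_ge s (t + ε / 2) with h2 | h2
    · exact (h1 s ⟨hs.1, by linarith⟩).ne h0
    · exact absurd (hmin ⟨h0, h2, by linarith [hs.2, hu.2]⟩) (not_le.2 hs.2)
  have hu1 : t + ε ≤ u := by
    by_contra hlt
    exact (h1 u ⟨by linarith [hu.1], not_le.1 hlt⟩).ne hu0
  have hneg : ∀ s ∈ Set.Ioo t u, deriv φ s < 0 :=
    neg_of_ne hc hne (c := t + ε / 2) ⟨by linarith, by linarith⟩ (h1 _ ⟨by linarith, by linarith⟩)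
  have hmn : IsMn φ u := by
    refine ⟨hu0, lt_of_le_of_ne (not_lt.1 fun hlt => ?_) (h.nd u hu0).symm⟩
    obtain ⟨δ, hδ, -, h4⟩ := mx_sign ⟨hu0, hlt⟩
    have h5 : max t (u - δ) < u := max_lt (by linarith) (by linarith)
    have h6 := h4 ((max t (u - δ) + u) / 2) ⟨by linarith [le_max_right t (u - δ)], by linarith⟩
    have h7 := hneg ((max t (u - δ) + u) / 2) ⟨by linarith [le_max_left t (u - δ)], by linarith⟩
    linarith
  refine ⟨u, by linarith, lt_of_le_of_ne hu.2 ?_, hmn, hneg⟩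
  rintro rfl
  exact absurd htτ.2 (not_lt.2 hmn.2.le)

lemma MF.next' {φ : ℝ → ℝ} (h : MF φ) {t : ℝ} (ht : IsMn φ t) :
    ∃ u, t < u ∧ u < t + τ ∧ IsMx φ u ∧ ∀ s ∈ Set.Ioo t u, 0 < deriv φ s := by
  obtain ⟨u, h1, h2, h3, h4⟩ := h.neg.next (isMx_neg.2 ht)
  exact ⟨u, h1, h2, isMn_neg.1 h3, fun s hs => by simpa using h4 s hs⟩

lemma MF.prev' {φ : ℝ → ℝ} (h : MF φ) {t : ℝ} (ht : IsMx φ t) :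
    ∃ u, u < t ∧ t < u + τ ∧ IsMn φ u ∧ ∀ s ∈ Set.Ioo u t, 0 < deriv φ s := by
  obtain ⟨u, h1, h2, h3, h4⟩ := h.refl.next (t := -t) (by rw [isMx_refl]; simpa using ht)
  refine ⟨-u, by linarith, by linarith, isMn_refl.1 h3, fun s hs => ?_⟩
  have := h4 (-s) ⟨by linarith [hs.2], by linarith [hs.1]⟩
  rw [deriv_refl] at this; simpa using this

lemma MF.prev {φ : ℝ → ℝ} (h : MF φ) {t : ℝ} (ht : IsMn φ t) :
    ∃ u, u < t ∧ t < u + τ ∧ IsMx φ u ∧ ∀ s ∈ Set.Ioo u t, deriv φ s < 0 := by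
  obtain ⟨u, h1, h2, h3, h4⟩ := h.neg.prev' (isMx_neg.2 ht)
  exact ⟨u, h1, h2, isMn_neg.1 h3, fun s hs => by simpa using h4 s hs⟩

lemma MF.mx_or_mn {φ : ℝ → ℝ} (h : MF φ) {t : ℝ} (ht : deriv φ t = 0) : IsMx φ t ∨ IsMn φ t :=
  (lt_or_gt_of_ne (h.nd t ht)).imp (fun h => ⟨ht, h⟩) (fun h => ⟨ht, h⟩)

lemma MF.exists_mx {φ : ℝ → ℝ} (h : MF φ) : ∃ t, IsMx φ t := by
  obtain ⟨t, ht, hm⟩ := (isCompact_Icc (a := 0) (b := τ)).exists_isMaxOn ⟨0, le_rfl, tau_pos.le⟩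
    (sm_diff h.sm).continuous.continuousOn
  have hmax : ∀ s, φ s ≤ φ t := fun s => by
    obtain ⟨k, hk⟩ := exists_shift 0 s
    rw [← h.per.int_mul k s]; exact hm ⟨hk.1, by linarith [hk.2]⟩
  have h0 : deriv φ t = 0 := IsLocalMax.deriv_eq_zero (Filter.Eventually.of_forall hmax)
  rcases h.mx_or_mn h0 with h1 | h1
  · exact ⟨t, h1⟩
  · exfalso
    obtain ⟨u, h2, -, -, h3⟩ := h.next' h1
    have := (strictMonoOn_of_deriv_pos (convex_Icc t u) (sm_diff h.sm).continuous.continuousOn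
      (by rw [interior_Icc]; exact h3)) ⟨le_rfl, h2.le⟩ ⟨h2.le, le_rfl⟩ h2
    exact absurd (hmax u) (not_le.2 this)

lemma base1 {φ : ℝ → ℝ} (hφ : Sm φ) (hp : Function.Periodic φ τ) {M m : ℝ} (hM : IsMx φ M) (hm : IsMn φ m)
    (hMm : M < m) (hmM : m < M + τ) (hle : m - M ≤ Real.pi) (h1 : ∀ t ∈ Set.Ioo M m, deriv φ t < 0)
    (h2 : ∀ t ∈ Set.Ioo m (M + τ), 0 < deriv φ t) {ν : ℝ → ℤ} (hν : Function.Periodic ν τ)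
    (hνM : ν M = 1) (hνm : ν m = 1) : QQ φ ν 0 := by
  set v := (M + m) / 2 - Real.pi / 2 with hv
  have hpi := Real.pi_pos
  have hmono : StrictMonoOn φ (Set.Icc m (M + τ)) :=
    strictMonoOn_of_deriv_pos (convex_Icc _ _) (sm_diff hφ).continuous.continuousOn (by rw [interior_Icc]; exact h2)
  have hτ : τ = 2 * Real.pi := rfl
  have hlt : φ (v + Real.pi) < φ v := by
    rw [← hp v]
    exact hmono ⟨by linarith, by linarith⟩ ⟨by linarith, by linarith⟩ (by linarith)
  set c := (φ (v + Real.pi) + φ v) / 2 with hc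
  set ε := (φ v - φ (v + Real.pi)) / 4 with hε
  have hε0 : 0 < ε := by linarith
  set f : E2 → ℝ := fun x => c + ε * ⟪sphPt v, x⟫ with hf
  have hfs : Sm f := contDiff_const.add (contDiff_const.mul (contDiff_const.inner ℝ contDiff_id))
  have hfd : ∀ x w, fderiv ℝ f x w = ε * ⟪sphPt v, w⟫ := fun x w => by
    have : HasFDerivAt f (ε • innerSL ℝ (sphPt v)) x := by
      have := ((innerSL ℝ (sphPt v)).hasFDerivAt (x := x)).const_mul ε |>.const_add c
      exact this
    rw [this.fderiv]; simp
  have hfb : ∀ t, f (sphPt t) = c + ε * Real.cos (t - v) := fun t => by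
    simp only [hf, sphPt_inner]; rw [← Real.cos_neg]; ring_nf
  have hfr : ∀ t, pr f 1 t = ε * Real.cos (t - v) := fun t => by
    simp only [pr, hfd, sphPt_inner]; rw [← Real.cos_neg]; ring_nf
  have hft : ∀ t, pt f 1 t = - ε * Real.sin (t - v) := fun t => by
    simp only [pt, hfd, one_smul, sphPt_inner]; rw [← Real.cos_neg, show -(v - (t + Real.pi / 2)) = (t - v) + Real.pi / 2 by ring, Real.cos_add_pi_div_two]; ring
  have hcr : critPts f = ∅ := by
    ext x; simp only [critPts, Set.mem_setOf_eq, Set.mem_empty_iff_false, iff_false, not_and]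
    intro _ h0
    have := hfd x (sphPt v)
    rw [h0, sphPt_inner] at this; simp at this; linarith
  have hcosM : ∀ t ∈ Set.Icc v M, 0 < Real.cos (t - v) := fun t ht =>
    Real.cos_pos_of_mem_Ioo ⟨by linarith [ht.1], by linarith [ht.2]⟩
  have hcosm : ∀ t ∈ Set.Icc m (v + Real.pi), Real.cos (t - v) < 0 := fun t ht =>
    Real.cos_neg_of_pi_div_two_lt_of_lt (by linarith [ht.1]) (by linarith [ht.2])
  have hcont := (sm_diff hφ).continuous
  have hfcont : Continuous fun t => f (sphPt t) := (sm_diff hfs).continuous.comp sphPt_continuous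
  obtain ⟨g, hg, hgb, hgr, hgc⟩ := lem_Int_per hfs hφ hp v (by
    intro t ht
    rcases le_or_gt t M with hM1 | hM1
    · right; left
      refine ⟨by rw [hfr]; exact mul_pos hε0 (hcosM t ⟨ht.1, hM1⟩), ?_⟩
      have : f (sphPt t) < φ t := by
        have e1 : φ v ≤ φ t := by
          rw [← hp v, ← hp t]
          exact hmono.monotoneOn ⟨by linarith, by linarith⟩ ⟨by linarith [ht.1], by linarith⟩ (by linarith [ht.1])
        rw [hfb]; nlinarith [Real.cos_le_one (t - v)]
      exact ((hfcont.tendsto t).eventually_lt (hcont.tendsto t) this).mono fun s hs => hs.le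
    rcases lt_or_ge t m with hm1 | hm1
    · left
      rw [hft]
      have e1 := h1 t ⟨hM1, hm1⟩
      have e2 := Real.sin_pos_of_pos_of_lt_pi (x := t - v) (by linarith) (by linarith)
      nlinarith [mul_pos hε0 e2]
    rcases le_or_gt t (v + Real.pi) with hv1 | hv1
    · right; right
      refine ⟨by rw [hfr]; nlinarith [hcosm t ⟨hm1, hv1⟩], ?_⟩
      have : φ t < f (sphPt t) := by
        have e1 : φ t ≤ φ (v + Real.pi) := 
          hmono.monotoneOn ⟨by linarith, by linarith⟩ ⟨by linarith, by linarith⟩ (by linarith)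
        rw [hfb]; nlinarith [Real.neg_one_le_cos (t - v)]
      exact ((hcont.tendsto t).eventually_lt (hfcont.tendsto t) this).mono fun s hs => hs.le
    · left
      rw [hft]
      have e1 := h2 t ⟨by linarith, by linarith [ht.2]⟩
      have e2 : Real.sin (t - v) < 0 := by
        have := Real.sin_neg_of_neg_of_neg_pi_lt (x := t - v - τ) (by linarith [ht.2]) (by linarith)
        rwa [Real.sin_sub_two_pi] at this
      nlinarith [mul_pos hε0 (neg_pos.2 e2)])
  refine ⟨g, ⟨hg, hgb, fun t ht => ?_⟩, by rw [Set.subset_eq_empty (hgc.trans hcr.subset) rfl]; simp⟩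
  rw [hgr]
  obtain ⟨k, hk⟩ := exists_shift M t
  rw [← (pr_periodic f 1).int_mul k t, ← (deriv_per (deriv_per hp)).int_mul k t, ← hν.int_mul k t]
  rw [← (deriv_per hp).int_mul k t] at ht
  generalize t + k * τ = t' at ht hk
  have : t' = M ∨ t' = m := by
    by_contra hcon
    push Not at hcon
    rcases lt_trichotomy t' m with h | h | h
    · exact (h1 t' ⟨lt_of_le_of_ne hk.1 (Ne.symm hcon.1), h⟩).ne ht
    · exact hcon.2 h
    · exact (h2 t' ⟨h, hk.2⟩).ne' ht
  rcases this with rfl | rfl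
  · rw [hνM, hfr]; push_cast
    nlinarith [mul_pos (mul_pos hε0 (hcosM t' ⟨by linarith, le_rfl⟩)) (neg_pos.2 hM.2)]
  · rw [hνm, hfr]; push_cast
    nlinarith [mul_pos (mul_pos hε0 (neg_pos.2 (hcosm t' ⟨le_rfl, by linarith⟩))) hm.2]

lemma base2 {φ : ℝ → ℝ} (hφ : Sm φ) (hp : Function.Periodic φ τ) {M m : ℝ} (hM : IsMx φ M) (hm : IsMn φ m)
    (hMm : M < m) (hmM : m < M + τ) (h1 : ∀ t ∈ Set.Ioo M m, deriv φ t < 0)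
    (h2 : ∀ t ∈ Set.Ioo m (M + τ), 0 < deriv φ t) {ν : ℝ → ℤ} (hν : Function.Periodic ν τ)
    (hνM : ν M = 1) (hνm : ν m = 1) : QQ φ ν 0 := by
  rcases le_total (m - M) Real.pi with h | h
  · exact base1 hφ hp hM hm hMm hmM h h1 h2 hν hνM hνm
  · have hp' : Function.Periodic (fun t => φ (-t)) τ := fun t => by
      simp only [neg_add]; rw [← sub_eq_add_neg, hp.sub_eq]
    have hν' : Function.Periodic (fun t => ν (-t)) τ := fun t => by
      simp only [neg_add]; rw [← sub_eq_add_neg, hν.sub_eq]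
    have hτ : τ = 2 * Real.pi := rfl
    have hM' : IsMx φ (M + τ) := by simpa using hM.shift hp 1
    have := QQ_refl (base1 (φ := fun t => φ (-t)) (ν := fun t => ν (-t)) (M := -(M + τ)) (m := -m)
      (hφ.comp contDiff_neg) hp' (by rw [isMx_refl, neg_neg]; exact hM') (by rw [isMn_refl, neg_neg]; exact hm)
      (by linarith) (by linarith) (by linarith)
      (fun t ht => by
        rw [deriv_refl]
        have := h2 (-t) ⟨by linarith [ht.2], by linarith [ht.1]⟩
        linarith)
      (fun t ht => by
        rw [deriv_refl]
        have := h1 (-t - τ + τ) ⟨by linarith [ht.2], by linarith [ht.1]⟩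
        simp only [sub_add_cancel] at this
        linarith) hν' (by rw [neg_neg, hν, hνM]) (by rw [neg_neg, hνm]))
    simpa using this

structure Tri (φ : ℝ → ℝ) (M L M' : ℝ) : Prop where
  lt1 : M < L
  lt2 : L < M'
  mx : IsMx φ M
  mn : IsMn φ L
  mx' : IsMx φ M'
  d1 : ∀ t ∈ Set.Ioo M L, deriv φ t < 0
  d2 : ∀ t ∈ Set.Ioo L M', 0 < deriv φ t

lemma Tri.shift {φ : ℝ → ℝ} (hp : Function.Periodic φ τ) {M L M' : ℝ} (h : Tri φ M L M') (k : ℤ) :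
    Tri φ (M + k * τ) (L + k * τ) (M' + k * τ) := by
  refine ⟨by linarith [h.lt1], by linarith [h.lt2], h.mx.shift hp k, h.mn.shift hp k, h.mx'.shift hp k, ?_, ?_⟩
  · intro t ht
    rw [← (deriv_per hp).sub_int_mul_eq k]
    exact h.d1 _ ⟨by linarith [ht.1], by linarith [ht.2]⟩
  · intro t ht
    rw [← (deriv_per hp).sub_int_mul_eq k]
    exact h.d2 _ ⟨by linarith [ht.1], by linarith [ht.2]⟩

lemma Tri.refl {φ : ℝ → ℝ} {M L M' : ℝ} (h : Tri φ M L M') :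
    Tri (fun t => φ (-t)) (-M') (-L) (-M) := by
  refine ⟨by linarith [h.lt2], by linarith [h.lt1], by rw [isMx_refl, neg_neg]; exact h.mx',
    by rw [isMn_refl, neg_neg]; exact h.mn, by rw [isMx_refl, neg_neg]; exact h.mx, ?_, ?_⟩
  · intro t ht
    rw [deriv_refl]
    linarith [h.d2 (-t) ⟨by linarith [ht.2], by linarith [ht.1]⟩]
  · intro t ht
    rw [deriv_refl]
    linarith [h.d1 (-t) ⟨by linarith [ht.2], by linarith [ht.1]⟩]

lemma Tri.ofRefl {φ : ℝ → ℝ} {M L M' : ℝ} (h : Tri (fun t => φ (-t)) M L M') : Tri φ (-M') (-L) (-M) := by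
  simpa using h.refl

lemma mx_not_mn {φ : ℝ → ℝ} {t : ℝ} (h : IsMx φ t) (h' : IsMn φ t) : False := by
  linarith [h.2, h'.2]

lemma Tri.le_of_mx {φ : ℝ → ℝ} {M L M' Q : ℝ} (h : Tri φ M L M') (hQ : IsMx φ Q) (hlt : M < Q) : M' ≤ Q := by
  by_contra hcon
  push Not at hcon
  rcases lt_trichotomy Q L with h1 | h1 | h1
  · exact (h.d1 Q ⟨hlt, h1⟩).ne hQ.1
  · exact mx_not_mn hQ (h1 ▸ h.mn)
  · exact (h.d2 Q ⟨h1, hcon⟩).ne' hQ.1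

lemma Tri.le_of_mx' {φ : ℝ → ℝ} {M L M' Q : ℝ} (h : Tri φ M L M') (hQ : IsMx φ Q) (hlt : Q < M') : Q ≤ M := by
  by_contra hcon
  exact absurd (h.le_of_mx hQ (not_le.1 hcon)) (not_le.2 hlt)

/-- a node strictly inside is the min -/
lemma Tri.eq_mn {φ : ℝ → ℝ} {M L M' Q : ℝ} (h : Tri φ M L M') (hQ : deriv φ Q = 0) (h1 : M < Q) (h2 : Q < M') : Q = L := by
  rcases lt_trichotomy Q L with h3 | h3 | h3
  · exact absurd hQ (h.d1 Q ⟨h1, h3⟩).ne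
  · exact h3
  · exact absurd hQ (h.d2 Q ⟨h3, h2⟩).ne'

lemma Tri.le_tau {φ : ℝ → ℝ} (hp : Function.Periodic φ τ) {M L M' : ℝ} (h : Tri φ M L M') : M' ≤ M + τ := by
  have := h.le_of_mx (by simpa using h.mx.shift hp 1) (by linarith [tau_pos] : M < M + τ)
  exact this

lemma Tri.lt_tau {φ : ℝ → ℝ} (hp : Function.Periodic φ τ) {M L M' : ℝ} (h : Tri φ M L M')
    (hne : sphPt M ≠ sphPt M') : M' < M + τ := by
  refine lt_of_le_of_ne (h.le_tau hp) fun he => hne ?_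
  rw [he, sphPt_periodic]

lemma Tri.mono {φ : ℝ → ℝ} (hs : Sm φ) {M L M' : ℝ} (h : Tri φ M L M') : φ L < φ M ∧ φ L < φ M' := by
  have hc := (sm_diff hs).continuous
  constructor
  · exact (strictAntiOn_of_deriv_neg (convex_Icc M L) hc.continuousOn (by rw [interior_Icc]; exact h.d1))
      ⟨le_rfl, h.lt1.le⟩ ⟨h.lt1.le, le_rfl⟩ h.lt1
  · exact (strictMonoOn_of_deriv_pos (convex_Icc L M') hc.continuousOn (by rw [interior_Icc]; exact h.d2))
      ⟨le_rfl, h.lt2.le⟩ ⟨h.lt2.le, le_rfl⟩ h.lt2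

lemma MF.tri_mx {φ : ℝ → ℝ} (h : MF φ) {M : ℝ} (hM : IsMx φ M) : ∃ L M', Tri φ M L M' := by
  obtain ⟨L, h1, -, h2, h3⟩ := h.next hM
  obtain ⟨M', h4, -, h5, h6⟩ := h.next' h2
  exact ⟨L, M', h1, h4, hM, h2, h5, h3, h6⟩

lemma MF.tri_mx' {φ : ℝ → ℝ} (h : MF φ) {M' : ℝ} (hM : IsMx φ M') : ∃ M L, Tri φ M L M' := by
  obtain ⟨L, h1, -, h2, h3⟩ := h.prev' hM
  obtain ⟨M, h4, -, h5, h6⟩ := h.prev h2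
  exact ⟨M, L, h4, h1, h5, h2, hM, h6, h3⟩

lemma MF.tri_mn {φ : ℝ → ℝ} (h : MF φ) {L : ℝ} (hL : IsMn φ L) : ∃ M M', Tri φ M L M' := by
  obtain ⟨M, h4, -, h5, h6⟩ := h.prev hL
  obtain ⟨M', h7, -, h8, h9⟩ := h.next' hL
  exact ⟨M, M', h4, h7, h5, hL, h8, h6, h9⟩

lemma Tri.uniq {φ : ℝ → ℝ} {M L M' N N' : ℝ} (h : Tri φ M L M') (h' : Tri φ N L N') : M = N ∧ M' = N' := by
  constructor
  · exact le_antisymm (h'.le_of_mx' h.mx (h.lt1.trans h'.lt2)) (h.le_of_mx' h'.mx (h'.lt1.trans h.lt2))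
  · exact le_antisymm (h.le_of_mx h'.mx' (h.lt1.trans h'.lt2)) (h'.le_of_mx h.mx' (h'.lt1.trans h.lt2))

lemma MF.fin {φ : ℝ → ℝ} (h : MF φ) (a b : ℝ) : ({t | deriv φ t = 0} ∩ Set.Icc a b).Finite := by
  by_contra hinf
  have hc : Continuous (deriv φ) := (deriv_smth h.sm).continuous
  obtain ⟨t, ht, hacc⟩ := Set.Infinite.exists_accPt_of_subset_isCompact hinf isCompact_Icc Set.inter_subset_right
  have h0 : deriv φ t = 0 := by
    have : t ∈ closure {t | deriv φ t = 0} := mem_closure_iff_clusterPt.2 ((hacc.mono (Filter.principal_mono.2 Set.inter_subset_left)).clusterPt)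
    rwa [(isClosed_eq hc continuous_const).closure_eq] at this
  have := ((deriv_smth h.sm) t).hasDerivAt.eventually_ne (h.nd t h0) (c := 0)
  rw [accPt_iff_frequently_nhdsNE] at hacc
  exact hacc (this.mono fun s hs h1 => hs h1.1)

def Wit (φ : ℝ → ℝ) (b : ℝ → ℝ → ℝ) (x y : ℝ) : Prop :=
  ∃ M L M', Tri φ M L M' ∧ b M M' = φ L ∧ b x y = φ L ∧ φ L < b x M ∧ φ L < b y M'

structure Good (φ : ℝ → ℝ) (ν : E2 → ℤ) (b : ℝ → ℝ → ℝ) : Prop where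
  mf : MF φ
  νs : ∀ p, ν p = 1 ∨ ν p = -1
  symm : ∀ x y, b x y = b y x
  per : ∀ x x' y, sphPt x = sphPt x' → b x y = b x' y
  self : ∀ x, IsMx φ x → b x x = φ x
  le : ∀ x y, IsMx φ x → IsMx φ y → b x y ≤ φ x
  ultra : ∀ x y z, min (b x y) (b y z) ≤ b x z
  adj : ∀ M L M', Tri φ M L M' → φ L ≤ b M M'
  nc : ∀ x y z w, x < y → y < z → z < w → w < x + τ → min (b x z) (b y w) ≤ b x y
  p0 : ∀ x y, IsMx φ x → IsMx φ y → sphPt x ≠ sphPt y →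
    b x y = φ x ∨ b x y = φ y ∨ Wit φ b x y ∨ Wit φ b y x
  nx : ∀ V Q, IsMx φ V → IsMx φ Q → sphPt V ≠ sphPt Q → b V Q = φ V → ν (sphPt V) = -1
  nn : ∀ M L M', Tri φ M L M' → b M M' = φ L → ν (sphPt L) = -1

lemma Good.per' {φ ν b} (h : Good φ ν b) {x y y' : ℝ} (hy : sphPt y = sphPt y') : b x y = b x y' := by
  rw [h.symm x y, h.symm x y']; exact h.per _ _ _ hy

lemma rfl_sph (t : ℝ) : sphPt (-t) = rflE (sphPt t) := (rflE_sph t).symm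

lemma Good.refl {φ ν b} (h : Good φ ν b) :
    Good (fun t => φ (-t)) (fun p => ν (rflE p)) (fun x y => b (-x) (-y)) := by
  refine ⟨h.mf.refl, fun p => h.νs _, fun x y => h.symm _ _, fun x x' y hx => h.per _ _ _ (sph_neg_iff.2 hx),
    fun x hx => h.self _ (isMx_refl.1 hx), fun x y hx hy => h.le _ _ (isMx_refl.1 hx) (isMx_refl.1 hy),
    fun x y z => h.ultra _ _ _, fun M L M' hT => ?_, fun x y z w h1 h2 h3 h4 => ?_, fun x y hx hy hxy => ?_,
    fun V Q hV hQ hVQ he => ?_, fun M L M' hT he => ?_⟩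
  · rw [h.symm]; exact h.adj _ _ _ hT.ofRefl
  · have := h.nc (-y) (-x) (-w + τ) (-z + τ) (by linarith) (by linarith) (by linarith) (by linarith)
    rw [h.per' (sphPt_periodic (-w)), h.per' (sphPt_periodic (-z)), h.symm (-y) (-x), min_comm] at this
    exact this
  · have hw : ∀ x y, Wit φ b (-x) (-y) → Wit (fun t => φ (-t)) (fun x y => b (-x) (-y)) y x := by
      rintro x y ⟨M, L, M', hT, h1, h2, h3, h4⟩
      refine ⟨-M', -L, -M, hT.refl, ?_, ?_, ?_, ?_⟩
      · simp only [neg_neg]; rw [h.symm]; exact h1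
      · simp only [neg_neg]; rw [h.symm]; exact h2
      · simpa using h4
      · simpa using h3
    rcases h.p0 (-x) (-y) (isMx_refl.1 hx) (isMx_refl.1 hy) (fun h0 => hxy (sph_neg_iff.1 h0)) with h1 | h1 | h1 | h1
    · exact Or.inl h1
    · exact Or.inr (Or.inl h1)
    · exact Or.inr (Or.inr (Or.inr (hw _ _ h1)))
    · exact Or.inr (Or.inr (Or.inl (hw _ _ h1)))
  · have := h.nx _ _ (isMx_refl.1 hV) (isMx_refl.1 hQ) (fun h0 => hVQ (sph_neg_iff.1 h0)) he
    rwa [rfl_sph] at this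
  · have := h.nn _ _ _ hT.ofRefl (by rw [h.symm]; exact he)
    rwa [rfl_sph] at this

def Conf (φ : ℝ → ℝ) (b : ℝ → ℝ → ℝ) (X Y Z : ℝ) : Prop :=
  Tri φ X Y Z ∧ sphPt X ≠ sphPt Z ∧
    ((φ X < φ Z ∧ b X Z = φ X) ∨
      (b X Z = φ Y ∧ ∀ y, IsMx φ y → sphPt y ≠ sphPt X → b X y ≤ φ Y))

lemma confB {φ ν b} (h : Good φ ν b) {Z y : ℝ} (hZ : IsMx φ Z) (hy : IsMx φ y) (hZy : sphPt Z ≠ sphPt y)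
    (hmax : ∀ y', IsMx φ y' → sphPt y' ≠ sphPt Z → b Z y' ≤ b Z y) (h1 : b Z y ≠ φ Z) (h2 : b Z y ≠ φ y) :
    (∃ X Y Z, Conf φ b X Y Z) ∨ ∃ X Y Z, Conf (fun t => φ (-t)) (fun x y => b (-x) (-y)) X Y Z := by
  rcases h.p0 Z y hZ hy hZy with h3 | h3 | ⟨M, L, M', hT, h3, h4, h5, h6⟩ | ⟨M, L, M', hT, h3, h4, h5, h6⟩
  · exact absurd h3 h1
  · exact absurd h3 h2
  · have hM : sphPt M = sphPt Z := by
      by_contra hne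
      have := hmax M hT.mx hne
      linarith
    left
    refine ⟨M, L, M', hT, fun h0 => ?_, Or.inr ⟨h3, fun y' hy' hne => ?_⟩⟩
    · rw [h.per' h0.symm, h.self _ hT.mx] at h3
      exact absurd h3 (hT.mono h.mf.sm).1.ne'
    · rw [h.per _ _ _ hM, ← h4]; exact hmax _ hy' (by rwa [hM] at hne)
  · rw [h.symm] at h4
    have hM : sphPt M' = sphPt Z := by
      by_contra hne
      have := hmax M' hT.mx' hne
      linarith
    right
    refine ⟨-M', -L, -M, hT.refl, fun h0 => ?_, Or.inr ⟨?_, fun y' hy' hne => ?_⟩⟩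
    · rw [sph_neg_iff] at h0
      rw [h.per' h0, h.self _ hT.mx] at h3
      exact absurd h3 (hT.mono h.mf.sm).1.ne'
    · simp only [neg_neg]; rw [h.symm]; exact h3
    · simp only [neg_neg]; rw [h.per _ _ _ hM, ← h4]
      refine hmax _ (isMx_refl.1 hy') fun h0 => hne ?_
      rw [← sph_neg_iff, neg_neg, h0, hM]

lemma sph_ne {s t : ℝ} (h1 : s ≠ t) (h2 : |s - t| < τ) : sphPt s ≠ sphPt t := by
  intro h
  obtain ⟨k, hk⟩ := sphPt_eq_iff.1 h
  have h3 : |(k : ℝ)| * τ < 1 * τ := by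
    rw [one_mul]
    calc |(k : ℝ)| * τ = |s - t| := by rw [hk, add_sub_cancel_left, abs_mul, abs_of_pos tau_pos]
      _ < τ := h2
  have h4 : |(k : ℝ)| < 1 := lt_of_mul_lt_mul_right h3 tau_pos.le
  have h5 : |k| < 1 := by exact_mod_cast h4
  rw [Int.abs_lt_one_iff] at h5
  rw [h5] at hk; simp at hk; exact h1 hk

lemma MF.fin_mx {φ : ℝ → ℝ} (h : MF φ) (a b : ℝ) : ({t | IsMx φ t} ∩ Set.Icc a b).Finite :=
  (h.fin a b).subset fun _ ht => ⟨ht.1.1, ht.2⟩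

lemma conf_pair {φ ν b} (h : Good φ ν b) {V Q : ℝ} (hV : IsMx φ V) (hQ : IsMx φ Q) (hVQ : V < Q) (hQV : Q < V + τ)
    (hb : b V Q = φ V)
    (hmin : ∀ x y, IsMx φ x → IsMx φ y → x ∈ Set.Icc V Q → y ∈ Set.Icc V Q → x ≠ y →
      (x ∈ Set.Ioo V Q ∨ y ∈ Set.Ioo V Q) → b x y ≠ φ x) :
    (∃ X Y Z, Conf φ b X Y Z) ∨ ∃ X Y Z, Conf (fun t => φ (-t)) (fun x y => b (-x) (-y)) X Y Z := by
  have hne : sphPt V ≠ sphPt Q := sph_ne hVQ.ne (by rw [abs_sub_comm, abs_of_pos] <;> linarith)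
  by_cases hex : ∃ Z, IsMx φ Z ∧ Z ∈ Set.Ioo V Q
  · obtain ⟨Z0, hZ0, hZ0m⟩ := hex
    set S : Set (ℝ × ℝ) := {p | IsMx φ p.1 ∧ IsMx φ p.2 ∧ p.1 ∈ Set.Ioo V Q ∧ p.2 ∈ Set.Icc V Q ∧ p.1 ≠ p.2} with hS
    have hSf : S.Finite := ((h.mf.fin_mx V Q).prod (h.mf.fin_mx V Q)).subset
      fun p hp => ⟨⟨hp.1, hp.2.2.1.1.le, hp.2.2.1.2.le⟩, ⟨hp.2.1, hp.2.2.2.1⟩⟩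
    obtain ⟨⟨Z, y⟩, ⟨hZ, hy, hZm, hym, hZy⟩, hmx⟩ := Set.exists_max_image S (fun p => b p.1 p.2) hSf
      ⟨(Z0, V), hZ0, hV, hZ0m, ⟨le_rfl, hVQ.le⟩, hZ0m.1.ne'⟩
    dsimp only at hZ hy hZm hym hZy hmx
    have hbVZ : b V Z < φ V := lt_of_le_of_ne (h.le _ _ hV hZ)
      (hmin V Z hV hZ ⟨le_rfl, hVQ.le⟩ ⟨hZm.1.le, hZm.2.le⟩ hZm.1.ne (Or.inr hZm))
    refine confB h hZ hy (sph_ne hZy (by rw [abs_lt]; constructor <;> linarith [hZm.1, hZm.2, hym.1, hym.2])) ?_ ?_ ?_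
    · intro y' hy' hne'
      obtain ⟨k, hk⟩ := exists_shift V y'
      have hsp : sphPt (y' + k * τ) = sphPt y' := sphPt_periodic.int_mul k y'
      rw [← h.per' hsp]
      rw [← hsp] at hne'
      have hy'' := hy'.shift h.mf.per k
      generalize y' + k * τ = w at *
      rcases le_or_gt w Q with h1 | h1
      · exact hmx (Z, w) ⟨hZ, hy'', hZm, ⟨hk.1, h1⟩, fun h0 => hne' (by rw [show Z = w from h0])⟩
      · have h2 := h.nc V Z Q w hZm.1 hZm.2 h1 hk.2
        rw [hb, min_le_iff] at h2
        have h3 := hmx (Z, V) ⟨hZ, hV, hZm, ⟨le_rfl, hVQ.le⟩, hZm.1.ne'⟩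
        dsimp only at h3
        rw [h.symm Z V] at h3
        rcases h2 with h2 | h2 <;> linarith
    · exact hmin Z y hZ hy ⟨hZm.1.le, hZm.2.le⟩ hym hZy (Or.inl hZm)
    · rw [h.symm]; exact hmin y Z hy hZ hym ⟨hZm.1.le, hZm.2.le⟩ hZy.symm (Or.inr hZm)
  · left
    obtain ⟨L, M1, hT⟩ := h.mf.tri_mx hV
    have h1 := hT.le_of_mx hQ hVQ
    have h2 : M1 = Q := by
      by_contra hne'
      exact hex ⟨M1, hT.mx', hT.lt1.trans hT.lt2, lt_of_le_of_ne h1 hne'⟩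
    subst h2
    refine ⟨V, L, M1, hT, hne, Or.inl ⟨?_, hb⟩⟩
    refine lt_of_le_of_ne ?_ fun he => hne (h.mf.inj _ _ hV.1 hQ.1 he)
    rw [← hb, h.symm]; exact h.le _ _ hQ hV

lemma exists_conf {φ ν b} (h : Good φ ν b) {x0 y0 : ℝ} (hx0 : IsMx φ x0) (hy0 : IsMx φ y0) (hne0 : sphPt x0 ≠ sphPt y0) :
    (∃ X Y Z, Conf φ b X Y Z) ∨ ∃ X Y Z, Conf (fun t => φ (-t)) (fun x y => b (-x) (-y)) X Y Z := by
  set S : Set (ℝ × ℝ) := {p | IsMx φ p.1 ∧ IsMx φ p.2 ∧ p.1 ≠ p.2 ∧ |p.1 - p.2| < τ ∧ b p.1 p.2 = φ p.1} with hS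
  by_cases hex : S.Nonempty
  · set cnt : ℝ × ℝ → ℕ := fun p => ({t | IsMx φ t} ∩ Set.Ioo (min p.1 p.2) (max p.1 p.2)).ncard with hcnt
    obtain ⟨⟨V, Q⟩, ⟨hV, hQ, hne, hlt, hb⟩, hmn⟩ := (measure cnt).wf.has_min S hex
    dsimp only at hV hQ hne hlt hb
    rw [abs_lt] at hlt
    have hmin : ∀ x y, IsMx φ x → IsMx φ y → x ∈ Set.Icc (min V Q) (max V Q) → y ∈ Set.Icc (min V Q) (max V Q) → x ≠ y →
      (x ∈ Set.Ioo (min V Q) (max V Q) ∨ y ∈ Set.Ioo (min V Q) (max V Q)) → b x y ≠ φ x := by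
      intro x y hx hy hxm hym hxy hor he
      have hlen : max V Q - min V Q < τ := by rw [max_sub_min_eq_abs, abs_lt]; constructor <;> linarith
      refine hmn (x, y) ⟨hx, hy, hxy, ?_, he⟩ ?_
      · dsimp only; rw [abs_lt]; constructor <;> linarith [hxm.1, hxm.2, hym.1, hym.2]
      · change cnt (x, y) < cnt (V, Q)
        refine Set.ncard_lt_ncard ⟨?_, ?_⟩ ((h.mf.fin_mx _ _).subset (Set.inter_subset_inter_right _ Set.Ioo_subset_Icc_self))
        · exact Set.inter_subset_inter_right _ (Set.Ioo_subset_Ioo (le_min hxm.1 hym.1) (max_le hxm.2 hym.2))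
        · intro hsub
          rcases hor with ho | ho
          · have := (hsub ⟨hx, ho⟩).2
            dsimp only at this
            rcases le_total x y with h1 | h1
            · rw [min_eq_left h1] at this; exact lt_irrefl _ this.1
            · rw [max_eq_left h1] at this; exact lt_irrefl _ this.2
          · have := (hsub ⟨hy, ho⟩).2
            dsimp only at this
            rcases le_total x y with h1 | h1
            · rw [max_eq_right h1] at this; exact lt_irrefl _ this.2
            · rw [min_eq_right h1] at this; exact lt_irrefl _ this.1
    rcases lt_or_gt_of_ne hne with h1 | h1
    · rw [min_eq_left h1.le, max_eq_right h1.le] at hmin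
      exact conf_pair h hV hQ h1 (by linarith) hb hmin
    · rw [min_eq_right h1.le, max_eq_left h1.le] at hmin
      have := conf_pair h.refl (V := -V) (Q := -Q) (by rw [isMx_refl, neg_neg]; exact hV)
        (by rw [isMx_refl, neg_neg]; exact hQ) (by linarith) (by linarith) (by simpa using hb) (by
          intro x y hx hy hxm hym hxy hor
          refine hmin (-x) (-y) (isMx_refl.1 hx) (isMx_refl.1 hy) ⟨by linarith [hxm.2], by linarith [hxm.1]⟩
            ⟨by linarith [hym.2], by linarith [hym.1]⟩ (fun h0 => hxy (neg_injective h0)) ?_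
          exact hor.imp (fun h => ⟨by linarith [h.2], by linarith [h.1]⟩) (fun h => ⟨by linarith [h.2], by linarith [h.1]⟩))
      simp only [neg_neg] at this
      exact this.symm
  · set S' : Set (ℝ × ℝ) := {p | IsMx φ p.1 ∧ IsMx φ p.2 ∧ sphPt p.1 ≠ sphPt p.2 ∧ p.1 ∈ Set.Ico 0 (0 + τ) ∧ p.2 ∈ Set.Ico 0 (0 + τ)} with hS'
    have hf : S'.Finite := ((h.mf.fin_mx 0 (0 + τ)).prod (h.mf.fin_mx 0 (0 + τ))).subset
      fun p hp => ⟨⟨hp.1, hp.2.2.2.1.1, hp.2.2.2.1.2.le⟩, ⟨hp.2.1, hp.2.2.2.2.1, hp.2.2.2.2.2.le⟩⟩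
    obtain ⟨k, hk⟩ := exists_shift 0 x0
    obtain ⟨l, hl⟩ := exists_shift 0 y0
    obtain ⟨⟨Z, y⟩, ⟨hZ, hy, hZy, hZm, hym⟩, hmx⟩ := Set.exists_max_image S' (fun p => b p.1 p.2) hf
      ⟨(x0 + k * τ, y0 + l * τ), hx0.shift h.mf.per k, hy0.shift h.mf.per l,
        by dsimp only; rw [sphPt_periodic.int_mul, sphPt_periodic.int_mul]; exact hne0, hk, hl⟩
    dsimp only at hZ hy hZy hmx hZm hym
    have hnot : ∀ p, p ∉ S := fun p hp => hex ⟨p, hp⟩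
    refine confB h hZ hy hZy ?_ ?_ ?_
    · intro y' hy' hne'
      obtain ⟨k, hk⟩ := exists_shift 0 y'
      have hsp : sphPt (y' + k * τ) = sphPt y' := sphPt_periodic.int_mul k y'
      rw [← h.per' hsp]
      rw [← hsp] at hne'
      exact hmx (Z, _) ⟨hZ, hy'.shift h.mf.per k, hne'.symm, hZm, hk⟩
    · intro he
      exact hnot (Z, y) ⟨hZ, hy, fun h0 => hZy (by rw [show Z = y from h0]), by dsimp only; rw [abs_lt]; constructor <;> linarith [hZm.1, hZm.2, hym.1, hym.2], he⟩
    · intro he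
      rw [h.symm] at he
      exact hnot (y, Z) ⟨hy, hZ, fun h0 => hZy (by rw [show y = Z from h0]), by dsimp only; rw [abs_lt]; constructor <;> linarith [hZm.1, hZm.2, hym.1, hym.2], he⟩

lemma tri_M1le {φ : ℝ → ℝ} {M0 L0 X Y M1 : ℝ} (mf : MF φ) (t0 : Tri φ M0 L0 X) (t1 : Tri φ X Y M1)
    (ne : sphPt X ≠ sphPt M1) : M1 ≤ M0 + τ := by
  refine t1.le_of_mx (by simpa using t0.mx.shift mf.per 1) ?_
  by_contra hcon
  have h1 := t0.le_tau mf.per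
  have h2 : X = M0 + τ := le_antisymm h1 (not_lt.1 hcon)
  have h5 := t1.lt_tau mf.per ne
  have h4 := t0.shift mf.per 1
  simp only [Int.cast_one, one_mul] at h4
  rw [← h2] at h4
  have := h4.le_of_mx t1.mx' (t1.lt1.trans t1.lt2)
  linarith

structure RD (φ ψ : ℝ → ℝ) (M0 L0 X Y M1 a b : ℝ) : Prop where
  mf : MF φ
  t0 : Tri φ M0 L0 X
  t1 : Tri φ X Y M1
  ne : sphPt X ≠ sphPt M1
  sm : Sm ψ
  per : Function.Periodic ψ τ
  La : L0 < a
  bM : b < M1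
  eq : ∀ t ∈ Set.Icc b (a + τ), ψ t = φ t
  pos : ∀ t ∈ Set.Ioo L0 M1, 0 < deriv ψ t

namespace RD
variable {φ ψ : ℝ → ℝ} {M0 L0 X Y M1 a b : ℝ} (D : RD φ ψ M0 L0 X Y M1 a b)
include D

lemma M1lt : M1 < X + τ := D.t1.lt_tau D.mf.per D.ne

lemma M1le : M1 ≤ M0 + τ := tri_M1le D.mf D.t0 D.t1 D.ne

lemma M1L : M1 < L0 + τ := by linarith [D.M1le, D.t0.lt1]

lemma ev (t : ℝ) (ht : t ∈ Set.Icc M1 (L0 + τ)) : ∀ᶠ s in nhds t, ψ s = φ s := by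
  filter_upwards [Ioo_mem_nhds (show b < t by linarith [ht.1, D.bM]) (show t < a + τ by linarith [ht.2, D.La])] with s hs
  exact D.eq s ⟨hs.1.le, hs.2.le⟩

lemma d0 (t : ℝ) (ht : t ∈ Set.Icc M1 (L0 + τ)) : ψ t = φ t := (D.ev t ht).self_of_nhds
lemma d1 (t : ℝ) (ht : t ∈ Set.Icc M1 (L0 + τ)) : deriv ψ t = deriv φ t := Filter.EventuallyEq.deriv_eq (D.ev t ht)
lemma d2 (t : ℝ) (ht : t ∈ Set.Icc M1 (L0 + τ)) : deriv (deriv ψ) t = deriv (deriv φ) t :=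
  (Filter.EventuallyEq.deriv (D.ev t ht)).deriv_eq
lemma mx_iff (t : ℝ) (ht : t ∈ Set.Icc M1 (L0 + τ)) : IsMx ψ t ↔ IsMx φ t := by
  unfold IsMx; rw [D.d1 t ht, D.d2 t ht]
lemma mn_iff (t : ℝ) (ht : t ∈ Set.Icc M1 (L0 + τ)) : IsMn ψ t ↔ IsMn φ t := by
  unfold IsMn; rw [D.d1 t ht, D.d2 t ht]

lemma rep (t : ℝ) : ∃ k : ℤ, t + k * τ ∈ Set.Icc M1 (L0 + τ) ∨ t + k * τ ∈ Set.Ioo L0 M1 := by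
  obtain ⟨k, hk⟩ := exists_shift M1 t
  rcases le_or_gt (t + k * τ) (L0 + τ) with h | h
  · exact ⟨k, Or.inl ⟨hk.1, h⟩⟩
  · refine ⟨k - 1, Or.inr ?_⟩
    push_cast
    constructor <;> linarith [hk.2]

lemma node_in {t : ℝ} (ht : t ∈ Set.Ioo L0 M1) (h0 : deriv φ t = 0) : t = X ∨ t = Y := by
  rcases lt_trichotomy t X with h | h | h
  · exact absurd h0 (D.t0.d2 t ⟨ht.1, h⟩).ne'
  · exact Or.inl h
  · exact Or.inr (D.t1.eq_mn h0 h ht.2)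

lemma nodeψ {t : ℝ} (h0 : deriv ψ t = 0) : ∃ k : ℤ, t + k * τ ∈ Set.Icc M1 (L0 + τ) := by
  obtain ⟨k, h | h⟩ := D.rep t
  · exact ⟨k, h⟩
  · have := D.pos _ h
    rw [(deriv_per D.per).int_mul k t, h0] at this
    exact absurd this (lt_irrefl _)

lemma nodeφ {t : ℝ} (h0 : deriv φ t = 0) :
    (∃ k : ℤ, t + k * τ ∈ Set.Icc M1 (L0 + τ)) ∨ (∃ k : ℤ, t + k * τ = X) ∨ ∃ k : ℤ, t + k * τ = Y := by
  obtain ⟨k, h | h⟩ := D.rep t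
  · exact Or.inl ⟨k, h⟩
  · right
    rcases D.node_in h (by rw [(deriv_per D.mf.per).int_mul k t, h0]) with h1 | h1
    · exact Or.inl ⟨k, h1⟩
    · exact Or.inr ⟨k, h1⟩

/-- transfer at a point along shifts -/
lemma tr {t : ℝ} {k : ℤ} (h : t + k * τ ∈ Set.Icc M1 (L0 + τ)) :
    ψ t = φ t ∧ deriv ψ t = deriv φ t ∧ deriv (deriv ψ) t = deriv (deriv φ) t := by
  have h0 := D.d0 _ h
  have h1 := D.d1 _ h
  have h2 := D.d2 _ h
  rw [D.per.int_mul, D.mf.per.int_mul] at h0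
  rw [(deriv_per D.per).int_mul, (deriv_per D.mf.per).int_mul] at h1
  rw [(deriv_per (deriv_per D.per)).int_mul, (deriv_per (deriv_per D.mf.per)).int_mul] at h2
  exact ⟨h0, h1, h2⟩

lemma notX {t s : ℝ} {k : ℤ} (h : t + k * τ ∈ Set.Icc M1 (L0 + τ)) (hs : s ∈ Set.Ioo L0 M1) : sphPt t ≠ sphPt s := by
  intro he
  rw [← sphPt_periodic.int_mul k t] at he
  have hM := D.M1L
  refine sph_ne ?_ ?_ he
  · exact (lt_of_lt_of_le hs.2 h.1).ne'
  · rw [abs_of_pos (by linarith [h.1, hs.2])]; linarith [h.2, hs.1]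

lemma Xm : X ∈ Set.Ioo L0 M1 := ⟨D.t0.lt2, D.t1.lt1.trans D.t1.lt2⟩
lemma Ym : Y ∈ Set.Ioo L0 M1 := ⟨D.t0.lt2.trans D.t1.lt1, D.t1.lt2⟩

lemma mxψ {t : ℝ} (h : IsMx ψ t) : IsMx φ t ∧ ψ t = φ t ∧ sphPt t ≠ sphPt X := by
  obtain ⟨k, hk⟩ := D.nodeψ h.1
  obtain ⟨h0, h1, h2⟩ := D.tr hk
  exact ⟨by unfold IsMx at *; rwa [h1, h2] at h, h0, D.notX hk D.Xm⟩

lemma node_iff (p : E2) : (∃ t, deriv ψ t = 0 ∧ p = sphPt t) ↔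
    (∃ t, deriv φ t = 0 ∧ p = sphPt t) ∧ p ≠ sphPt X ∧ p ≠ sphPt Y := by
  constructor
  · rintro ⟨t, ht, rfl⟩
    obtain ⟨k, hk⟩ := D.nodeψ ht
    obtain ⟨h0, h1, h2⟩ := D.tr hk
    exact ⟨⟨t, by rw [← h1]; exact ht, rfl⟩, D.notX hk D.Xm, D.notX hk D.Ym⟩
  · rintro ⟨⟨t, ht, rfl⟩, h1, h2⟩
    rcases D.nodeφ ht with ⟨k, hk⟩ | ⟨k, hk⟩ | ⟨k, hk⟩
    · exact ⟨t, by rw [(D.tr hk).2.1]; exact ht, rfl⟩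
    · exact absurd (by rw [← hk, sphPt_periodic.int_mul]) h1
    · exact absurd (by rw [← hk, sphPt_periodic.int_mul]) h2

lemma triψ : Tri ψ M0 L0 M1 := by
  have e : ∀ t ∈ Set.Icc M0 L0, t + ((1 : ℤ) : ℝ) * τ ∈ Set.Icc M1 (L0 + τ) := fun t ht => by
    push_cast; constructor <;> linarith [ht.1, ht.2, D.M1le]
  refine ⟨D.t0.lt1, D.t0.lt2.trans (D.t1.lt1.trans D.t1.lt2), ?_, ?_, ?_, ?_, D.pos⟩
  · have := D.tr (e M0 ⟨le_rfl, D.t0.lt1.le⟩)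
    unfold IsMx; rw [this.2.1, this.2.2]; exact D.t0.mx
  · have := D.tr (e L0 ⟨D.t0.lt1.le, le_rfl⟩)
    unfold IsMn; rw [this.2.1, this.2.2]; exact D.t0.mn
  · exact (D.mx_iff _ ⟨le_rfl, D.M1L.le⟩).2 D.t1.mx'
  · intro t ht
    rw [(D.tr (e t ⟨ht.1.le, ht.2.le⟩)).2.1]; exact D.t0.d1 t ht

lemma ψL0 : ψ L0 = φ L0 :=
  (D.tr (t := L0) (k := 1) (by push_cast; constructor <;> linarith [D.M1L])).1

omit D in
lemma transfer {g h : ℝ → ℝ} {A B M L M' : ℝ} (h1 : ∀ t ∈ Set.Icc A B, deriv g t = deriv h t)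
    (h2 : ∀ t ∈ Set.Icc A B, deriv (deriv g) t = deriv (deriv h) t) (hA : IsMx g A) (hB : deriv g B = 0)
    (hT : Tri g M L M') (hL : L ∈ Set.Ioo A B) : Tri h M L M' := by
  have e1 : A ≤ M := hT.le_of_mx' hA (hL.1.trans hT.lt2)
  have e2 : M' ≤ B := by
    by_contra hcon
    exact (hT.d2 B ⟨hL.2, not_le.1 hcon⟩).ne' hB
  have hlt1 := hT.lt1
  have hlt2 := hT.lt2
  have m1 : M ∈ Set.Icc A B := ⟨e1, by linarith⟩
  have m2 : L ∈ Set.Icc A B := ⟨hL.1.le, hL.2.le⟩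
  have m3 : M' ∈ Set.Icc A B := ⟨by linarith, e2⟩
  refine ⟨hT.lt1, hT.lt2, ?_, ?_, ?_, ?_, ?_⟩
  · unfold IsMx; rw [← h1 _ m1, ← h2 _ m1]; exact hT.mx
  · unfold IsMn; rw [← h1 _ m2, ← h2 _ m2]; exact hT.mn
  · unfold IsMx; rw [← h1 _ m3, ← h2 _ m3]; exact hT.mx'
  · intro t ht; rw [← h1 t ⟨by linarith [ht.1], by linarith [ht.2]⟩]; exact hT.d1 t ht
  · intro t ht; rw [← h1 t ⟨by linarith [ht.1], by linarith [ht.2]⟩]; exact hT.d2 t ht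

lemma tri_of_ψ {M L M' : ℝ} (hT : Tri ψ M L M') : ∃ N K N', sphPt M = sphPt N ∧ sphPt L = sphPt K ∧
    sphPt M' = sphPt N' ∧ ψ L = φ K ∧ ((N = M0 ∧ K = L0 ∧ N' = M1) ∨ Tri φ N K N') := by
  obtain ⟨k, hk⟩ := D.nodeψ hT.mn.1
  have hT' := hT.shift D.per k
  have hM1 : IsMx ψ M1 := D.triψ.mx'
  rcases eq_or_lt_of_le hk.2 with h1 | h1
  · have h2 := D.triψ.shift D.per 1
    push_cast at h2
    simp only [one_mul] at h2
    rw [h1] at hT'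
    obtain ⟨h3, h4⟩ := hT'.uniq h2
    refine ⟨M0, L0, M1, ?_, ?_, ?_, ?_, Or.inl ⟨rfl, rfl, rfl⟩⟩
    · rw [← sphPt_periodic.int_mul k M, h3, sphPt_periodic]
    · rw [← sphPt_periodic.int_mul k L, h1, sphPt_periodic]
    · rw [← sphPt_periodic.int_mul k M', h4, sphPt_periodic]
    · rw [← D.per.int_mul k L, h1, D.per, D.ψL0]
  · refine ⟨_, _, _, (sphPt_periodic.int_mul k M).symm, (sphPt_periodic.int_mul k L).symm, (sphPt_periodic.int_mul k M').symm, ?_, Or.inr ?_⟩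
    · rw [← D.d0 _ hk, D.per.int_mul]
    · refine transfer (g := ψ) D.d1 D.d2 hM1 ?_ hT' ⟨lt_of_le_of_ne hk.1 fun he => ?_, h1⟩
      · rw [(deriv_per D.per)]; exact D.triψ.mn.1
      · exact mx_not_mn hM1 (he ▸ hT'.mn)

lemma tri_of_φ {M L M' : ℝ} (hT : Tri φ M L M') : ∃ N K N', sphPt M = sphPt N ∧ sphPt L = sphPt K ∧
    sphPt M' = sphPt N' ∧ φ L = φ K ∧ ((N = X ∧ K = Y ∧ N' = M1) ∨ (N = M0 ∧ K = L0 ∧ N' = X) ∨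
      (Tri ψ N K N' ∧ ψ K = φ K)) := by
  have key : ∀ {k : ℤ} {U V W : ℝ}, Tri φ U V W → L + k * τ = V →
      sphPt M = sphPt U ∧ sphPt L = sphPt V ∧ sphPt M' = sphPt W ∧ φ L = φ V := by
    intro k U V W hU hV
    have hT' := hT.shift D.mf.per k
    rw [hV] at hT'
    obtain ⟨h3, h4⟩ := hT'.uniq hU
    exact ⟨by rw [← h3, sphPt_periodic.int_mul], by rw [← hV, sphPt_periodic.int_mul],
      by rw [← h4, sphPt_periodic.int_mul], by rw [← hV, D.mf.per.int_mul]⟩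
  rcases D.nodeφ hT.mn.1 with ⟨k, hk⟩ | ⟨k, hk⟩ | ⟨k, hk⟩
  · rcases eq_or_lt_of_le hk.2 with h1 | h1
    · obtain ⟨k1, k2, k3, k4⟩ := key (k := k - 1) D.t0 (by push_cast; linarith)
      exact ⟨_, _, _, k1, k2, k3, k4, Or.inr (Or.inl ⟨rfl, rfl, rfl⟩)⟩
    · obtain ⟨k1, k2, k3, k4⟩ := key (hT.shift D.mf.per k) rfl
      refine ⟨_, _, _, k1, k2, k3, k4, Or.inr (Or.inr ⟨?_, D.d0 _ hk⟩)⟩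
      refine transfer (g := φ) (fun t ht => (D.d1 t ht).symm) (fun t ht => (D.d2 t ht).symm) D.t1.mx' ?_ 
        (hT.shift D.mf.per k) ⟨lt_of_le_of_ne hk.1 fun he => ?_, h1⟩
      · rw [(deriv_per D.mf.per)]; exact D.t0.mn.1
      · exact mx_not_mn D.t1.mx' (he ▸ hT.mn.shift D.mf.per k)
  · exact (mx_not_mn D.t0.mx' (hk ▸ hT.mn.shift D.mf.per k)).elim
  · obtain ⟨k1, k2, k3, k4⟩ := key D.t1 hk
    exact ⟨_, _, _, k1, k2, k3, k4, Or.inl ⟨rfl, rfl, rfl⟩⟩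

lemma mfψ : MF ψ := by
  refine ⟨D.sm, D.per, fun t ht => ?_, fun s t hs ht he => ?_⟩
  · obtain ⟨k, hk⟩ := D.nodeψ ht
    obtain ⟨h0, h1, h2⟩ := D.tr hk
    rw [h2]; exact D.mf.nd t (h1 ▸ ht)
  · obtain ⟨k, hk⟩ := D.nodeψ ht
    obtain ⟨h0, h1, h2⟩ := D.tr hk
    obtain ⟨k', hk'⟩ := D.nodeψ hs
    obtain ⟨h0', h1', h2'⟩ := D.tr hk'
    exact D.mf.inj s t (h1' ▸ hs) (h1 ▸ ht) (by rw [← h0', ← h0, he])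

lemma good {ν : E2 → ℤ} {β : ℝ → ℝ → ℝ} (G : Good φ ν β) (hc : φ L0 < β X M1)
    (hw : ∀ x, IsMx φ x → sphPt x ≠ sphPt X → β X M1 = φ Y → β x X ≤ φ Y) : Good ψ ν β := by
  have hadj := G.adj _ _ _ D.t0
  have hb1 : φ L0 ≤ β M0 M1 := (le_min hadj hc.le).trans (G.ultra M0 X M1)
  have hiff : β M0 M1 = φ L0 ↔ β M0 X = φ L0 := by
    have u1 := G.ultra M0 M1 X
    have u2 := G.ultra M0 X M1
    rw [G.symm M1 X] at u1
    rw [min_le_iff] at u1 u2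
    constructor
    · intro h
      rcases u2 with u | u <;> linarith
    · intro h
      rcases u1 with u | u <;> linarith
  refine ⟨D.mfψ, G.νs, G.symm, G.per, fun x hx => ?_, fun x y hx hy => ?_, G.ultra, fun M L M' hT => ?_, G.nc, fun x y hx hy hxy => ?_,
    fun V Q hV hQ hVQ he => ?_, fun M L M' hT he => ?_⟩
  · obtain ⟨h1, h2, -⟩ := D.mxψ hx
    rw [h2]; exact G.self _ h1
  · obtain ⟨h1, h2, -⟩ := D.mxψ hx
    rw [h2]; exact G.le _ _ h1 (D.mxψ hy).1
  · obtain ⟨N, K, N', h1, h2, h3, h4, h5⟩ := D.tri_of_ψ hT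
    rw [G.per _ _ _ h1, G.per' h3, h4]
    rcases h5 with ⟨rfl, rfl, rfl⟩ | h5
    · exact hb1
    · exact G.adj _ _ _ h5
  · obtain ⟨h1, h2, h3⟩ := D.mxψ hx
    obtain ⟨h1', h2', h3'⟩ := D.mxψ hy
    have hW : ∀ x y, IsMx φ x → sphPt x ≠ sphPt X → Wit φ β x y → Wit ψ β x y := by
      rintro x y hx hxX ⟨M, L, M', hT, w1, w2, w3, w4⟩
      obtain ⟨N, K, N', e1, e2, e3, e4, e5⟩ := D.tri_of_φ hT
      rw [G.per _ _ _ e1, G.per' e3, e4] at w1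
      rw [e4] at w2
      rw [e4, G.per' e1] at w3
      rw [e4, G.per' e3] at w4
      rcases e5 with ⟨rfl, rfl, rfl⟩ | ⟨rfl, rfl, rfl⟩ | ⟨e5, e6⟩
      · exact absurd (hw x hx hxX w1) (not_le.2 w3)
      · refine ⟨_, _, _, D.triψ, ?_, ?_, ?_, ?_⟩ <;> rw [D.ψL0]
        · exact hiff.2 w1
        · exact w2
        · exact w3
        · exact (lt_min w4 hc).trans_le (G.ultra _ _ _)
      · exact ⟨_, _, _, e5, by rw [e6]; exact w1, by rw [e6]; exact w2, by rw [e6]; exact w3, by rw [e6]; exact w4⟩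
    rw [h2, h2']
    rcases G.p0 x y h1 h1' hxy with h | h | h | h
    · exact Or.inl h
    · exact Or.inr (Or.inl h)
    · exact Or.inr (Or.inr (Or.inl (hW _ _ h1 h3 h)))
    · exact Or.inr (Or.inr (Or.inr (hW _ _ h1' h3' h)))
  · obtain ⟨h1, h2, -⟩ := D.mxψ hV
    exact G.nx V Q h1 (D.mxψ hQ).1 hVQ (by rw [← h2]; exact he)
  · obtain ⟨N, K, N', h1, h2, h3, h4, h5⟩ := D.tri_of_ψ hT
    rw [G.per _ _ _ h1, G.per' h3, h4] at he
    rw [h2]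
    rcases h5 with ⟨rfl, rfl, rfl⟩ | h5
    · exact G.nn _ _ _ D.t0 (hiff.1 he)
    · exact G.nn _ _ _ h5 he

end RD

lemma upd_per {ν : ℝ → ℤ} (h : Function.Periodic ν τ) (t0 : ℝ) (z : ℤ) : Function.Periodic (upd ν t0 z) τ := fun t => by
  simp only [upd, sphPt_periodic t, h t]

lemma stepA {φ : ℝ → ℝ} (mf : MF φ) {M0 L0 X Y M1 : ℝ} (t0 : Tri φ M0 L0 X) (t1 : Tri φ X Y M1)
    (ne : sphPt X ≠ sphPt M1) (hlt : φ X < φ M1) : ∃ ψ a b, RD φ ψ M0 L0 X Y M1 a b ∧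
      ∀ ν : ℝ → ℤ, Function.Periodic ν τ → ν X = -1 → ν Y = 1 → ∀ q, QQ ψ ν q → QQ φ ν q := by
  have hM1L : M1 < L0 + τ := by linarith [tri_M1le mf t0 t1 ne, t0.lt1]
  obtain ⟨ψ, a, b, h1, h2, h3, h4, h5, h6, h7⟩ := rem1D mf.sm mf.per t0.lt2 t1.lt1 t1.lt2 hM1L t0.d2 t1.d1 t1.d2 hlt
  refine ⟨ψ, a, b, ⟨mf, t0, t1, ne, h1, h2, h3, h4, h5, h6⟩, fun ν hν hX hY q hQ => ?_⟩
  exact birthA mf.sm mf.per t0.lt2 t1.lt1 t1.lt2 hM1L t0.d2 t1.d2 t1.mx.1 t1.mx.2 t1.mn.1 t1.mn.2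
    (fun t ht => (t1.d1 t ht).ne) h2 h3 h4 h5 h6 h7 hν hX hY hQ

lemma stepB {φ : ℝ → ℝ} (mf : MF φ) {M0 L0 X Y M1 : ℝ} (t0 : Tri φ M0 L0 X) (t1 : Tri φ X Y M1)
    (ne : sphPt X ≠ sphPt M1) (hlt : φ L0 < φ Y) : ∃ ψ a b, RD φ ψ M0 L0 X Y M1 a b ∧
      ∀ ν : ℝ → ℤ, Function.Periodic ν τ → ν X = 1 → ν Y = -1 → ∀ q, QQ ψ ν q → QQ φ ν q := by
  have hM1L : M1 < L0 + τ := by linarith [tri_M1le mf t0 t1 ne, t0.lt1]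
  set χ : ℝ → ℝ := fun t => - φ (-t) with hχ
  have mχ : MF χ := mf.refl.neg
  have dχ : ∀ t, deriv χ t = deriv φ (-t) := fun t => by
    have : deriv χ t = - deriv (fun t => φ (-t)) t := by simp [hχ]
    rw [this, deriv_refl, neg_neg]
  have dχ2 : ∀ t, deriv (deriv χ) t = - deriv (deriv φ) (-t) := fun t => by
    rw [show deriv χ = fun t => deriv φ (-t) from funext dχ, deriv_refl]
  have e1 : ∀ t ∈ Set.Ioo (-M1) (-Y), 0 < deriv χ t := fun t ht => by
    rw [dχ]; exact t1.d2 _ ⟨by linarith [ht.2], by linarith [ht.1]⟩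
  have e2 : ∀ t ∈ Set.Ioo (-Y) (-X), deriv χ t < 0 := fun t ht => by
    rw [dχ]; exact t1.d1 _ ⟨by linarith [ht.2], by linarith [ht.1]⟩
  have e3 : ∀ t ∈ Set.Ioo (-X) (-L0), 0 < deriv χ t := fun t ht => by
    rw [dχ]; exact t0.d2 _ ⟨by linarith [ht.2], by linarith [ht.1]⟩
  obtain ⟨ψ, a, b, h1, h2, h3, h4, h5, h6, h7⟩ := rem1D mχ.sm mχ.per (neg_lt_neg t1.lt2) (neg_lt_neg t1.lt1)
    (neg_lt_neg t0.lt2) (by linarith) e1 e2 e3 (by simp only [hχ, neg_neg]; linarith)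
  have hψp : Function.Periodic (fun t => - ψ (-t)) τ := fun t => by
    simp only [neg_add]; rw [← sub_eq_add_neg, h2.sub_eq]
  refine ⟨fun t => - ψ (-t), -b, -a, ⟨mf, t0, t1, ne, (h1.comp contDiff_neg).neg, hψp, by linarith, by linarith, ?_, ?_⟩,
    fun ν hν hX hY q hQ => ?_⟩
  · intro t ht
    have := h5 (-t + τ) ⟨by linarith [ht.2], by linarith [ht.1]⟩
    rw [h2, mχ.per] at this
    simp only [this, hχ, neg_neg]
  · intro t ht
    have : deriv (fun t => - ψ (-t)) t = - deriv (fun t => ψ (-t)) t := by simp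
    rw [this, deriv_refl, neg_neg]
    exact h6 _ ⟨by linarith [ht.2], by linarith [ht.1]⟩
  · have hQ1 := QQ_neg (QQ_refl hQ)
    simp only [neg_neg] at hQ1
    have hν' : Function.Periodic (fun t => ν (-t)) τ := fun t => by
      simp only [neg_add]; rw [← sub_eq_add_neg, hν.sub_eq]
    have := birthA (φ := χ) (ψ := ψ) (ν := fun t => ν (-t)) mχ.sm mχ.per (neg_lt_neg t1.lt2) (neg_lt_neg t1.lt1)
      (neg_lt_neg t0.lt2) (by linarith) e1 e3 (by rw [dχ, neg_neg]; exact t1.mn.1)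
      (by rw [dχ2, neg_neg]; linarith [t1.mn.2]) (by rw [dχ, neg_neg]; exact t1.mx.1)
      (by rw [dχ2, neg_neg]; linarith [t1.mx.2]) (fun t ht => (e2 t ht).ne) h2 h3 h4 h5 h6 h7 hν' (by simpa using hY) (by simpa using hX) hQ1
    have := QQ_refl (QQ_neg this)
    simpa [hχ] using this

def Goal (φ : ℝ → ℝ) (ν : E2 → ℤ) (T : Finset E2) : Prop :=
  ∃ q : ℕ, 2 * (q : ℤ) = 2 - ∑ p ∈ T, ν p ∧ QQ φ (fun t => ν (sphPt t)) q

lemma νper (ν : E2 → ℤ) : Function.Periodic (fun t => ν (sphPt t)) τ := fun t => by simp only [sphPt_periodic t]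

lemma sum_two {ν : E2 → ℤ} {T : Finset E2} {P Q : E2} (hP : P ∈ T) (hQ : Q ∈ T) (h : P ≠ Q) :
    ∑ p ∈ T, ν p = ∑ p ∈ (T.erase P).erase Q, ν p + ν P + ν Q := by
  rw [← Finset.sum_erase_add _ _ hP, ← Finset.sum_erase_add (T.erase P) _ (Finset.mem_erase.2 ⟨h.symm, hQ⟩)]
  ring

lemma step {N : ℕ} (IH : ∀ N' < N, ∀ φ ν β (T : Finset E2), Good φ ν β →
      (∀ p, p ∈ T ↔ ∃ t, deriv φ t = 0 ∧ p = sphPt t) → T.card = N' → Goal φ ν T)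
    {φ ν β} {T : Finset E2} (G : Good φ ν β) (hT : ∀ p, p ∈ T ↔ ∃ t, deriv φ t = 0 ∧ p = sphPt t)
    (hN : T.card = N) {X Y Z : ℝ} (hC : Conf φ β X Y Z) : Goal φ ν T := by
  obtain ⟨t1, ne, hAB⟩ := hC
  obtain ⟨M0, L0, t0⟩ := G.mf.tri_mx' t1.mx
  have hXT : sphPt X ∈ T := (hT _).2 ⟨X, t1.mx.1, rfl⟩
  have hYT : sphPt Y ∈ T := (hT _).2 ⟨Y, t1.mn.1, rfl⟩
  have hlt := t1.lt_tau G.mf.per ne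
  have h01 := t0.lt1
  have h02 := t0.lt2
  have h11 := t1.lt1
  have h12 := t1.lt2
  have hM1le := tri_M1le G.mf t0 t1 ne
  have hXY : sphPt X ≠ sphPt Y := sph_ne h11.ne (by rw [abs_lt]; constructor <;> linarith)
  have hcard : ((T.erase (sphPt X)).erase (sphPt Y)).card < N := by
    rw [← hN]
    exact (Finset.card_erase_le).trans_lt (Finset.card_erase_lt_of_mem hXT)
  have hT' : ∀ {ψ a b}, RD φ ψ M0 L0 X Y Z a b → ∀ p, p ∈ (T.erase (sphPt X)).erase (sphPt Y) ↔ ∃ t, deriv ψ t = 0 ∧ p = sphPt t := by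
    intro ψ a b D p
    rw [D.node_iff, Finset.mem_erase, Finset.mem_erase, hT]; exact ⟨fun h => ⟨h.2.2, h.2.1, h.1⟩, fun h => ⟨h.2.2, h.2.1, h.1⟩⟩
  rcases hAB with ⟨h1, h2⟩ | ⟨h1, h2⟩
  · obtain ⟨ψ, a, b, D, hD⟩ := stepA G.mf t0 t1 ne h1
    have Gψ := D.good G (by rw [h2]; exact (t0.mono G.mf.sm).2) (fun x _ _ he => by
      rw [h2] at he; exact absurd he (t1.mono G.mf.sm).1.ne')
    obtain ⟨q, hq, hQ⟩ := IH _ hcard ψ ν β _ Gψ (hT' D) rfl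
    have hνX := G.nx X Z t1.mx t1.mx' ne h2
    have hQ2 : QQ φ (upd (fun t => ν (sphPt t)) Y 1) q := by
      refine hD _ (upd_per (νper ν) _ _) (by rw [upd_ne hXY, hνX]) (upd_same rfl) q (QQ_congr (fun t ht => ?_) hQ)
      rw [upd_ne ((D.node_iff _).1 ⟨t, ht, rfl⟩).2.2]
    have hs := sum_two (ν := ν) hXT hYT hXY
    rcases G.νs (sphPt Y) with hY | hY
    · exact ⟨q, by rw [hs]; linarith, QQ_flip' G.mf.per (νper ν) t1.mn.1 t1.mn.2.ne' (Or.inl ⟨hY, rfl⟩) hQ2⟩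
    · exact ⟨q + 1, by rw [hs]; push_cast; linarith, QQ_flip' G.mf.per (νper ν) t1.mn.1 t1.mn.2.ne' (Or.inr ⟨hY, rfl⟩) hQ2⟩
  · have hLY : φ L0 < φ Y := by
      have e1 := G.adj _ _ _ t0
      have e2 := h2 M0 t0.mx (sph_ne (by linarith) (by rw [abs_lt]; constructor <;> linarith))
      rw [G.symm] at e2
      refine lt_of_le_of_ne (e1.trans e2) fun he => ?_
      exact sph_ne (by linarith : L0 ≠ Y) (by rw [abs_lt]; constructor <;> linarith) (G.mf.inj _ _ t0.mn.1 t1.mn.1 he)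
    obtain ⟨ψ, a, b, D, hD⟩ := stepB G.mf t0 t1 ne hLY
    have Gψ := D.good G (by rw [h1]; exact hLY) (fun x hx hxX _ => by rw [G.symm]; exact h2 x hx hxX)
    obtain ⟨q, hq, hQ⟩ := IH _ hcard ψ ν β _ Gψ (hT' D) rfl
    have hνY := G.nn _ _ _ t1 h1
    have hQ2 : QQ φ (upd (fun t => ν (sphPt t)) X 1) q := by
      refine hD _ (upd_per (νper ν) _ _) (upd_same rfl) (by rw [upd_ne hXY.symm, hνY]) q (QQ_congr (fun t ht => ?_) hQ)
      rw [upd_ne ((D.node_iff _).1 ⟨t, ht, rfl⟩).2.1]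
    have hs := sum_two (ν := ν) hXT hYT hXY
    rcases G.νs (sphPt X) with hX | hX
    · exact ⟨q, by rw [hs]; linarith, QQ_flip' G.mf.per (νper ν) t1.mx.1 t1.mx.2.ne (Or.inl ⟨hX, rfl⟩) hQ2⟩
    · exact ⟨q + 1, by rw [hs]; push_cast; linarith, QQ_flip' G.mf.per (νper ν) t1.mx.1 t1.mx.2.ne (Or.inr ⟨hX, rfl⟩) hQ2⟩

lemma base_case {φ ν β} {T : Finset E2} (G : Good φ ν β) (hT : ∀ p, p ∈ T ↔ ∃ t, deriv φ t = 0 ∧ p = sphPt t)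
    (hone : ∀ x y, IsMx φ x → IsMx φ y → sphPt x = sphPt y) : Goal φ ν T := by
  obtain ⟨M, hM⟩ := G.mf.exists_mx
  obtain ⟨m, M', t1⟩ := G.mf.tri_mx hM
  have hp := G.mf.per
  have hM' : M' = M + τ := by
    refine le_antisymm (t1.le_tau hp) ?_
    by_contra hlt
    exact sph_ne (by linarith [t1.lt1, t1.lt2] : M ≠ M') (by rw [abs_lt]; constructor <;> linarith [t1.lt1, t1.lt2]) (hone _ _ hM t1.mx')
  subst hM'
  have hne : sphPt M ≠ sphPt m := sph_ne t1.lt1.ne (by rw [abs_lt]; constructor <;> linarith [t1.lt1, t1.lt2])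
  have hTe : (T.erase (sphPt M)).erase (sphPt m) = ∅ := by
    rw [Finset.eq_empty_iff_forall_notMem]
    intro p hp'
    rw [Finset.mem_erase, Finset.mem_erase, hT] at hp'
    obtain ⟨h1, h2, t, ht, rfl⟩ := hp'
    obtain ⟨k, hk⟩ := exists_shift M t
    rw [← sphPt_periodic.int_mul k t] at h1 h2
    rw [← (deriv_per hp).int_mul k t] at ht
    rcases eq_or_lt_of_le hk.1 with h3 | h3
    · exact h2 (by rw [← h3])
    · exact h1 (by rw [t1.eq_mn ht h3 hk.2])
  have hs := sum_two (ν := ν) ((hT _).2 ⟨M, hM.1, rfl⟩) ((hT _).2 ⟨m, t1.mn.1, rfl⟩) hne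
  rw [hTe, Finset.sum_empty, zero_add] at hs
  have hQ0 : QQ φ (upd (upd (fun t => ν (sphPt t)) m 1) M 1) 0 :=
    base2 G.mf.sm hp hM t1.mn t1.lt1 t1.lt2 t1.d1 t1.d2 (upd_per (upd_per (νper ν) _ _) _ _) (upd_same rfl)
      (by rw [upd_ne hne.symm, upd_same rfl])
  have hQ1 : ∃ q : ℕ, 2 * (q : ℤ) = 1 - ν (sphPt M) ∧ QQ φ (upd (fun t => ν (sphPt t)) m 1) q := by
    rcases G.νs (sphPt M) with h | h
    · exact ⟨0, by rw [h]; norm_num, QQ_flip' hp (upd_per (νper ν) _ _) hM.1 hM.2.ne (Or.inl ⟨by rw [upd_ne hne]; exact h, rfl⟩) hQ0⟩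
    · exact ⟨1, by rw [h]; norm_num, QQ_flip' hp (upd_per (νper ν) _ _) hM.1 hM.2.ne (Or.inr ⟨by rw [upd_ne hne]; exact h, rfl⟩) hQ0⟩
  obtain ⟨q, hq, hQ1⟩ := hQ1
  rcases G.νs (sphPt m) with h | h
  · exact ⟨q, by rw [hs]; linarith, QQ_flip' hp (νper ν) t1.mn.1 t1.mn.2.ne' (Or.inl ⟨h, rfl⟩) hQ1⟩
  · exact ⟨q + 1, by rw [hs]; push_cast; linarith, QQ_flip' hp (νper ν) t1.mn.1 t1.mn.2.ne' (Or.inr ⟨h, rfl⟩) hQ1⟩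

theorem main_ind : ∀ N : ℕ, ∀ φ ν β (T : Finset E2), Good φ ν β →
      (∀ p, p ∈ T ↔ ∃ t, deriv φ t = 0 ∧ p = sphPt t) → T.card = N → Goal φ ν T := by
  intro N
  induction N using Nat.strong_induction_on with
  | _ N IH =>
  intro φ ν β T G hT hN
  by_cases hex : ∃ x y, IsMx φ x ∧ IsMx φ y ∧ sphPt x ≠ sphPt y
  · obtain ⟨x, y, hx, hy, hxy⟩ := hex
    rcases exists_conf G hx hy hxy with ⟨X, Y, Z, hC⟩ | ⟨X, Y, Z, hC⟩
    · exact step IH G hT hN hC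
    · have hinj : Function.Injective rflE := rflE.injective
      have hinv : ∀ p, rflE (rflE p) = p := fun p => by
        obtain ⟨t, -, ht⟩ := exists_polar p
        rw [ht, map_smul, map_smul, rflE_sph, rflE_sph, neg_neg]
      obtain ⟨q, hq, hQ⟩ := step (T := T.image rflE) IH G.refl (by
        intro p
        rw [Finset.mem_image]
        constructor
        · rintro ⟨p', hp', rfl⟩
          obtain ⟨t, ht, rfl⟩ := (hT p').1 hp'
          exact ⟨-t, by rw [deriv_refl, neg_neg, ht, neg_zero], rflE_sph t⟩
        · rintro ⟨t, ht, rfl⟩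
          rw [deriv_refl, neg_eq_zero] at ht
          exact ⟨sphPt (-t), (hT _).2 ⟨-t, ht, rfl⟩, by rw [rflE_sph, neg_neg]⟩) (by rw [Finset.card_image_of_injective _ hinj, hN]) hC
      refine ⟨q, ?_, ?_⟩
      · rw [Finset.sum_image (fun a _ b _ h => hinj h)] at hq
        simpa only [hinv] using hq
      · have := QQ_refl hQ
        simp only [neg_neg, rfl_sph, hinv] at this
        exact this
  · push Not at hex
    exact base_case G hT (fun x y hx hy => hex x y hx hy)

lemma edge_aux {h : ℝ → ℂ} (hh : Continuous h) {th al be r : ℝ} (hr : 0 < r)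
    (hpos : ∀ t ∈ Set.Icc (0:ℝ) 1, 0 < Real.cos ((h t).im - th))
    (h0 : (h 0).im = al) (hal : |al - th| < Real.pi / 2) (hbe : |be - th| < Real.pi / 2)
    (h1 : Complex.exp (h 1) = r * Complex.exp (be * Complex.I)) : (h 1).im = be := by
  have hc : Continuous (fun t => (h t).im - th) := by fun_prop
  have key : |(h 1).im - th| < Real.pi / 2 := by
    by_contra hcon
    push Not at hcon
    have hc2 : ContinuousOn (fun t => |(h t).im - th|) (Set.Icc 0 1) := hc.abs.continuousOn
    obtain ⟨t, ht, he⟩ := intermediate_value_Icc (zero_le_one) hc2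
      (show Real.pi/2 ∈ Set.Icc |(h 0).im - th| |(h 1).im - th| from ⟨by rw [h0]; exact hal.le, hcon⟩)
    have := hpos t ht
    rw [← Real.cos_abs] at this
    simp only at he
    rw [he, Real.cos_pi_div_two] at this
    exact lt_irrefl _ this
  have e1 : Complex.exp (h 1) = Complex.exp (Real.log r + be * Complex.I) := by
    rw [h1, Complex.exp_add, ← Complex.ofReal_exp, Real.exp_log hr]
  rw [Complex.exp_eq_exp_iff_exists_int] at e1
  obtain ⟨n, hn⟩ := e1
  have e2 := congrArg Complex.im hn
  simp at e2
  rw [abs_lt] at key hbe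
  have hn0 : n = 0 := by
    have hp := Real.pi_pos
    have h3 : (n:ℝ) < 1 := by by_contra hc; push Not at hc; nlinarith
    have h4 : (-1:ℝ) < n := by by_contra hc; push Not at hc; nlinarith
    have h5 : n < 1 := by exact_mod_cast h3
    have h6 : -1 < n := by exact_mod_cast h4
    omega
  rw [e2, hn0]; simp

def toC (x : E2) : ℂ := ⟨x 0, x 1⟩

lemma toC_cont : Continuous toC := by
  have : toC = fun x : E2 => ((x 0 : ℝ) : ℂ) + (x 1 : ℝ) * Complex.I := by
    ext x; apply Complex.ext <;> simp [toC]
  rw [this]; fun_prop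

lemma toC_sph_sub (x y : ℝ) : toC (sphPt x - sphPt y) =
    ((2 * Real.sin ((y - x)/2) : ℝ) : ℂ) * Complex.exp ((((x + y)/2 - Real.pi/2 : ℝ) : ℂ) * Complex.I) := by
  rw [Complex.exp_mul_I, ← Complex.ofReal_cos, ← Complex.ofReal_sin]
  rw [Real.cos_sub_pi_div_two, Real.sin_sub_pi_div_two]
  have e1 := Real.cos_sub_cos x y
  have e2 := Real.sin_sub_sin x y
  have e3 : Real.sin ((y - x)/2) = - Real.sin ((x-y)/2) := by rw [← Real.sin_neg]; congr 1; ring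
  rw [e3]
  generalize Real.sin ((x-y)/2) = p at *
  generalize Real.sin ((x+y)/2) = q at *
  generalize Real.cos ((x+y)/2) = r at *
  apply Complex.ext
  · simp [toC, sphPt_zero]; rw [e1]; try ring
  · simp [toC, sphPt_one]; rw [e2]; try ring

lemma inner_pos_of_le {x : E2} {a : ℝ} (hx : ‖x‖ ≤ 1) (hne : x ≠ sphPt a) : 0 < ⟪sphPt a - x, sphPt a⟫ := by
  have h1 : ⟪sphPt a - x, sphPt a⟫ = 1 - ⟪x, sphPt a⟫ := by
    rw [inner_sub_left, real_inner_self_eq_norm_sq, sphPt_norm]; norm_num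
  have h2 : 0 < ‖sphPt a - x‖ := norm_pos_iff.2 (sub_ne_zero.2 hne.symm)
  have h3 : ‖sphPt a - x‖^2 = 1 - 2 * ⟪x, sphPt a⟫ + ‖x‖^2 := by
    rw [norm_sub_sq_real, sphPt_norm, real_inner_comm]; ring
  rw [h1]
  have h4 := norm_nonneg x
  nlinarith

lemma toC_inner (z : ℂ) (y : E2) (a : ℝ) (h : Complex.exp z = toC y) :
    ⟪y, sphPt a⟫ = Real.exp z.re * Real.cos (z.im - a) := by
  have h0 := congrArg Complex.re h
  have h1 := congrArg Complex.im h
  rw [Complex.exp_re] at h0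
  rw [Complex.exp_im] at h1
  simp only [toC] at h0 h1
  rw [E2_inner, sphPt_zero, sphPt_one, ← h0, ← h1, Real.cos_sub]; ring

lemma crossing {a b c d : ℝ} (hab : a < b) (hbc : b < c) (hcd : c < d) (hda : d < a + τ)
    (γ : Path (sphPt a) (sphPt c)) (δ : Path (sphPt b) (sphPt d))
    (hγ : ∀ t, ‖γ t‖ ≤ 1) (hδ : ∀ t, ‖δ t‖ ≤ 1) : ∃ s t, γ s = δ t := by
  by_contra hcon
  push Not at hcon
  have hτ : τ = 2 * Real.pi := rfl
  have hp := Real.pi_pos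
  have hγe : ∀ s, ∃ s', γ.extend s = γ s' := fun s => ⟨_, rfl⟩
  have hδe : ∀ s, ∃ s', δ.extend s = δ s' := fun s => ⟨_, rfl⟩
  have hne : ∀ s t, γ.extend s ≠ δ.extend t := by
    intro s t
    obtain ⟨s', hs⟩ := hγe s
    obtain ⟨t', ht⟩ := hδe t
    rw [hs, ht]; exact hcon _ _
  have hγ1 : ∀ s, ‖γ.extend s‖ ≤ 1 := fun s => by obtain ⟨s', hs⟩ := hγe s; rw [hs]; exact hγ _
  have hδ1 : ∀ s, ‖δ.extend s‖ ≤ 1 := fun s => by obtain ⟨s', hs⟩ := hδe s; rw [hs]; exact hδ _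
  have toC_ne : ∀ x : E2, x ≠ 0 → toC x ≠ 0 := by
    intro x hx h; apply hx
    exact E2_ext (by simpa [toC] using congrArg Complex.re h) (by simpa [toC] using congrArg Complex.im h)
  have hcH : Continuous (fun p : ℝ × ℝ => toC (γ.extend p.1 - δ.extend p.2)) :=
    toC_cont.comp ((γ.continuous_extend.comp continuous_fst).sub (δ.continuous_extend.comp continuous_snd))
  let H : C(ℝ × ℝ, {z : ℂ // z ≠ 0}) :=
    ⟨fun p => ⟨toC (γ.extend p.1 - δ.extend p.2), toC_ne _ (sub_ne_zero.2 (hne _ _))⟩,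
      hcH.subtype_mk _⟩
  have hs1 : 0 < Real.sin ((b - a)/2) := Real.sin_pos_of_pos_of_lt_pi (by linarith) (by linarith)
  have hs2 : 0 < Real.sin ((d - a)/2) := Real.sin_pos_of_pos_of_lt_pi (by linarith) (by linarith)
  have hs3 : 0 < Real.sin ((c - b)/2) := Real.sin_pos_of_pos_of_lt_pi (by linarith) (by linarith)
  have hs4 : 0 < Real.sin ((d - c)/2) := Real.sin_pos_of_pos_of_lt_pi (by linarith) (by linarith)
  obtain ⟨L, ⟨hL0, hL⟩, -⟩ := Complex.isCoveringMap_exp.existsUnique_continuousMap_lifts H (0, 0)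
    (Real.log (2 * Real.sin ((b-a)/2)) + (((a + b)/2 - Real.pi/2 : ℝ) : ℂ) * Complex.I) (by
      apply Subtype.ext
      simp only [H, ContinuousMap.coe_mk, Path.extend_zero]
      rw [toC_sph_sub, Complex.exp_add, ← Complex.ofReal_exp, Real.exp_log (by linarith)])
  have hexp : ∀ s t, Complex.exp (L (s, t)) = toC (γ.extend s - δ.extend t) := by
    intro s t
    have := congrArg Subtype.val (congrFun hL (s, t))
    simpa [H] using this
  have hLc := L.continuous
  have c00 : (L (0,0)).im = (a+b)/2 - Real.pi/2 := by rw [hL0]; simp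
  -- edges
  have E1 : (L (0,1)).im = (a+d)/2 - Real.pi/2 := by
    refine edge_aux (h := fun t => L (0,t)) (by fun_prop) (th := a) (al := (a+b)/2 - Real.pi/2)
      (r := 2 * Real.sin ((d-a)/2)) (by linarith) ?_ c00 (by rw [abs_lt]; constructor <;> linarith)
      (by rw [abs_lt]; constructor <;> linarith) ?_
    · intro t ht
      have h1 := toC_inner _ _ a (hexp 0 t)
      rw [Path.extend_zero] at h1
      have h2 := inner_pos_of_le (hδ1 t) (a := a) (by have := hne 0 t; rw [Path.extend_zero] at this; exact this.symm)
      rw [h1] at h2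
      exact pos_of_mul_pos_right h2 (Real.exp_pos _).le
    · rw [hexp, Path.extend_zero, Path.extend_one, toC_sph_sub]
  have E2' : (L (1,1)).im = (c+d)/2 - Real.pi/2 := by
    refine edge_aux (h := fun s => L (s,1)) (by fun_prop) (th := d - Real.pi) (al := (a+d)/2 - Real.pi/2)
      (r := 2 * Real.sin ((d-c)/2)) (by linarith) ?_ E1 (by rw [abs_lt]; constructor <;> linarith)
      (by rw [abs_lt]; constructor <;> linarith) ?_
    · intro s hs
      have h1 := toC_inner _ _ d (hexp s 1)
      rw [Path.extend_one] at h1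
      have h2 := inner_pos_of_le (hγ1 s) (a := d) (by have := hne s 1; rw [Path.extend_one] at this; exact this)
      have h3 : ⟪γ.extend s - sphPt d, sphPt d⟫ = - ⟪sphPt d - γ.extend s, sphPt d⟫ := by
        rw [← inner_neg_left]; congr 1; abel
      rw [h3] at h1
      rw [show (L (s,1)).im - (d - Real.pi) = (L (s,1)).im - d + Real.pi by ring, Real.cos_add_pi]
      have := Real.exp_pos (L (s,1)).re
      nlinarith
    · rw [hexp, Path.extend_one, Path.extend_one, toC_sph_sub]
  have E3 : (L (1,0)).im = (b+c)/2 - 3*Real.pi/2 := by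
    refine edge_aux (h := fun s => L (s,0)) (by fun_prop) (th := b - Real.pi) (al := (a+b)/2 - Real.pi/2)
      (r := 2 * Real.sin ((c-b)/2)) (by linarith) ?_ c00 (by rw [abs_lt]; constructor <;> linarith)
      (by rw [abs_lt]; constructor <;> linarith) ?_
    · intro s hs
      have h1 := toC_inner _ _ b (hexp s 0)
      rw [Path.extend_zero] at h1
      have h2 := inner_pos_of_le (hγ1 s) (a := b) (by have := hne s 0; rw [Path.extend_zero] at this; exact this)
      have h3 : ⟪γ.extend s - sphPt b, sphPt b⟫ = - ⟪sphPt b - γ.extend s, sphPt b⟫ := by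
        rw [← inner_neg_left]; congr 1; abel
      rw [h3] at h1
      rw [show (L (s,0)).im - (b - Real.pi) = (L (s,0)).im - b + Real.pi by ring, Real.cos_add_pi]
      have := Real.exp_pos (L (s,0)).re
      nlinarith
    · rw [hexp, Path.extend_one, Path.extend_zero, toC_sph_sub,
        show (b - c)/2 = -((c-b)/2) by ring, Real.sin_neg,
        show (((b+c)/2 - 3*Real.pi/2 : ℝ):ℂ) * Complex.I
          = (((c+b)/2 - Real.pi/2 : ℝ):ℂ) * Complex.I - Real.pi * Complex.I by push_cast; ring,
        Complex.exp_sub_pi_mul_I]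
      push_cast; ring
  have E4 : (L (1,1)).im = (c+d)/2 - 5 * Real.pi/2 := by
    refine edge_aux (h := fun t => L (1,t)) (by fun_prop) (th := c - 2 * Real.pi) (al := (b+c)/2 - 3*Real.pi/2)
      (r := 2 * Real.sin ((d-c)/2)) (by linarith) ?_ E3 (by rw [abs_lt]; constructor <;> linarith)
      (by rw [abs_lt]; constructor <;> linarith) ?_
    · intro t ht
      have h1 := toC_inner _ _ c (hexp 1 t)
      rw [Path.extend_one] at h1
      have h2 := inner_pos_of_le (hδ1 t) (a := c) (by have := hne 1 t; rw [Path.extend_one] at this; exact this.symm)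
      rw [h1] at h2
      rw [show (L (1,t)).im - (c - 2 * Real.pi) = (L (1,t)).im - c + 2 * Real.pi by ring, Real.cos_add_two_pi]
      exact pos_of_mul_pos_right h2 (Real.exp_pos _).le
    · rw [hexp, Path.extend_one, Path.extend_one, toC_sph_sub,
        show (((c+d)/2 - 5*Real.pi/2 : ℝ):ℂ) * Complex.I
          = (((c+d)/2 - Real.pi/2 : ℝ):ℂ) * Complex.I - 2 * Real.pi * Complex.I by push_cast; ring,
        Complex.exp_periodic.sub_eq]
  linarith

def Lv (f : E2 → ℝ) (c : ℝ) : Set E2 := {x | ‖x‖ ≤ 1 ∧ c ≤ f x}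
def J (f : E2 → ℝ) (c : ℝ) (x y : E2) : Prop := ∃ S ⊆ Lv f c, IsPreconnected S ∧ x ∈ S ∧ y ∈ S
def Bp (f : E2 → ℝ) (x y : E2) : ℝ := sSup {c | J f c x y}
def bb (f : E2 → ℝ) (s t : ℝ) : ℝ := Bp f (sphPt s) (sphPt t)

lemma J.symm {f c x y} (h : J f c x y) : J f c y x := by
  obtain ⟨S, h1, h2, h3, h4⟩ := h; exact ⟨S, h1, h2, h4, h3⟩
lemma J.left {f c x y} (h : J f c x y) : x ∈ Lv f c := by
  obtain ⟨S, h1, h2, h3, h4⟩ := h; exact h1 h3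
lemma J.right {f c x y} (h : J f c x y) : y ∈ Lv f c := h.symm.left
lemma J.trans {f c x y z} (h : J f c x y) (h' : J f c y z) : J f c x z := by
  obtain ⟨S, h1, h2, h3, h4⟩ := h
  obtain ⟨S', h1', h2', h3', h4'⟩ := h'
  exact ⟨S ∪ S', Set.union_subset h1 h1', h2.union y h4 h3' h2', Or.inl h3, Or.inr h4'⟩
lemma J.mono {f c c' x y} (hc : c' ≤ c) (h : J f c x y) : J f c' x y := by
  obtain ⟨S, h1, h2, h3, h4⟩ := h
  exact ⟨S, fun w hw => ⟨(h1 hw).1, hc.trans (h1 hw).2⟩, h2, h3, h4⟩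
lemma J.trans' {f c c' x y z} (h : J f c x y) (h' : J f c' y z) : J f (min c c') x z :=
  (h.mono (min_le_left _ _)).trans (h'.mono (min_le_right _ _))
lemma J.refl {f c x} (h : x ∈ Lv f c) : J f c x x :=
  ⟨{x}, by simpa using h, isPreconnected_singleton, rfl, rfl⟩

lemma J.seg {f c x y} (h : ∀ w ∈ segment ℝ x y, w ∈ Lv f c) : J f c x y :=
  ⟨segment ℝ x y, h, (convex_segment x y).isPreconnected, left_mem_segment _ _ _, right_mem_segment _ _ _⟩

lemma J.arc {f c} {s t : ℝ} (hst : s ≤ t) (h : ∀ r ∈ Set.Icc s t, c ≤ f (sphPt r)) :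
    J f c (sphPt s) (sphPt t) := by
  refine ⟨sphPt '' Set.Icc s t, ?_, isPreconnected_Icc.image _ sphPt_continuous.continuousOn,
    ⟨s, Set.left_mem_Icc.2 hst, rfl⟩, ⟨t, Set.right_mem_Icc.2 hst, rfl⟩⟩
  rintro _ ⟨r, hr, rfl⟩
  exact ⟨(sphPt_norm r).le, h r hr⟩

lemma J_bdd (f : E2 → ℝ) (x y : E2) : BddAbove {c | J f c x y} := ⟨f x, fun _ hc => hc.left.2⟩

lemma J_ne {f : E2 → ℝ} (hf : Continuous f) {x y : E2} (hx : ‖x‖ ≤ 1) (hy : ‖y‖ ≤ 1) :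
    {c | J f c x y}.Nonempty := by
  obtain ⟨z, hz, hmin⟩ := (isCompact_closedBall (0:E2) 1).exists_isMinOn ⟨x, by simpa using hx⟩ hf.continuousOn
  refine ⟨f z, Metric.closedBall 0 1, ?_, (convex_closedBall 0 1).isPreconnected, by simpa using hx, by simpa using hy⟩
  intro w hw
  exact ⟨by simpa using hw, hmin hw⟩

lemma J.le_B {f c x y} (h : J f c x y) : c ≤ Bp f x y := le_csSup (J_bdd f x y) h

lemma B_le {f : E2 → ℝ} (hf : Continuous f) {x y : E2} (hx : ‖x‖ ≤ 1) (hy : ‖y‖ ≤ 1) {d : ℝ}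
    (h : ∀ c, J f c x y → c ≤ d) : Bp f x y ≤ d := csSup_le (J_ne hf hx hy) h

lemma lt_B {f : E2 → ℝ} (hf : Continuous f) {x y : E2} (hx : ‖x‖ ≤ 1) (hy : ‖y‖ ≤ 1) {c : ℝ}
    (h : c < Bp f x y) : ∃ c' > c, J f c' x y := by
  obtain ⟨c', h1, h2⟩ := exists_lt_of_lt_csSup (J_ne hf hx hy) h
  exact ⟨c', h2, h1⟩

lemma B_symm (f x y) : Bp f x y = Bp f y x := by
  unfold Bp; congr 1; ext c; exact ⟨J.symm, J.symm⟩

lemma B_le_left {f : E2 → ℝ} (hf : Continuous f) {x y : E2} (hx : ‖x‖ ≤ 1) (hy : ‖y‖ ≤ 1) :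
    Bp f x y ≤ f x := B_le hf hx hy fun c h => h.left.2

lemma B_self {f : E2 → ℝ} (hf : Continuous f) {x : E2} (hx : ‖x‖ ≤ 1) : Bp f x x = f x :=
  le_antisymm (B_le_left hf hx hx) (J.refl ⟨hx, le_rfl⟩).le_B

lemma B_ultra {f : E2 → ℝ} (hf : Continuous f) {x y z : E2} (hx : ‖x‖ ≤ 1) (hy : ‖y‖ ≤ 1) (hz : ‖z‖ ≤ 1) :
    min (Bp f x y) (Bp f y z) ≤ Bp f x z := by
  refine le_of_forall_lt fun c hc => ?_
  obtain ⟨c1, h1, h2⟩ := lt_B hf hx hy (lt_of_lt_of_le hc (min_le_left _ _))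
  obtain ⟨c2, h3, h4⟩ := lt_B hf hy hz (lt_of_lt_of_le hc (min_le_right _ _))
  exact lt_of_lt_of_le (lt_min h1 h3) (h2.trans' h4).le_B

lemma sep {f : E2 → ℝ} (hf : Continuous f) {K : Set E2} {c : ℝ} (hK : K ⊆ Lv f c) (hcl : IsClosed K)
    (hop : IsClosed (Lv f c \ K)) {x y : E2} (hx : x ∈ K) (hy : ‖y‖ ≤ 1) (hyK : y ∉ K) : Bp f x y < c := by
  have hD := isCompact_closedBall (0:E2) 1
  have hsub : ∀ {A : Set E2}, A ⊆ Lv f c → A ⊆ Metric.closedBall 0 1 := fun h w hw => by simpa using (h hw).1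
  have hKc : IsCompact K := hD.of_isClosed_subset hcl (hsub hK)
  have hKc' : IsCompact (Lv f c \ K) := hD.of_isClosed_subset hop (hsub Set.diff_subset)
  obtain ⟨U, V, hU, hV, hKU, hKV, hUV⟩ := SeparatedNhds.of_isCompact_isCompact hKc hKc' Set.disjoint_sdiff_right
  -- level
  have hlev : ∃ c' < c, ∀ w, ‖w‖ ≤ 1 → c' ≤ f w → w ∈ U ∪ V := by
    by_cases hE : (Metric.closedBall (0:E2) 1 \ (U ∪ V)).Nonempty
    · obtain ⟨z, hz, hmax⟩ := (hD.diff (hU.union hV)).exists_isMaxOn hE hf.continuousOn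
      have hfz : f z < c := by
        by_contra hcon
        push Not at hcon
        have hzL : z ∈ Lv f c := ⟨by simpa using hz.1, hcon⟩
        by_cases hzK : z ∈ K
        · exact hz.2 (Or.inl (hKU hzK))
        · exact hz.2 (Or.inr (hKV ⟨hzL, hzK⟩))
      refine ⟨(f z + c)/2, by linarith, fun w hw hfw => ?_⟩
      by_contra hcon
      have : f w ≤ f z := hmax ⟨by simpa using hw, hcon⟩
      linarith
    · refine ⟨c - 1, by linarith, fun w hw _ => ?_⟩
      by_contra hcon
      exact hE ⟨w, by simpa using hw, hcon⟩
  obtain ⟨c', hc', hc2⟩ := hlev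
  have hex : ∃ c'' < c, ¬ J f c'' x y := by
    by_cases hyc : c ≤ f y
    · refine ⟨c', hc', ?_⟩
      rintro ⟨S, hS, hSp, hxS, hyS⟩
      obtain ⟨w, hw, hw1, hw2⟩ := hSp U V hU hV (fun w hw => hc2 w (hS hw).1 (hS hw).2) ⟨x, hxS, hKU hx⟩
        ⟨y, hyS, hKV ⟨⟨hy, hyc⟩, hyK⟩⟩
      exact Set.disjoint_left.1 hUV hw1 hw2
    · push Not at hyc
      exact ⟨(f y + c)/2, by linarith, fun h => by linarith [h.right.2]⟩
  obtain ⟨c2, h2, h3⟩ := hex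
  refine lt_of_le_of_lt (B_le hf (hK hx).1 hy fun c3 h => ?_) h2
  by_contra hcon
  exact h3 (h.mono (not_le.1 hcon).le)

def prj (x : E2) : E2 := (max 1 ‖x‖)⁻¹ • x
lemma prj_cont : Continuous prj := by
  unfold prj
  refine Continuous.smul (Continuous.inv₀ (continuous_const.max continuous_norm) fun x => ?_) continuous_id
  have : (1:ℝ) ≤ max 1 ‖x‖ := le_max_left _ _
  linarith
lemma prj_norm (x : E2) : ‖prj x‖ ≤ 1 := by
  have h1 : (1:ℝ) ≤ max 1 ‖x‖ := le_max_left _ _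
  unfold prj
  rw [norm_smul, norm_inv, Real.norm_of_nonneg (by linarith), inv_mul_le_iff₀ (by linarith), mul_one]
  exact le_max_right _ _
lemma prj_id {x : E2} (h : ‖x‖ ≤ 1) : prj x = x := by
  unfold prj; rw [max_eq_left h]; simp

lemma J_path {f : E2 → ℝ} (hf : Continuous f) {x y : E2} {c c' : ℝ} (h : J f c x y) (hc : c' < c) :
    ∃ γ : Path x y, ∀ t, ‖γ t‖ ≤ 1 ∧ c' < f (γ t) := by
  obtain ⟨S, hS, hSp, hxS, hyS⟩ := h
  have hO : IsOpen {w | c' < f (prj w)} := isOpen_lt continuous_const (hf.comp prj_cont)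
  have hSO : S ⊆ {w | c' < f (prj w)} := fun w hw => by
    simp only [Set.mem_setOf_eq]; rw [prj_id (hS hw).1]; exact lt_of_lt_of_le hc (hS hw).2
  have hCo : IsOpen (connectedComponentIn {w | c' < f (prj w)} x) := hO.connectedComponentIn
  have hpc : IsPathConnected (connectedComponentIn {w | c' < f (prj w)} x) :=
    (hCo.isConnected_iff_isPathConnected).1 (isConnected_connectedComponentIn_iff.2 (hSO hxS))
  have hsub := hSp.subset_connectedComponentIn hxS hSO
  obtain ⟨γ, hγ⟩ := hpc.joinedIn x (hsub hxS) y (hsub hyS)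
  refine ⟨(γ.map prj_cont).cast (prj_id (hS hxS).1).symm (prj_id (hS hyS).1).symm, fun t => ?_⟩
  simp only [Path.cast_coe, Path.map_coe, Function.comp]
  have h3 : γ t ∈ {w | c' < f (prj w)} := connectedComponentIn_subset _ _ (hγ t)
  exact ⟨prj_norm _, h3⟩

lemma J_of_path {f : E2 → ℝ} {x y : E2} {c : ℝ} (γ : Path x y) (h : ∀ t, γ t ∈ Lv f c) (t) : J f c x (γ t) := by
  refine ⟨Set.range γ, ?_, isPreconnected_range γ.continuous, ⟨0, by simp⟩, ⟨t, rfl⟩⟩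
  rintro _ ⟨t, rfl⟩; exact h t

lemma bb_nc {f : E2 → ℝ} (hf : Continuous f) {x y z w : ℝ} (hxy : x < y) (hyz : y < z) (hzw : z < w)
    (hwx : w < x + τ) : min (bb f x z) (bb f y w) ≤ bb f x y := by
  have hn := fun t => (sphPt_norm t).le
  refine le_of_forall_lt fun c hc => ?_
  obtain ⟨c1, h1, h2⟩ := lt_B hf (hn _) (hn _) (lt_of_lt_of_le hc (min_le_left _ _))
  obtain ⟨c2, h3, h4⟩ := lt_B hf (hn _) (hn _) (lt_of_lt_of_le hc (min_le_right _ _))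
  obtain ⟨c3, h5, h6⟩ := exists_between (lt_min h1 h3)
  obtain ⟨γ, hγ⟩ := J_path hf h2 (lt_of_lt_of_le h6 (min_le_left _ _))
  obtain ⟨δ, hδ⟩ := J_path hf h4 (lt_of_lt_of_le h6 (min_le_right _ _))
  obtain ⟨s, t, hst⟩ := crossing hxy hyz hzw hwx γ δ (fun t => (hγ t).1) (fun t => (hδ t).1)
  have j1 := J_of_path (f := f) (c := c3) γ (fun t => ⟨(hγ t).1, (hγ t).2.le⟩) s
  have j2 := J_of_path (f := f) (c := c3) δ (fun t => ⟨(hδ t).1, (hδ t).2.le⟩) t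
  rw [hst] at j1
  exact lt_of_lt_of_le h5 (j1.trans j2.symm).le_B

/-- duality -/
lemma bb_dual {f : E2 → ℝ} (hf : Continuous f) {x y z w : ℝ} (hxy : x < y) (hyz : y < z) (hzw : z < w)
    (hwx : w < x + τ) : bb (fun p => - f p) y w ≤ - bb f x z := by
  have hn := fun t => (sphPt_norm t).le
  by_contra hcon
  push Not at hcon
  have hf' : Continuous (fun p => - f p) := hf.neg
  obtain ⟨c, h1, h2⟩ := exists_between hcon
  obtain ⟨c1, h3, h4⟩ := lt_B hf' (hn _) (hn _) h2
  obtain ⟨c2, h5, h6⟩ := lt_B hf (hn _) (hn _) (show -c < bb f x z by linarith)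
  obtain ⟨γ, hγ⟩ := J_path hf h6 h5
  obtain ⟨δ, hδ⟩ := J_path hf' h4 h3
  obtain ⟨s, t, hst⟩ := crossing hxy hyz hzw hwx γ δ (fun t => (hγ t).1) (fun t => (hδ t).1)
  have e1 := (hγ s).2
  have e2 := (hδ t).2
  rw [hst] at e1
  linarith

def Reg (f : E2 → ℝ) (c : ℝ) (z : E2) : Prop := ∃ O, IsOpen O ∧ z ∈ O ∧
  (∀ w ∈ O, ∀ w' ∈ O, ‖w‖ ≤ 1 → ‖w'‖ ≤ 1 → c < f w → c < f w' → ∃ c' > c, J f c' w w') ∧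
  (∀ w ∈ O, ‖w‖ ≤ 1 → f w = c → w ∈ closure {w' | ‖w'‖ ≤ 1 ∧ c < f w'})

def Iso (f : E2 → ℝ) (c : ℝ) (z : E2) : Prop := ∃ O, IsOpen O ∧ z ∈ O ∧ ∀ w ∈ O, ‖w‖ ≤ 1 → c ≤ f w → w = z

lemma reg_gt {f : E2 → ℝ} (hf : Continuous f) {z : E2} {c : ℝ} (h : c < f z) : Reg f c z := by
  obtain ⟨c1, h1, h2⟩ := exists_between h
  obtain ⟨ρ, hρ, hb⟩ := Metric.isOpen_iff.1 (isOpen_lt continuous_const hf : IsOpen {w | c1 < f w}) z h2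
  refine ⟨Metric.ball z ρ, Metric.isOpen_ball, Metric.mem_ball_self hρ, ?_, ?_⟩
  · intro w hw w' hw' hn hn' _ _
    refine ⟨c1, h1, J.seg fun u hu => ⟨?_, ?_⟩⟩
    · simpa using (convex_closedBall (0:E2) 1).segment_subset (by simpa using hn) (by simpa using hn') hu
    · exact (hb ((convex_ball z ρ).segment_subset hw hw' hu)).le
  · intro w hw _ he
    have : c1 < f w := hb hw
    linarith

lemma reg_push {f : E2 → ℝ} (hf : Sm f) {z v : E2} (hz : ‖z‖ ≤ 1) (hv : 0 < fderiv ℝ f z v)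
    (hin : ∃ ε : ℝ, 0 < ε ∧ ∀ᶠ w in nhds z, ‖w‖ ≤ 1 → ‖w + ε • v‖ ≤ 1) : Reg f (f z) z := by
  have hcf : Continuous f := hf.continuous
  have hG : Continuous (fun w => fderiv ℝ f w v) := (hf.continuous_fderiv (by simp)).clm_apply continuous_const
  obtain ⟨ε, hε, hin⟩ := hin
  obtain ⟨ρ, hρ, hb⟩ := Metric.eventually_nhds_iff_ball.1 (hin.and (hG.continuousAt.eventually (lt_mem_nhds hv)))
  obtain ⟨s, hs, hsε, hsρ⟩ : ∃ s : ℝ, 0 < s ∧ s ≤ ε ∧ s * ‖v‖ < ρ / 2 := by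
    refine ⟨min ε (ρ / (2 * (‖v‖ + 1)) / 2), by positivity, min_le_left _ _, ?_⟩
    have h1 : min ε (ρ / (2 * (‖v‖ + 1)) / 2) ≤ ρ / (2 * (‖v‖ + 1)) / 2 := min_le_right _ _
    have h2 : ρ / (2 * (‖v‖ + 1)) / 2 * (‖v‖ + 1) = ρ / 4 := by field_simp; norm_num
    have := norm_nonneg v
    have h3 : 0 < min ε (ρ / (2 * (‖v‖ + 1)) / 2) := by positivity
    nlinarith
  -- along the segments
  have hmem : ∀ w ∈ Metric.ball z (ρ/2), ∀ r ∈ Set.Icc 0 s, w + r • v ∈ Metric.ball z ρ := by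
    intro w hw r hr
    rw [Metric.mem_ball, dist_eq_norm] at hw ⊢
    have h1 : w + r • v - z = (w - z) + r • v := by abel
    rw [h1]
    refine lt_of_le_of_lt (norm_add_le _ _) ?_
    rw [norm_smul, Real.norm_of_nonneg hr.1]
    have := mul_le_mul_of_nonneg_right hr.2 (norm_nonneg v)
    linarith
  have hmono : ∀ w ∈ Metric.ball z (ρ/2), StrictMonoOn (fun r => f (w + r • v)) (Set.Icc 0 s) := by
    intro w hw
    refine strictMonoOn_of_deriv_pos (convex_Icc _ _) (by fun_prop) fun r hr => ?_
    rw [interior_Icc] at hr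
    have h1 : HasDerivAt (fun r : ℝ => w + r • v) v r := by
      simpa using ((hasDerivAt_id r).smul_const v).const_add w
    have h2 : HasDerivAt (fun r => f (w + r • v)) (fderiv ℝ f (w + r • v) v) r :=
      ((sm_diff hf) _).hasFDerivAt.comp_hasDerivAt r h1
    rw [h2.deriv]
    exact (hb _ (hmem w hw r ⟨hr.1.le, hr.2.le⟩)).2
  have hnorm : ∀ w ∈ Metric.ball z (ρ/2), ‖w‖ ≤ 1 → ∀ r ∈ Set.Icc 0 s, ‖w + r • v‖ ≤ 1 := by
    intro w hw hn r hr
    have h1 := (hb w (Metric.ball_subset_ball (by linarith) hw)).1 hn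
    have h2 := (convex_closedBall (0:E2) 1).segment_subset (x := w) (y := w + ε • v) (by simpa using hn) (by simpa using h1)
    have h3 : w + r • v ∈ segment ℝ w (w + ε • v) := by
      rw [segment_eq_image']
      refine ⟨r/ε, ⟨div_nonneg hr.1 hε.le, (div_le_one hε).2 (hr.2.trans hsε)⟩, ?_⟩
      simp only [add_sub_cancel_left, smul_smul]
      rw [div_mul_cancel₀ _ hε.ne']
    simpa using h2 h3
  have hz0 : z ∈ Metric.ball z (ρ/2) := Metric.mem_ball_self (by linarith)
  have hzs : f z < f (z + s • v) := by
    have := hmono z hz0 (Set.left_mem_Icc.2 hs.le) (Set.right_mem_Icc.2 hs.le) hs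
    simpa using this
  obtain ⟨c2, hc2, hc3⟩ := exists_between hzs
  have hcs : Continuous (fun w => f (w + s • v)) := by fun_prop
  obtain ⟨ρ', hρ', hb'⟩ := Metric.eventually_nhds_iff_ball.1 (hcs.continuousAt.eventually (lt_mem_nhds hc3))
  have hsub1 : Metric.ball z (min ρ' (ρ/2)) ⊆ Metric.ball z ρ' := Metric.ball_subset_ball (min_le_left _ _)
  have hsub2 : Metric.ball z (min ρ' (ρ/2)) ⊆ Metric.ball z (ρ/2) := Metric.ball_subset_ball (min_le_right _ _)
  refine ⟨Metric.ball z (min ρ' (ρ/2)), Metric.isOpen_ball, Metric.mem_ball_self (by positivity), ?_, ?_⟩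
  · have step : ∀ w ∈ Metric.ball z (min ρ' (ρ/2)), ‖w‖ ≤ 1 → J f (f w) w (w + s • v) := by
      intro w hw hn
      refine J.seg fun u hu => ?_
      rw [segment_eq_image'] at hu
      obtain ⟨θ, hθ, rfl⟩ := hu
      simp only [add_sub_cancel_left, smul_smul]
      have hr : θ * s ∈ Set.Icc 0 s := ⟨mul_nonneg hθ.1 hs.le, by nlinarith [hθ.2]⟩
      refine ⟨hnorm w (hsub2 hw) hn _ hr, ?_⟩
      have := (hmono w (hsub2 hw)).monotoneOn (Set.left_mem_Icc.2 hs.le) hr hr.1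
      simpa using this
    intro w hw w' hw' hn hn' hc hc'
    have j1 := step w hw hn
    have j2 := step w' hw' hn'
    have j3 : J f c2 (w + s • v) (w' + s • v) := by
      refine J.seg fun u hu => ?_
      have hu' : u - s • v ∈ segment ℝ w w' := by
        rw [segment_eq_image'] at hu ⊢
        obtain ⟨θ, hθ, rfl⟩ := hu
        exact ⟨θ, hθ, by simp only [add_sub_add_right_eq_sub]; abel⟩
      have h1 := (convex_ball z (min ρ' (ρ/2))).segment_subset hw hw' hu'
      have h2 := (convex_closedBall (0:E2) 1).segment_subset (by simpa using hn) (by simpa using hn') hu'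
      have h3 := hnorm _ (hsub2 h1) (by simpa using h2) s (Set.right_mem_Icc.2 hs.le)
      have h4 := hb' _ (hsub1 h1)
      rw [sub_add_cancel] at h3 h4
      exact ⟨h3, h4.le⟩
    exact ⟨_, lt_min (lt_min hc hc2) hc', (j1.trans' j3).trans' j2.symm⟩
  · intro w hw hn he
    have ht : Filter.Tendsto (fun r : ℝ => w + r • v) (nhdsWithin 0 (Set.Ioi 0)) (nhds w) := by
      have : Continuous (fun r : ℝ => w + r • v) := by fun_prop
      have h2 := this.tendsto 0
      simp only [zero_smul, add_zero] at h2
      exact h2.mono_left nhdsWithin_le_nhds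
    refine mem_closure_of_tendsto ht ?_
    filter_upwards [Ioc_mem_nhdsGT hs] with r hr
    refine ⟨hnorm w (hsub2 hw) hn r ⟨hr.1.le, hr.2⟩, ?_⟩
    have := hmono w (hsub2 hw) (Set.left_mem_Icc.2 hs.le) (show r ∈ Set.Icc 0 s from ⟨hr.1.le, hr.2⟩) hr.1
    simp only [zero_smul, add_zero] at this
    linarith

lemma inw_int {z : E2} (v : E2) (hz : ‖z‖ < 1) : ∃ ε : ℝ, 0 < ε ∧ ∀ᶠ w in nhds z, ‖w‖ ≤ 1 → ‖w + ε • v‖ ≤ 1 := by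
  have h1 : Continuous (fun r : ℝ => ‖z + r • v‖) := by fun_prop
  have h2 : ∀ᶠ r in nhds (0:ℝ), ‖z + r • v‖ < 1 :=
    h1.continuousAt.eventually (gt_mem_nhds (by simpa using hz))
  obtain ⟨ε, h3, hε⟩ := ((h2.filter_mono nhdsWithin_le_nhds).and (self_mem_nhdsWithin : Set.Ioi (0:ℝ) ∈ _)).exists
  refine ⟨ε, hε, ?_⟩
  have h4 : Continuous (fun w : E2 => ‖w + ε • v‖) := by fun_prop
  filter_upwards [h4.continuousAt.eventually (gt_mem_nhds h3)] with w hw _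
  exact hw.le

lemma inw_bd {z v : E2} (hz : ⟪z, v⟫ < 0) : ∃ ε : ℝ, 0 < ε ∧ ∀ᶠ w in nhds z, ‖w‖ ≤ 1 → ‖w + ε • v‖ ≤ 1 := by
  have hp : 0 < ‖v‖^2 + 1 := by positivity
  refine ⟨-⟪z, v⟫ / (‖v‖^2 + 1), div_pos (by linarith) hp, ?_⟩
  set ε := -⟪z, v⟫ / (‖v‖^2 + 1) with he
  have hε : 0 < ε := div_pos (by linarith) hp
  have h1 : ε * (‖v‖^2 + 1) = - ⟪z, v⟫ := by rw [he]; field_simp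
  have h4 : Continuous (fun w : E2 => ⟪w, v⟫) := by fun_prop
  filter_upwards [h4.continuousAt.eventually (gt_mem_nhds (show ⟪z,v⟫ < ⟪z,v⟫/2 by linarith))] with w hw hn
  have h5 : ‖w + ε • v‖^2 = ‖w‖^2 + 2 * (ε * ⟪w, v⟫) + ε^2 * ‖v‖^2 := by
    rw [norm_add_sq_real, inner_smul_right, norm_smul, Real.norm_of_nonneg hε.le]; ring
  have h6 := norm_nonneg w
  have h7 := norm_nonneg (w + ε • v)
  have h8 : 2 * (ε * ⟪w, v⟫) ≤ ε * ⟪z, v⟫ := by nlinarith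
  have h9 : ε * (ε * ‖v‖^2) ≤ ε * - ⟪z, v⟫ := mul_le_mul_of_nonneg_left (by linarith) hε.le
  nlinarith

lemma reg_int {f : E2 → ℝ} (hf : Sm f) {z : E2} (hz : ‖z‖ < 1) (h : fderiv ℝ f z ≠ 0) : Reg f (f z) z := by
  obtain ⟨v, hv⟩ : ∃ v, fderiv ℝ f z v ≠ 0 := by
    by_contra hcon; push Not at hcon; exact h (by ext v; simpa using hcon v)
  rcases lt_or_gt_of_ne hv with h1 | h1
  · exact reg_push hf hz.le (v := -v) (by simpa using h1) (inw_int _ hz)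
  · exact reg_push hf hz.le h1 (inw_int _ hz)

lemma reg_in {f : E2 → ℝ} (hf : Sm f) {t : ℝ} (h : pr f 1 t < 0) : Reg f (f (sphPt t)) (sphPt t) := by
  unfold pr at h
  rw [one_smul] at h
  refine reg_push hf (sphPt_norm t).le (v := - sphPt t) (by simpa using h) (inw_bd ?_)
  rw [inner_neg_right, real_inner_self_eq_norm_sq, sphPt_norm]; norm_num

lemma reg_tan {f : E2 → ℝ} (hf : Sm f) {t : ℝ} (h : pt f 1 t ≠ 0) : Reg f (f (sphPt t)) (sphPt t) := by
  set a := pt f 1 t with ha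
  set p := pr f 1 t with hp
  have h1 : 0 < |p| + 1 := by positivity
  have ha2 : 0 < a^2 := by positivity
  set δ := a^2 / (|p| + 1) with hδ
  have hδ0 : 0 < δ := by positivity
  have h2 : δ * (|p| + 1) = a^2 := by rw [hδ]; field_simp
  have h3 : δ * p ≤ δ * |p| := mul_le_mul_of_nonneg_left (le_abs_self p) hδ0.le
  refine reg_push hf (sphPt_norm t).le (v := a • sphPt (t + Real.pi/2) - δ • sphPt t) ?_ (inw_bd ?_)
  · have e1 : fderiv ℝ f (sphPt t) (sphPt (t + Real.pi/2)) = a := by rw [ha, pt]; simp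
    have e2 : fderiv ℝ f (sphPt t) (sphPt t) = p := by rw [hp, pr]; simp
    rw [map_sub, map_smul, map_smul, e1, e2]
    simp only [smul_eq_mul]
    nlinarith
  · rw [inner_sub_right, inner_smul_right, inner_smul_right, sphPt_inner, sphPt_inner]
    simp [show t - (t + Real.pi/2) = -(Real.pi/2) by ring]
    exact hδ0

lemma reg_min {f : E2 → ℝ} (hf : Continuous f) {z : E2} (hz : ‖z‖ < 1)
    (h : ∀ᶠ w in nhds z, w ≠ z → f z < f w) : Reg f (f z) z := by
  have hb1 : ∀ᶠ w in nhds z, ‖w‖ < 1 := continuous_norm.continuousAt.eventually (gt_mem_nhds hz)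
  obtain ⟨ρ, hρ, hb⟩ := Metric.eventually_nhds_iff_ball.1 (h.and hb1)
  have hrank : 1 < Module.rank ℝ E2 := by
    rw [← Module.finrank_eq_rank, finrank_euclideanSpace]; norm_num
  refine ⟨Metric.ball z ρ, Metric.isOpen_ball, Metric.mem_ball_self hρ, ?_, ?_⟩
  · intro w hw w' hw' _ _ hc hc'
    have hwz : w ≠ z := by rintro rfl; exact lt_irrefl _ hc
    have hwz' : w' ≠ z := by rintro rfl; exact lt_irrefl _ hc'
    rw [Metric.mem_ball, dist_eq_norm] at hw hw'
    set r1 := min ‖w - z‖ ‖w' - z‖ with hr1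
    set r2 := max ‖w - z‖ ‖w' - z‖ with hr2
    have h1 : 0 < r1 := lt_min (norm_pos_iff.2 (sub_ne_zero.2 hwz)) (norm_pos_iff.2 (sub_ne_zero.2 hwz'))
    have h12 : r1 ≤ r2 := (min_le_left _ _).trans (le_max_left _ _)
    have h2 : r2 < ρ := max_lt hw hw'
    set A : Set E2 := {x | r1 ≤ ‖x - z‖ ∧ ‖x - z‖ ≤ r2} with hA
    have hAc : IsCompact A := by
      refine (isCompact_closedBall z ρ).of_isClosed_subset ?_ ?_
      · have hcn : Continuous (fun x : E2 => ‖x - z‖) := by fun_prop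
        exact (isClosed_le continuous_const hcn).inter (isClosed_le hcn continuous_const)
      · intro x hx; rw [Metric.mem_closedBall, dist_eq_norm]; exact hx.2.trans h2.le
    have hwA : w ∈ A := ⟨min_le_left _ _, le_max_left _ _⟩
    have hwA' : w' ∈ A := ⟨min_le_right _ _, le_max_right _ _⟩
    have hAb : ∀ x ∈ A, f z < f x ∧ ‖x‖ < 1 := by
      intro x hx
      have := hb x (by rw [Metric.mem_ball, dist_eq_norm]; exact lt_of_le_of_lt hx.2 h2)
      refine ⟨this.1 ?_, this.2⟩
      rintro rfl
      have := hx.1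
      rw [sub_self, norm_zero] at this
      linarith
    obtain ⟨y, hyA, hy⟩ := hAc.exists_isMinOn ⟨w, hwA⟩ hf.continuousOn
    let R : E2 → E2 := fun x => z + (max r1 (min r2 ‖x - z‖) / ‖x - z‖) • (x - z)
    have hRc : ContinuousOn R {z}ᶜ := by
      have hcn : Continuous (fun x : E2 => ‖x - z‖) := by fun_prop
      have h3 : ContinuousOn (fun x : E2 => max r1 (min r2 ‖x - z‖) / ‖x - z‖) {z}ᶜ :=
        ContinuousOn.div (continuous_const.max (continuous_const.min hcn)).continuousOn hcn.continuousOn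
          fun x hx => (norm_pos_iff.2 (sub_ne_zero.2 hx)).ne'
      exact continuousOn_const.add (h3.smul (by fun_prop))
    have hRA : ∀ x ∈ ({z}ᶜ : Set E2), R x ∈ A := by
      intro x hx
      have hx0 : 0 < ‖x - z‖ := norm_pos_iff.2 (sub_ne_zero.2 hx)
      have hm : 0 ≤ max r1 (min r2 ‖x - z‖) := h1.le.trans (le_max_left _ _)
      have e : ‖R x - z‖ = max r1 (min r2 ‖x - z‖) := by
        simp only [R, add_sub_cancel_left]
        rw [norm_smul, Real.norm_of_nonneg (div_nonneg hm hx0.le), div_mul_cancel₀ _ hx0.ne']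
      rw [hA, Set.mem_setOf_eq, e]
      exact ⟨le_max_left _ _, max_le h12 (min_le_left _ _)⟩
    have hRid : ∀ x ∈ A, R x = x := by
      intro x hx
      have hx0 : 0 < ‖x - z‖ := lt_of_lt_of_le h1 hx.1
      simp only [R]
      rw [min_eq_right hx.2, max_eq_right hx.1, div_self hx0.ne', one_smul]; abel
    refine ⟨f y, (hAb y hyA).1, R '' {z}ᶜ, ?_,
      (isConnected_compl_singleton_of_one_lt_rank hrank z).isPreconnected.image R hRc,
      ⟨w, hwz, hRid w hwA⟩, ⟨w', hwz', hRid w' hwA'⟩⟩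
    rintro _ ⟨x, hx, rfl⟩
    exact ⟨(hAb _ (hRA x hx)).2.le, hy (hRA x hx)⟩
  · intro w hw _ he
    have hwz : w = z := by
      by_contra hcon
      linarith [(hb w hw).1 hcon]
    rw [hwz]
    have hcl : z ∈ closure ({z}ᶜ : Set E2) := by
      have : Nontrivial E2 := inferInstance
      rw [(dense_compl_singleton (x := z)).closure_eq]; trivial
    rw [mem_closure_iff] at hcl ⊢
    intro U hU hzU
    obtain ⟨y, ⟨hyU, hyb⟩, hyz⟩ := hcl (U ∩ Metric.ball z ρ) (hU.inter Metric.isOpen_ball) ⟨hzU, Metric.mem_ball_self hρ⟩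
    exact ⟨y, hyU, (hb y hyb).2.le, (hb y hyb).1 hyz⟩

lemma polar_nhd (t0 : ℝ) {ε : ℝ} (hε : 0 < ε) : ∃ O, IsOpen O ∧ sphPt t0 ∈ O ∧ ∀ w ∈ O, ‖w‖ ≤ 1 →
    ∃ r t : ℝ, w = r • sphPt t ∧ 1 - ε < r ∧ r ≤ 1 ∧ 0 ≤ r ∧ |t - t0| < ε := by
  set A : Set (ℝ × ℝ) := (Set.Icc 0 1 ×ˢ Set.Icc (t0 - Real.pi) (t0 + Real.pi)) ∩
    ({p | p.1 ≤ 1 - ε} ∪ {p | ε ≤ |p.2 - t0|}) with hA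
  have hAc : IsCompact A := by
    refine (isCompact_Icc.prod isCompact_Icc).inter_right (IsClosed.union ?_ ?_)
    · exact isClosed_le continuous_fst continuous_const
    · exact isClosed_le continuous_const (by fun_prop)
  have hcP : Continuous (fun p : ℝ × ℝ => p.1 • sphPt p.2) :=
    continuous_fst.smul (sphPt_continuous.comp continuous_snd)
  have hcl := (hAc.image hcP).isClosed
  refine ⟨_, hcl.isOpen_compl, ?_, ?_⟩
  · rintro ⟨⟨r, t⟩, ⟨⟨hr, ht⟩, h2⟩, he⟩
    simp only [Set.mem_Icc] at hr ht he
    have hr1 : r = 1 := by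
      have := congrArg norm he
      rwa [rsph_norm hr.1, sphPt_norm] at this
    rw [hr1, one_smul, sphPt_eq_iff] at he
    obtain ⟨k, hk⟩ := he
    have hτ : τ = 2 * Real.pi := rfl
    have hp := Real.pi_pos
    have hk0 : k = 0 := by
      have h3 : (k:ℝ) < 1 := by by_contra hc; push Not at hc; nlinarith
      have h4 : (-1:ℝ) < k := by by_contra hc; push Not at hc; nlinarith
      have h5 : k < 1 := by exact_mod_cast h3
      have h6 : -1 < k := by exact_mod_cast h4
      omega
    rw [hk0] at hk
    rcases h2 with h2 | h2
    · simp only [Set.mem_setOf_eq] at h2; linarith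
    · simp only [Set.mem_setOf_eq] at h2; rw [hk] at h2; simp at h2; linarith
  · intro w hw hn
    obtain ⟨t, -, hwt⟩ := exists_polar w
    obtain ⟨k, hk⟩ := exists_shift (t0 - Real.pi) t
    have hτ : τ = 2 * Real.pi := rfl
    have hwt' : w = ‖w‖ • sphPt (t + k * τ) := by
      rw [sphPt_eq_iff.2 ⟨k, rfl⟩]; exact hwt
    have hnot : (‖w‖, t + k * τ) ∉ A := fun h => hw ⟨_, h, hwt'.symm⟩
    have hin : (‖w‖, t + k * τ) ∈ (Set.Icc (0:ℝ) 1 ×ˢ Set.Icc (t0 - Real.pi) (t0 + Real.pi)) :=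
      ⟨⟨norm_nonneg _, hn⟩, ⟨hk.1, by linarith [hk.2]⟩⟩
    have h3 : ¬ (‖w‖ ≤ 1 - ε) := fun h => hnot ⟨hin, Or.inl h⟩
    have h4 : ¬ (ε ≤ |t + k * τ - t0|) := fun h => hnot ⟨hin, Or.inr h⟩
    exact ⟨‖w‖, t + k * τ, hwt', not_le.1 h3, hn, norm_nonneg _, not_le.1 h4⟩

lemma polar_pos {f : E2 → ℝ} (hf : Sm f) {t0 : ℝ} (h : 0 < pr f 1 t0) {ε : ℝ} (hε : 0 < ε) :
    ∃ O, IsOpen O ∧ sphPt t0 ∈ O ∧ ∀ w ∈ O, ‖w‖ ≤ 1 →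
    ∃ r t : ℝ, w = r • sphPt t ∧ r ≤ 1 ∧ 0 ≤ r ∧ |t - t0| < ε ∧
      StrictMonoOn (fun r : ℝ => f (r • sphPt t)) (Set.Icc r 1) := by
  have h1 := (pr_cont hf).continuousAt (x := ((1:ℝ), t0)) |>.eventually (lt_mem_nhds h)
  obtain ⟨δ, hδ, hb⟩ := Metric.eventually_nhds_iff.1 h1
  obtain ⟨O, hO, hzO, H⟩ := polar_nhd t0 (lt_min hε hδ)
  refine ⟨O, hO, hzO, fun w hw hn => ?_⟩
  obtain ⟨r, t, e, h2, h3, h4, h5⟩ := H w hw hn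
  refine ⟨r, t, e, h3, h4, lt_of_lt_of_le h5 (min_le_left _ _), ?_⟩
  have hcf := hf.continuous
  refine strictMonoOn_of_deriv_pos (convex_Icc _ _) (by fun_prop) fun r' hr => ?_
  rw [interior_Icc] at hr
  rw [(hasDerivAt_radial ((sm_diff hf) _)).deriv]
  refine hb (y := (r', t)) ?_
  rw [Prod.dist_eq]
  have h6 := min_le_right ε δ
  refine max_lt ?_ ?_
  · rw [Real.dist_eq, abs_lt]; simp only; constructor <;> linarith [hr.1, hr.2]
  · rw [Real.dist_eq]; simp only; linarith

lemma mx_strict {φ : ℝ → ℝ} (hs : Sm φ) {t : ℝ} (h : IsMx φ t) :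
    ∃ ε > 0, ∀ s, |s - t| < ε → s ≠ t → φ s < φ t := by
  obtain ⟨ε, hε, h1, h2⟩ := mx_sign h
  have hc := (sm_diff hs).continuous
  refine ⟨ε, hε, fun s hst hne => ?_⟩
  rw [abs_lt] at hst
  rcases lt_or_gt_of_ne hne with h3 | h3
  · refine strictMonoOn_of_deriv_pos (convex_Icc s t) hc.continuousOn (fun r hr => ?_)
      (Set.left_mem_Icc.2 h3.le) (Set.right_mem_Icc.2 h3.le) h3
    rw [interior_Icc] at hr
    exact h2 r ⟨by linarith [hr.1], hr.2⟩
  · refine strictAntiOn_of_deriv_neg (convex_Icc t s) hc.continuousOn (fun r hr => ?_)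
      (Set.left_mem_Icc.2 h3.le) (Set.right_mem_Icc.2 h3.le) h3
    rw [interior_Icc] at hr
    exact h1 r ⟨hr.1, by linarith [hr.2]⟩

lemma iso_mx {f : E2 → ℝ} (hf : Sm f) {φ : ℝ → ℝ} (hs : Sm φ) (hφ : ∀ t, f (sphPt t) = φ t) {t0 : ℝ} (hm : IsMx φ t0)
    (h : 0 < pr f 1 t0) : Iso f (φ t0) (sphPt t0) := by
  obtain ⟨ε, hε, h1⟩ := mx_strict hs hm
  obtain ⟨O, hO, hz, H⟩ := polar_pos hf h hε
  refine ⟨O, hO, hz, fun w hw hn hc => ?_⟩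
  obtain ⟨r, t, e, h3, h4, h5, h6⟩ := H w hw hn
  have h7 : f (r • sphPt t) ≤ φ t := by
    have := h6.monotoneOn (Set.left_mem_Icc.2 h3) (Set.right_mem_Icc.2 h3) h3
    simpa [hφ] using this
  rw [e] at hc
  have ht : t = t0 := by
    by_contra hne
    linarith [h1 t h5 hne]
  subst ht
  rcases lt_or_eq_of_le h3 with h8 | h8
  · have := h6 (Set.left_mem_Icc.2 h3) (Set.right_mem_Icc.2 h3) h8
    simp only [one_smul, hφ] at this
    linarith
  · rw [e, h8, one_smul]

lemma side {f : E2 → ℝ} (hf : Sm f) {φ : ℝ → ℝ} (hs : Sm φ) (hφ : ∀ t, f (sphPt t) = φ t) {M L M' : ℝ}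
    (hT : Tri φ M L M') (h : 0 < pr f 1 L) : ∃ O, IsOpen O ∧ sphPt L ∈ O ∧
    (∀ w ∈ O, ‖w‖ ≤ 1 → φ L < f w → ∃ c' > φ L, J f c' w (sphPt M) ∨ J f c' w (sphPt M')) ∧
    (∀ w ∈ O, ‖w‖ ≤ 1 → f w = φ L → w ∈ closure {w' | ‖w'‖ ≤ 1 ∧ φ L < f w'}) := by
  have hcφ := (sm_diff hs).continuous
  have hcf : Continuous f := hf.continuous
  have a1 : StrictAntiOn φ (Set.Icc M L) :=
    strictAntiOn_of_deriv_neg (convex_Icc M L) hcφ.continuousOn (by rw [interior_Icc]; exact hT.d1)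
  have a2 : StrictMonoOn φ (Set.Icc L M') :=
    strictMonoOn_of_deriv_pos (convex_Icc L M') hcφ.continuousOn (by rw [interior_Icc]; exact hT.d2)
  have hl1 := hT.lt1
  have hl2 := hT.lt2
  obtain ⟨O, hO, hz, H⟩ := polar_pos hf h (ε := min (L - M) (M' - L)) (lt_min (by linarith) (by linarith))
  have htt : ∀ t, |t - L| < min (L - M) (M' - L) → M < t ∧ t < M' := by
    intro t ht
    rw [abs_lt] at ht
    have := min_le_left (L - M) (M' - L)
    have := min_le_right (L - M) (M' - L)
    constructor <;> linarith
  refine ⟨O, hO, hz, ?_, ?_⟩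
  · intro w hw hn hc
    obtain ⟨r, t, e, h3, h4, h5, h6⟩ := H w hw hn
    obtain ⟨t1, t2⟩ := htt t h5
    have h7 : f (r • sphPt t) ≤ φ t := by
      have := h6.monotoneOn (Set.left_mem_Icc.2 h3) (Set.right_mem_Icc.2 h3) h3
      simpa [hφ] using this
    rw [← e] at h7
    have j1 : J f (f w) w (sphPt t) := by
      refine ⟨(fun r : ℝ => r • sphPt t) '' Set.Icc r 1, ?_, isPreconnected_Icc.image _ (by fun_prop),
        ⟨r, Set.left_mem_Icc.2 h3, e.symm⟩, ⟨1, Set.right_mem_Icc.2 h3, one_smul _ _⟩⟩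
      rintro _ ⟨r', hr, rfl⟩
      refine ⟨by beta_reduce; rw [rsph_norm (h4.trans hr.1)]; exact hr.2, ?_⟩
      rw [e]
      exact h6.monotoneOn (Set.left_mem_Icc.2 h3) hr hr.1
    refine ⟨f w, hc, ?_⟩
    rcases lt_trichotomy t L with h8 | h8 | h8
    · left
      refine j1.trans (J.symm (J.arc t1.le fun u hu => ?_))
      rw [hφ]
      exact h7.trans (a1.antitoneOn ⟨hu.1, hu.2.trans h8.le⟩ ⟨t1.le, h8.le⟩ hu.2)
    · rw [h8] at h7; linarith
    · right
      refine j1.trans (J.arc t2.le fun u hu => ?_)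
      rw [hφ]
      exact h7.trans (a2.monotoneOn ⟨h8.le, t2.le⟩ ⟨h8.le.trans hu.1, hu.2⟩ hu.1)
  · intro w hw hn hc
    obtain ⟨r, t, e, h3, h4, h5, h6⟩ := H w hw hn
    obtain ⟨t1, t2⟩ := htt t h5
    rcases lt_or_eq_of_le h3 with h8 | h8
    · have ht : Filter.Tendsto (fun r : ℝ => r • sphPt t) (nhdsWithin r (Set.Ioi r)) (nhds w) := by
        have : Continuous (fun r : ℝ => r • sphPt t) := by fun_prop
        have h2 := this.tendsto r
        simp only [← e] at h2
        exact h2.mono_left nhdsWithin_le_nhds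
      refine mem_closure_of_tendsto ht ?_
      filter_upwards [Ioc_mem_nhdsGT h8] with r' hr
      refine ⟨by rw [rsph_norm (h4.trans hr.1.le)]; exact hr.2, ?_⟩
      have := h6 (Set.left_mem_Icc.2 h3) ⟨hr.1.le, hr.2⟩ hr.1
      simp only [← e, hc] at this
      exact this
    · rw [h8, one_smul] at e
      rw [e, hφ] at hc
      have htL : t = L := by
        rcases lt_trichotomy t L with h9 | h9 | h9
        · have := a1 ⟨t1.le, h9.le⟩ (Set.right_mem_Icc.2 hl1.le) h9; linarith
        · exact h9
        · have := a2 (Set.left_mem_Icc.2 hl2.le) ⟨h9.le, t2.le⟩ h9; linarith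
      rw [e, htL]
      have ht : Filter.Tendsto sphPt (nhdsWithin L (Set.Ioi L)) (nhds (sphPt L)) :=
        (sphPt_continuous.tendsto L).mono_left nhdsWithin_le_nhds
      refine mem_closure_of_tendsto ht ?_
      filter_upwards [Ioc_mem_nhdsGT hl2] with s hs
      refine ⟨(sphPt_norm s).le, ?_⟩
      rw [hφ]
      exact a2 (Set.left_mem_Icc.2 hl2.le) ⟨hs.1.le, hs.2⟩ hs.1

structure Su (φ : ℝ → ℝ) (ν : E2 → ℤ) (f : E2 → ℝ) : Prop where
  mf : MF φ
  νs : ∀ p, ν p = 1 ∨ ν p = -1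
  ext : ExtR φ (fun t => ν (sphPt t)) f

lemma Su.cf {φ ν f} (h : Su φ ν f) : Continuous f := h.ext.1.continuous
lemma Su.bd {φ ν f} (h : Su φ ν f) (t : ℝ) : f (sphPt t) = φ t := h.ext.2.1 t

lemma Su.mx_pos {φ ν f} (h : Su φ ν f) {t : ℝ} (ht : IsMx φ t) (hν : ν (sphPt t) = 1) : 0 < pr f 1 t := by
  have := h.ext.2.2 t ht.1
  beta_reduce at this; rw [hν] at this
  have h2 := ht.2
  by_contra hc; push Not at hc; push_cast at this; nlinarith
lemma Su.mx_neg {φ ν f} (h : Su φ ν f) {t : ℝ} (ht : IsMx φ t) (hν : ν (sphPt t) = -1) : pr f 1 t < 0 := by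
  have := h.ext.2.2 t ht.1
  beta_reduce at this; rw [hν] at this
  have h2 := ht.2
  by_contra hc; push Not at hc; push_cast at this; nlinarith
lemma Su.mn_pos {φ ν f} (h : Su φ ν f) {t : ℝ} (ht : IsMn φ t) (hν : ν (sphPt t) = 1) : pr f 1 t < 0 := by
  have := h.ext.2.2 t ht.1
  beta_reduce at this; rw [hν] at this
  have h2 := ht.2
  by_contra hc; push Not at hc; push_cast at this; nlinarith
lemma Su.mn_neg {φ ν f} (h : Su φ ν f) {t : ℝ} (ht : IsMn φ t) (hν : ν (sphPt t) = -1) : 0 < pr f 1 t := by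
  have := h.ext.2.2 t ht.1
  beta_reduce at this; rw [hν] at this
  have h2 := ht.2
  by_contra hc; push Not at hc; push_cast at this; nlinarith

lemma Tri.anti {φ : ℝ → ℝ} (hs : Sm φ) {M L M' : ℝ} (hT : Tri φ M L M') : StrictAntiOn φ (Set.Icc M L) :=
  strictAntiOn_of_deriv_neg (convex_Icc M L) (sm_diff hs).continuous.continuousOn (by rw [interior_Icc]; exact hT.d1)
lemma Tri.mono' {φ : ℝ → ℝ} (hs : Sm φ) {M L M' : ℝ} (hT : Tri φ M L M') : StrictMonoOn φ (Set.Icc L M') :=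
  strictMonoOn_of_deriv_pos (convex_Icc L M') (sm_diff hs).continuous.continuousOn (by rw [interior_Icc]; exact hT.d2)

lemma Lv_closed {f : E2 → ℝ} (hf : Continuous f) (c : ℝ) : IsClosed (Lv f c) :=
  (isClosed_le continuous_norm continuous_const).inter (isClosed_le continuous_const hf)

lemma Su.nx {φ ν f} (h : Su φ ν f) {V Q : ℝ} (hV : IsMx φ V) (hne : sphPt V ≠ sphPt Q)
    (hb : bb f V Q = φ V) : ν (sphPt V) = -1 := by
  refine (h.νs _).resolve_left fun h1 => ?_
  obtain ⟨O, hO, hz, H⟩ := iso_mx h.ext.1 h.mf.sm h.bd hV (h.mx_pos hV h1)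
  have hVL : sphPt V ∈ Lv f (φ V) := ⟨(sphPt_norm V).le, (h.bd V).ge⟩
  have he : Lv f (φ V) \ {sphPt V} = Lv f (φ V) ∩ Oᶜ := by
    ext w
    constructor
    · rintro ⟨hw, hwV⟩; exact ⟨hw, fun hwO => hwV (H w hwO hw.1 hw.2)⟩
    · rintro ⟨hw, hwO⟩; exact ⟨hw, fun hwV => hwO (by rw [hwV]; exact hz)⟩
  have := sep h.cf (K := {sphPt V}) (c := φ V) (by simpa using hVL) isClosed_singleton
    (by rw [he]; exact (Lv_closed h.cf _).inter hO.isClosed_compl) rfl (sphPt_norm Q).le (fun hQ => hne hQ.symm)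
  change bb f V Q < φ V at this
  linarith

lemma Su.reg_join {φ ν f} (h : Su φ ν f) {M L M' : ℝ} (hT : Tri φ M L M') (hr : Reg f (φ L) (sphPt L)) :
    φ L < bb f M M' := by
  obtain ⟨O, hO, hz, H, -⟩ := hr
  have h1 : ∀ᶠ t in nhds L, sphPt t ∈ O := sphPt_continuous.continuousAt.eventually (hO.mem_nhds hz)
  have a1 := hT.anti h.mf.sm
  have a2 := hT.mono' h.mf.sm
  obtain ⟨t1, ht1, ht1'⟩ := ((h1.filter_mono nhdsWithin_le_nhds).and (Ico_mem_nhdsLT hT.lt1)).exists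
  obtain ⟨t2, ht2, ht2'⟩ := ((h1.filter_mono nhdsWithin_le_nhds).and (Ioc_mem_nhdsGT hT.lt2)).exists
  have f1 : φ L < φ t1 := a1 ⟨ht1'.1, ht1'.2.le⟩ (Set.right_mem_Icc.2 hT.lt1.le) ht1'.2
  have f2 : φ L < φ t2 := a2 (Set.left_mem_Icc.2 hT.lt2.le) ⟨ht2'.1.le, ht2'.2⟩ ht2'.1
  obtain ⟨c', hc', j⟩ := H _ ht1 _ ht2 (sphPt_norm _).le (sphPt_norm _).le (by rw [h.bd]; exact f1) (by rw [h.bd]; exact f2)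
  have j1 : J f (φ t1) (sphPt M) (sphPt t1) := J.arc ht1'.1 fun u hu => by
    rw [h.bd]; exact a1.antitoneOn ⟨hu.1, hu.2.trans ht1'.2.le⟩ ⟨ht1'.1, ht1'.2.le⟩ hu.2
  have j2 : J f (φ t2) (sphPt t2) (sphPt M') := J.arc ht2'.2 fun u hu => by
    rw [h.bd]; exact a2.monotoneOn ⟨ht2'.1.le, ht2'.2⟩ ⟨ht2'.1.le.trans hu.1, hu.2⟩ hu.1
  exact lt_of_lt_of_le (lt_min (lt_min f1 hc') f2) ((j1.trans' j).trans' j2).le_B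

lemma Su.nn {φ ν f} (h : Su φ ν f) {M L M' : ℝ} (hT : Tri φ M L M')
    (hb : bb f M M' = φ L) : ν (sphPt L) = -1 := by
  refine (h.νs _).resolve_left fun h1 => ?_
  have hr := reg_in h.ext.1 (h.mn_pos hT.mn h1)
  rw [h.bd] at hr
  linarith [h.reg_join hT hr]

lemma Su.adj {φ ν f} (h : Su φ ν f) {M L M' : ℝ} (hT : Tri φ M L M') : φ L ≤ bb f M M' := by
  have a1 := hT.anti h.mf.sm
  have a2 := hT.mono' h.mf.sm
  refine (J.arc (hT.lt1.trans hT.lt2).le fun u hu => ?_).le_B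
  rw [h.bd]
  rcases le_total u L with h1 | h1
  · exact a1.antitoneOn ⟨hu.1, h1⟩ (Set.right_mem_Icc.2 hT.lt1.le) h1
  · exact a2.monotoneOn (Set.left_mem_Icc.2 hT.lt2.le) ⟨h1, hu.2⟩ h1

def P0 (φ : ℝ → ℝ) (b : ℝ → ℝ → ℝ) : Prop := ∀ x y, IsMx φ x → IsMx φ y → sphPt x ≠ sphPt y →
  b x y = φ x ∨ b x y = φ y ∨ Wit φ b x y ∨ Wit φ b y x

lemma Su.b_le {φ ν f} (h : Su φ ν f) (x y : ℝ) : bb f x y ≤ φ x := by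
  rw [← h.bd]; exact B_le_left h.cf (sphPt_norm x).le (sphPt_norm y).le
lemma bb_symm (f x y) : bb f x y = bb f y x := B_symm _ _ _
lemma Su.ultra {φ ν f} (h : Su φ ν f) (x y z : ℝ) : min (bb f x y) (bb f y z) ≤ bb f x z :=
  B_ultra h.cf (sphPt_norm _).le (sphPt_norm _).le (sphPt_norm _).le

lemma Su.good {φ ν f} (h : Su φ ν f) (hp : P0 φ (bb f)) : Good φ ν (bb f) where
  mf := h.mf
  νs := h.νs
  symm := bb_symm f
  per := fun x x' y hx => by unfold bb; rw [hx]
  self := fun x _ => by rw [← h.bd]; exact B_self h.cf (sphPt_norm x).le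
  le := fun x y _ _ => h.b_le x y
  ultra := h.ultra
  adj := fun M L M' hT => h.adj hT
  nc := fun x y z w h1 h2 h3 h4 => bb_nc h.cf h1 h2 h3 h4
  p0 := hp
  nx := fun V Q hV _ hne hb => h.nx hV hne hb
  nn := fun M L M' hT hb => h.nn hT hb

lemma Su.half {φ ν f} (h : Su φ ν f)
    (hE : ∀ z, ‖z‖ < 1 → fderiv ℝ f z = 0 → (∀ᶠ w in nhds z, w ≠ z → f z < f w) ∨ (∀ᶠ w in nhds z, w ≠ z → f w < f z))
    {x y : ℝ} (hx : bb f x y < φ x) (hy : bb f x y < φ y) :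
    ∃ M L M', Tri φ M L M' ∧ φ L = bb f x y ∧ bb f M M' = φ L ∧ (φ L < bb f x M ∨ φ L < bb f x M') := by
  by_contra hno
  set c := bb f x y with hc
  set A : Set E2 := {w | ∃ c' > c, J f c' (sphPt x) w} with hA
  have hAc : ∀ w ∈ A, ‖w‖ ≤ 1 ∧ c < f w := by
    rintro w ⟨c', h1, h2⟩; exact ⟨h2.right.1, lt_of_lt_of_le h1 h2.right.2⟩
  have hApp : ∀ w ∈ A, ∀ w', (∃ c' > c, J f c' w w') → w' ∈ A := by
    rintro w ⟨c', h1, h2⟩ w' ⟨c'', h3, h4⟩; exact ⟨min c' c'', lt_min h1 h3, h2.trans' h4⟩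
  have hAL : A ⊆ Lv f c := fun w hw => ⟨(hAc w hw).1, (hAc w hw).2.le⟩
  have hKL : closure A ⊆ Lv f c := closure_minimal hAL (Lv_closed h.cf c)
  have hlocal : ∀ z O, IsOpen O → z ∈ O →
      (∀ w ∈ O, ∀ w' ∈ O, ‖w‖ ≤ 1 → ‖w'‖ ≤ 1 → c < f w → c < f w' → w ∈ A → w' ∈ A) →
      (∀ w ∈ O, ‖w‖ ≤ 1 → f w = c → w ∈ closure {w' | ‖w'‖ ≤ 1 ∧ c < f w'}) →
      ∃ O, IsOpen O ∧ z ∈ O ∧ ((∀ w ∈ O, w ∉ A) ∨ ∀ w ∈ O, w ∈ Lv f c → w ∈ closure A) := by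
    intro z O hO hz h1 h2
    refine ⟨O, hO, hz, ?_⟩
    by_cases hex : ∃ w ∈ O, w ∈ A
    · right
      obtain ⟨w, hw, hwA⟩ := hex
      intro w' hw' hL
      rcases hL.2.lt_or_eq with h3 | h3
      · exact subset_closure (h1 w hw w' hw' (hAc w hwA).1 hL.1 (hAc w hwA).2 h3 hwA)
      · have := hO.inter_closure ⟨hw', h2 w' hw' hL.1 h3.symm⟩
        refine closure_mono ?_ this
        rintro u ⟨hu, hu1, hu2⟩
        exact h1 w hw u hu (hAc w hwA).1 hu1 (hAc w hwA).2 hu2 hwA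
    · left
      intro w hw hwA; exact hex ⟨w, hw, hwA⟩
  have hreg : ∀ z, Reg f c z → ∃ O, IsOpen O ∧ z ∈ O ∧ ((∀ w ∈ O, w ∉ A) ∨ ∀ w ∈ O, w ∈ Lv f c → w ∈ closure A) := by
    rintro z ⟨O, hO, hz, h1, h2⟩
    exact hlocal z O hO hz (fun w hw w' hw' a1 a2 a3 a4 a5 => hApp w a5 w' (h1 w hw w' hw' a1 a2 a3 a4)) h2
  have hiso : ∀ z, f z = c → Iso f c z → ∃ O, IsOpen O ∧ z ∈ O ∧ ((∀ w ∈ O, w ∉ A) ∨ ∀ w ∈ O, w ∈ Lv f c → w ∈ closure A) := by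
    rintro z hzc ⟨O, hO, hz, h1⟩
    refine ⟨O, hO, hz, Or.inl fun w hw hwA => ?_⟩
    have := h1 w hw (hAc w hwA).1 (hAc w hwA).2.le
    have h3 := (hAc w hwA).2
    rw [this, hzc] at h3
    exact lt_irrefl _ h3
  have key : ∀ z ∈ Lv f c, ∃ O, IsOpen O ∧ z ∈ O ∧ ((∀ w ∈ O, w ∉ A) ∨ ∀ w ∈ O, w ∈ Lv f c → w ∈ closure A) := by
    intro z hz
    rcases hz.2.lt_or_eq with h1 | h1
    · exact hreg z (reg_gt h.cf h1)
    rcases hz.1.lt_or_eq with h2 | h2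
    · by_cases h3 : fderiv ℝ f z = 0
      · rcases hE z h2 h3 with h4 | h4
        · refine hreg z ?_
          rw [h1]; exact reg_min h.cf h2 h4
        · refine hiso z h1.symm ?_
          obtain ⟨O, hO1, hO2, hO3⟩ := mem_nhds_iff.1 h4
          refine ⟨O, hO2, hO3, fun w hw _ hcw => ?_⟩
          by_contra hne
          have : f w < f z := hO1 hw hne
          linarith
      · refine hreg z ?_
        rw [h1]; exact reg_int h.ext.1 h2 h3
    · obtain ⟨t, -, rfl⟩ := exists_sphPt h2
      by_cases h3 : deriv φ t = 0
      · have hbt := h.bd t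
        rcases h.mf.mx_or_mn h3 with hm | hm
        · rcases h.νs (sphPt t) with hν | hν
          · refine hiso _ h1.symm ?_
            rw [h1, hbt]
            exact iso_mx h.ext.1 h.mf.sm h.bd hm (h.mx_pos hm hν)
          · refine hreg _ ?_
            rw [h1]; exact reg_in h.ext.1 (h.mx_neg hm hν)
        · rcases h.νs (sphPt t) with hν | hν
          · refine hreg _ ?_
            rw [h1]; exact reg_in h.ext.1 (h.mn_pos hm hν)
          · obtain ⟨M, M', hT⟩ := h.mf.tri_mn hm
            have hct : φ t = c := by rw [← hbt, h1]
            obtain ⟨O, hO, hz, H1, H2⟩ := side h.ext.1 h.mf.sm h.bd hT (h.mn_neg hm hν)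
            rw [hct] at H1 H2
            have hb0 := h.adj hT
            refine hlocal _ O hO hz ?_ H2
            intro w hw w' hw' a1 a2 a3 a4 a5
            obtain ⟨c1, hc1, j1⟩ := H1 w hw a1 a3
            obtain ⟨c2, hc2, j2⟩ := H1 w' hw' a2 a4
            have hMM : ∃ c' > c, J f c' (sphPt M) (sphPt M') := by
              rcases hb0.lt_or_eq with hb | hb
              · rw [hct] at hb
                exact lt_B h.cf (sphPt_norm _).le (sphPt_norm _).le hb
              · exfalso
                refine hno ⟨M, t, M', hT, hct, hb.symm, ?_⟩
                rw [hct]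
                rcases j1 with j1 | j1
                · obtain ⟨c3, h3, j3⟩ := hApp w a5 _ ⟨c1, hc1, j1⟩
                  exact Or.inl (lt_of_lt_of_le h3 j3.le_B)
                · obtain ⟨c3, h3, j3⟩ := hApp w a5 _ ⟨c1, hc1, j1⟩
                  exact Or.inr (lt_of_lt_of_le h3 j3.le_B)
            obtain ⟨c3, h3, j3⟩ := hMM
            have hM : sphPt M ∈ A := by
              rcases j1 with j1 | j1
              · exact hApp w a5 _ ⟨c1, hc1, j1⟩
              · exact hApp _ (hApp w a5 _ ⟨c1, hc1, j1⟩) _ ⟨c3, h3, j3.symm⟩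
            rcases j2 with j2 | j2
            · exact hApp _ hM _ ⟨c2, hc2, j2.symm⟩
            · exact hApp _ (hApp _ hM _ ⟨c3, h3, j3⟩) _ ⟨c2, hc2, j2.symm⟩
      · refine hreg _ ?_
        rw [h1]
        refine reg_tan h.ext.1 ?_
        rw [pt_one h.ext.1 h.bd]; exact h3
  have hyK : sphPt y ∉ closure A := by
    intro hyK
    obtain ⟨O, hO, hz, H1, -⟩ := reg_gt (z := sphPt y) (c := c) h.cf (by rw [h.bd]; exact hy)
    obtain ⟨w, hw, hwA⟩ := mem_closure_iff.1 hyK O hO hz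
    obtain ⟨c', hc', j⟩ := hApp w hwA _ (H1 w hw _ hz (hAc w hwA).1 (sphPt_norm y).le (hAc w hwA).2 (by rw [h.bd]; exact hy))
    have := lt_of_lt_of_le hc' j.le_B
    exact lt_irrefl _ this
  have hcl : IsClosed (Lv f c \ closure A) := by
    refine isClosed_of_closure_subset fun z hz => ?_
    have hzL : z ∈ Lv f c := (Lv_closed h.cf c).closure_subset_iff.2 Set.diff_subset hz
    refine ⟨hzL, fun hzK => ?_⟩
    obtain ⟨O, hO, hzO, H | H⟩ := key z hzL
    · obtain ⟨w, hw, hwA⟩ := mem_closure_iff.1 hzK O hO hzO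
      exact H w hw hwA
    · obtain ⟨w, hw, hwA⟩ := mem_closure_iff.1 hz O hO hzO
      exact hwA.2 (H w hw hwA.1)
  have hxA : sphPt x ∈ closure A := subset_closure ⟨φ x, hx, J.refl ⟨(sphPt_norm x).le, (h.bd x).ge⟩⟩
  have := sep h.cf hKL isClosed_closure hcl hxA (sphPt_norm y).le hyK
  exact lt_irrefl _ this

lemma bb_per {f : E2 → ℝ} {x x' y y' : ℝ} (hx : sphPt x = sphPt x') (hy : sphPt y = sphPt y') : bb f x y = bb f x' y' := by
  unfold bb; rw [hx, hy]

lemma Su.p0_1 {φ ν f} (h : Su φ ν f)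
    (hE : ∀ z, ‖z‖ < 1 → fderiv ℝ f z = 0 → (∀ᶠ w in nhds z, w ≠ z → f z < f w) ∨ (∀ᶠ w in nhds z, w ≠ z → f w < f z)) :
    P0 φ (bb f) := by
  intro x y hx hy hxy
  by_cases h1 : bb f x y = φ x
  · exact Or.inl h1
  by_cases h2 : bb f x y = φ y
  · exact Or.inr (Or.inl h2)
  right; right
  have h1' : bb f x y < φ x := lt_of_le_of_ne (h.b_le x y) h1
  have h2' : bb f x y < φ y := lt_of_le_of_ne (by rw [bb_symm]; exact h.b_le y x) h2
  obtain ⟨M, L, M', hT, e1, e2, s1⟩ := h.half hE h1' h2'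
  rw [bb_symm] at h1' h2'
  obtain ⟨N, K, N', hT', e1', e2', s2⟩ := h.half hE h2' h1'
  rw [bb_symm] at e1'
  have hKL : sphPt K = sphPt L := h.mf.inj _ _ hT'.mn.1 hT.mn.1 (by rw [e1, e1'])
  obtain ⟨k, hk⟩ := sphPt_eq_iff.1 hKL
  have hT2 := hT.shift h.mf.per k
  rw [← hk] at hT2
  obtain ⟨u1, u2⟩ := hT'.uniq hT2
  have v1 : sphPt N = sphPt M := sphPt_eq_iff.2 ⟨k, u1⟩
  have v2 : sphPt N' = sphPt M' := sphPt_eq_iff.2 ⟨k, u2⟩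
  rw [bb_per rfl v1, bb_per rfl v2, e1', ← e1] at s2
  have ul := h.ultra
  rcases s1 with s1 | s1 <;> rcases s2 with s2 | s2
  · have := ul x M y
    rw [bb_symm f M y] at this
    linarith [lt_min s1 s2]
  · exact Or.inl ⟨M, L, M', hT, e2, e1.symm, s1, s2⟩
  · exact Or.inr ⟨M, L, M', hT, e2, by rw [bb_symm, e1], s2, s1⟩
  · have := ul x M' y
    rw [bb_symm f M' y] at this
    linarith [lt_min s1 s2]

lemma ext_mx {f : E2 → ℝ} (hf : Sm f) {φ : ℝ → ℝ} (hm : MF φ) (bd : ∀ t, f (sphPt t) = φ t) {M : ℝ} (hM : IsMx φ M)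
    (hpr : pr f 1 M < 0) (leaf : ∀ y, IsMx φ y → sphPt y ≠ sphPt M → bb f M y < φ M) :
    ∃ c' q, ‖q‖ < 1 ∧ IsLocalMax f q ∧ J f c' (sphPt M) q ∧ ∀ y, IsMx φ y → sphPt y ≠ sphPt M → bb f M y < c' := by
  have cf : Continuous f := hf.continuous
  obtain ⟨c', hc', hc'M⟩ : ∃ c', (∀ y, IsMx φ y → sphPt y ≠ sphPt M → bb f M y < c') ∧ c' < φ M := by
    have h1 : ∀ᶠ c in nhdsWithin (φ M) (Set.Iio (φ M)), ∀ y ∈ {t | IsMx φ t} ∩ Set.Icc 0 (0 + τ), sphPt y ≠ sphPt M → bb f M y < c := by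
      rw [Filter.eventually_all_finite (hm.fin_mx 0 (0 + τ))]
      intro y hy
      by_cases hne : sphPt y = sphPt M
      · exact Filter.Eventually.of_forall fun c h => absurd hne h
      · exact ((lt_mem_nhds (leaf y hy.1 hne)).filter_mono nhdsWithin_le_nhds).mono fun c h _ => h
    obtain ⟨c', h2, h3⟩ := (h1.and self_mem_nhdsWithin).exists
    refine ⟨c', fun y hy hne => ?_, h3⟩
    obtain ⟨k, hk⟩ := exists_shift 0 y
    have e : sphPt (y + k * τ) = sphPt y := sphPt_eq_iff.2 ⟨k, rfl⟩
    rw [← bb_per (rfl : sphPt M = sphPt M) e]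
    exact h2 _ ⟨hy.shift hm.per k, hk.1, hk.2.le⟩ (by rw [e]; exact hne)
  have hML : sphPt M ∈ Lv f c' := ⟨(sphPt_norm M).le, by rw [bd]; exact hc'M.le⟩
  set K := connectedComponentIn (Lv f c') (sphPt M) with hK
  have hKs : K ⊆ Lv f c' := connectedComponentIn_subset _ _
  have hMK : sphPt M ∈ K := mem_connectedComponentIn hML
  have hKp : IsPreconnected K := isPreconnected_connectedComponentIn
  have hKcl : IsClosed K := by
    refine isClosed_of_closure_subset ?_
    exact hKp.closure.subset_connectedComponentIn (subset_closure hMK) (closure_minimal hKs (Lv_closed cf c'))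
  have hKc : IsCompact K := (isCompact_closedBall (0:E2) 1).of_isClosed_subset hKcl fun w hw => by simpa using (hKs hw).1
  obtain ⟨q, hqK, hqm⟩ := hKc.exists_isMaxOn ⟨_, hMK⟩ cf.continuousOn
  have hqc : c' < f q := lt_of_lt_of_le (by rw [bd]; exact hc'M) (hqm hMK)
  have hJ : J f c' (sphPt M) q := ⟨K, hKs, hKp, hMK, hqK⟩
  have hloc : ∀ᶠ w in nhds q, ‖w‖ ≤ 1 → f w ≤ f q := by
    obtain ⟨O, hO, hz, H1, -⟩ := reg_gt cf hqc
    filter_upwards [hO.mem_nhds hz, cf.continuousAt.eventually (lt_mem_nhds hqc)] with w hw hcw hw1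
    obtain ⟨c2, hc2, j⟩ := H1 q hz w hw (hKs hqK).1 hw1 hqc hcw
    obtain ⟨S, hS, hSp, hMS, hwS⟩ := hJ.trans (j.mono hc2.le)
    exact hqm (hSp.subset_connectedComponentIn hMS hS hwS)
  have hq1 : ‖q‖ < 1 := by
    refine lt_of_le_of_ne (hKs hqK).1 fun h1 => ?_
    obtain ⟨t, -, rfl⟩ := exists_sphPt h1
    have hlt : IsLocalMax φ t := by
      have := sphPt_continuous.continuousAt.eventually hloc
      refine this.mono fun s hs => ?_
      simpa only [bd] using hs (sphPt_norm s).le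
    rcases hm.mx_or_mn hlt.deriv_eq_zero with h2 | h2
    · by_cases hne : sphPt t = sphPt M
      · rw [hne] at hloc
        obtain ⟨O, hO, hz, -, H2⟩ := reg_in hf hpr
        obtain ⟨w, hw, hw1, hw2⟩ := mem_closure_iff_nhds.1 (H2 _ hz (sphPt_norm M).le rfl) _ hloc
        exact absurd (hw hw1) (not_le.2 hw2)
      · exact absurd (hc' t h2 hne) (not_lt.2 hJ.le_B)
    · obtain ⟨ε, hε, H⟩ := mx_strict hm.neg.sm (isMx_neg.2 h2)
      have h3 : ∀ᶠ s in nhdsWithin t (Set.Ioi t), φ s ≤ φ t ∧ s < t + ε ∧ t < s :=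
        (hlt.filter_mono nhdsWithin_le_nhds).and (((gt_mem_nhds (by linarith)).filter_mono nhdsWithin_le_nhds).and self_mem_nhdsWithin)
      obtain ⟨s, h4, h5, h6⟩ := h3.exists
      have := H s (by rw [abs_lt]; constructor <;> linarith) h6.ne'
      linarith
  refine ⟨c', q, hq1, ?_, hJ, hc'⟩
  filter_upwards [hloc, continuous_norm.continuousAt.eventually (gt_mem_nhds hq1)] with w h1 h2
  exact h1 h2.le

lemma ext_mn {f : E2 → ℝ} (hf : Sm f) {φ : ℝ → ℝ} (hm : MF φ) (bd : ∀ t, f (sphPt t) = φ t) {M L M' : ℝ} (hT : Tri φ M L M')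
    (hpr : 0 < pr f 1 L) (leaf : φ L < bb f M M') :
    ∃ c' q, ‖q‖ < 1 ∧ IsLocalMin f q ∧ J (fun p => - f p) c' (sphPt L) q ∧
      ∀ y, IsMn φ y → sphPt y ≠ sphPt L → bb (fun p => - f p) L y < c' := by
  have cf : Continuous f := hf.continuous
  obtain ⟨c', q, h1, h2, h3, h4⟩ := ext_mx (f := fun p => - f p) hf.neg hm.neg (fun t => by rw [bd]) (isMx_neg.2 hT.mn)
    (by unfold pr at hpr ⊢; simpa using hpr) (by
      intro y hy hne
      rw [isMx_neg] at hy
      obtain ⟨k, hk⟩ := exists_shift M y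
      have e : sphPt (y + k * τ) = sphPt y := sphPt_eq_iff.2 ⟨k, rfl⟩
      rw [← bb_per (rfl : sphPt L = sphPt L) e]
      have hy' := hy.shift hm.per k
      set y' := y + k * τ
      have g1 : M < y' := lt_of_le_of_ne hk.1 fun h => mx_not_mn hT.mx (h ▸ hy')
      have g2 : M' < y' := by
        by_contra hcon
        rcases (not_lt.1 hcon).lt_or_eq with g | g
        · exact hne (by rw [← e, hT.eq_mn hy'.1 g1 g])
        · exact mx_not_mn hT.mx' (g ▸ hy')
      have := bb_dual cf hT.lt1 hT.lt2 g2 hk.2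
      linarith)
  refine ⟨c', q, h1, ?_, h3, fun y hy => h4 y (isMx_neg.2 hy)⟩
  have := h2.neg
  simpa using this

lemma AL {α ι : Type} [Fintype α] [Fintype ι] (b : α → α → ℝ)
    (symm : ∀ x y, b x y = b y x) (ultra : ∀ x y z, min (b x y) (b y z) ≤ b x z) (u v : ι → α) (val : ι → ℝ)
    (huv : ∀ j, u j ≠ v j) (hb : ∀ j, b (u j) (v j) = val j) (inj : Function.Injective val)
    (hc : Fintype.card α ≤ Fintype.card ι + 1) (x y : α) (hxy : x ≠ y) :
    ∃ j, b x y = val j ∧ (((x = u j ∨ val j < b x (u j)) ∧ (y = v j ∨ val j < b y (v j))) ∨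
      ((y = u j ∨ val j < b y (u j)) ∧ (x = v j ∨ val j < b x (v j)))) := by
  classical
  let Φ : (α → ℝ) →ₗ[ℝ] (Option ι → ℝ) :=
    { toFun := fun χ o => o.elim (χ x - χ y) (fun j => χ (u j) - χ (v j))
      map_add' := fun χ χ' => by ext o; cases o <;> simp <;> ring
      map_smul' := fun r χ => by ext o; cases o <;> simp <;> ring }
  have hns : LinearMap.range Φ < ⊤ := by
    rw [lt_top_iff_ne_top]
    intro htop
    have h1 := Φ.finrank_range_add_finrank_ker
    rw [htop, finrank_top, Module.finrank_fintype_fun_eq_card, Module.finrank_fintype_fun_eq_card, Fintype.card_option] at h1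
    have h2 : Module.finrank ℝ (LinearMap.ker Φ) = 0 := by omega
    rw [Submodule.finrank_eq_zero] at h2
    have h3 : (fun _ => 1 : α → ℝ) ∈ LinearMap.ker Φ := by
      rw [LinearMap.mem_ker]; ext o; cases o <;> simp [Φ]
    rw [h2, Submodule.mem_bot] at h3
    have := congrFun h3 x
    simp at this
  obtain ⟨ψ, hψ, hle⟩ := Submodule.exists_le_ker_of_lt_top _ hns
  set g : Option ι → ℝ := fun i => ψ fun j => if i = j then 1 else 0 with hg
  have rel : ∀ χ : α → ℝ, (χ x - χ y) * g none + ∑ j, (χ (u j) - χ (v j)) * g (some j) = 0 := by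
    intro χ
    have h1 : ψ (Φ χ) = 0 := hle ⟨χ, rfl⟩
    rw [LinearMap.pi_apply_eq_sum_univ, Fintype.sum_option] at h1
    simpa [Φ] using h1
  have hex : ∃ j, g (some j) ≠ 0 := by
    by_contra hcon
    push Not at hcon
    have h1 := rel (fun a => if a = x then 1 else 0)
    simp only [hcon, mul_zero, Finset.sum_const_zero, add_zero] at h1
    simp [hxy.symm] at h1
    apply hψ
    ext w
    rw [LinearMap.comp_apply, LinearMap.pi_apply_eq_sum_univ]
    refine Finset.sum_eq_zero fun i _ => ?_
    cases i with
    | none => simp only [smul_eq_mul]; exact mul_eq_zero_of_right _ h1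
    | some j => simp only [smul_eq_mul]; exact mul_eq_zero_of_right _ (hcon j)
  obtain ⟨j, hj, hmin⟩ := (Finset.univ.filter fun j => g (some j) ≠ 0).exists_min_image val
    (by obtain ⟨j, hj⟩ := hex; exact ⟨j, by simpa using hj⟩)
  simp only [Finset.mem_filter, Finset.mem_univ, true_and] at hj hmin
  have hgt : ∀ i, g (some i) ≠ 0 → i ≠ j → val j < val i := fun i hi hne =>
    lt_of_le_of_ne (hmin i hi) fun h => hne (inj h.symm)
  have ind : ∀ c : α, (∀ i, i ≠ j → val j < val i → ((u i = c ∨ val j < b (u i) c) ↔ (v i = c ∨ val j < b (v i) c))) := by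
    intro c i _ hlt
    have hbi := hb i
    constructor
    · rintro (h | h)
      · right; rw [← h, symm, hbi]; exact hlt
      · right; refine lt_of_lt_of_le (lt_min ?_ h) (ultra (v i) (u i) c); rw [symm, hbi]; exact hlt
    · rintro (h | h)
      · right; rw [← h, hbi]; exact hlt
      · right; refine lt_of_lt_of_le (lt_min ?_ h) (ultra (u i) (v i) c); rw [hbi]; exact hlt
  have red : ∀ c : α, ((if x = c ∨ val j < b x c then (1:ℝ) else 0) - (if y = c ∨ val j < b y c then 1 else 0)) * g none
      + ((if u j = c ∨ val j < b (u j) c then (1:ℝ) else 0) - (if v j = c ∨ val j < b (v j) c then 1 else 0)) * g (some j) = 0 := by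
    intro c
    have h1 := rel (fun z => if z = c ∨ val j < b z c then 1 else 0)
    rw [Finset.sum_eq_single j] at h1
    · exact h1
    · intro i _ hne
      by_cases h0 : g (some i) = 0
      · rw [h0, mul_zero]
      · have := ind c i hne (hgt i h0 hne)
        beta_reduce
        simp only [this, sub_self, zero_mul]
    · intro h; exact absurd (Finset.mem_univ j) h
  have r1 := red (u j)
  have r2 := red (v j)
  have n1 : ¬ (v j = u j ∨ val j < b (v j) (u j)) := by
    rintro (h | h)
    · exact huv j h.symm
    · rw [symm, hb] at h; exact lt_irrefl _ h
  have n2 : ¬ (u j = v j ∨ val j < b (u j) (v j)) := by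
    rintro (h | h)
    · exact huv j h
    · rw [hb] at h; exact lt_irrefl _ h
  rw [if_pos (Or.inl rfl : u j = u j ∨ _), if_neg n1] at r1
  rw [if_pos (Or.inl rfl : v j = v j ∨ _), if_neg n2] at r2
  have main : ∀ x y, (x = u j ∨ val j < b x (u j)) → (y = v j ∨ val j < b y (v j)) → b x y = val j := by
    intro x y hx hy
    have hbj := hb j
    apply le_antisymm
    · by_contra hcon
      push Not at hcon
      have a1 : val j < b (u j) y := by
        rcases hx with rfl | hx
        · exact hcon
        · refine lt_of_lt_of_le (lt_min ?_ hcon) (ultra (u j) x y); rw [symm]; exact hx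
      rcases hy with rfl | hy
      · linarith
      · have := lt_of_lt_of_le (lt_min a1 hy) (ultra (u j) y (v j)); linarith
    · have a1 : val j ≤ b x (v j) := by
        rcases hx with rfl | hx
        · exact hbj.ge
        · exact (le_min hx.le hbj.ge).trans (ultra x (u j) (v j))
      rcases hy with rfl | hy
      · exact a1
      · rw [symm y] at hy; exact (le_min a1 hy.le).trans (ultra x (v j) y)
  refine ⟨j, ?_⟩
  by_cases p1 : x = u j ∨ val j < b x (u j) <;> by_cases p2 : y = u j ∨ val j < b y (u j) <;>
    by_cases p3 : x = v j ∨ val j < b x (v j) <;> by_cases p4 : y = v j ∨ val j < b y (v j) <;>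
    simp only [p1, p2, p3, p4, if_true, if_false] at r1 r2
  all_goals first
    | exact absurd (by linarith) hj
    | exact ⟨main x y p1 p4, Or.inl ⟨p1, p4⟩⟩
    | exact ⟨by rw [symm]; exact main y x p2 p3, Or.inr ⟨p2, p3⟩⟩
    | (exfalso; apply hj; linarith)

def Edge (φ : ℝ → ℝ) (f : E2 → ℝ) (p u v : E2) : Prop :=
  (∃ V Q, IsMx φ V ∧ IsMx φ Q ∧ u = sphPt V ∧ v = sphPt Q ∧ p = sphPt V ∧ u ≠ v ∧ bb f V Q = φ V) ∨
  (∃ M L M', Tri φ M L M' ∧ u = sphPt M ∧ v = sphPt M' ∧ p = sphPt L ∧ u ≠ v ∧ bb f M M' = φ L)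

lemma Edge.val {φ ν f} (h : Su φ ν f) {p u v} (he : Edge φ f p u v) : Bp f u v = f p := by
  rcases he with ⟨V, Q, -, -, rfl, rfl, rfl, -, h1⟩ | ⟨M, L, M', -, rfl, rfl, rfl, -, h1⟩
  · rw [h.bd]; exact h1
  · rw [h.bd]; exact h1

lemma Edge.neg {φ ν f} (h : Su φ ν f) {p u v} (he : Edge φ f p u v) : ν p = -1 := by
  rcases he with ⟨V, Q, hV, -, rfl, rfl, rfl, hne, h1⟩ | ⟨M, L, M', hT, rfl, rfl, rfl, -, h1⟩
  · exact h.nx hV hne h1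
  · exact h.nn hT h1

def MxP (φ : ℝ → ℝ) (p : E2) : Prop := ∃ t, IsMx φ t ∧ p = sphPt t

lemma crit_inf {f : E2 → ℝ} {q : E2} (hq : ‖q‖ < 1) (h1 : IsLocalMax f q) (h2 : IsLocalMin f q) (hfin : (critPts f).Finite) : False := by
  have h3 : ∀ᶠ w in nhds q, f w = f q := by
    filter_upwards [h1, h2] with w a b using le_antisymm a b
  have h4 : ∀ᶠ w in nhds q, w ∈ critPts f := by
    filter_upwards [h3.eventually_nhds, Metric.isOpen_ball.mem_nhds (show q ∈ Metric.ball (0:E2) 1 by simpa using hq)] with w hw hb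
    refine ⟨hb, ?_⟩
    have he : f =ᶠ[nhds w] fun _ => f q := hw
    rw [he.fderiv_eq]; simp
  exact infinite_of_mem_nhds q h4 hfin

def Rl (φ : ℝ → ℝ) (f : E2 → ℝ) (p q : E2) : Prop :=
  (∃ M c, IsMx φ M ∧ p = sphPt M ∧ IsLocalMax f q ∧ J f c p q ∧ ∀ y, IsMx φ y → sphPt y ≠ p → bb f M y < c) ∨
  (∃ L c, IsMn φ L ∧ p = sphPt L ∧ IsLocalMin f q ∧ J (fun w => - f w) c p q ∧
    ∀ y, IsMn φ y → sphPt y ≠ p → bb (fun w => - f w) L y < c)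

lemma Rl.exists {φ ν f} (h : Su φ ν f) {p : E2} (hp : ∃ t, deriv φ t = 0 ∧ p = sphPt t) (hn : ν p = -1)
    (hne : ¬ ∃ u v, Edge φ f p u v) : ∃ q, ‖q‖ < 1 ∧ Rl φ f p q := by
  obtain ⟨t, ht, rfl⟩ := hp
  rcases h.mf.mx_or_mn ht with hm | hm
  · obtain ⟨c, q, h1, h2, h3, h4⟩ := ext_mx h.ext.1 h.mf h.bd hm (h.mx_neg hm hn) (by
      intro y hy hyn
      refine lt_of_le_of_ne (h.b_le _ _) fun he => hne ⟨_, _, Or.inl ⟨t, y, hm, hy, rfl, rfl, rfl, hyn.symm, he⟩⟩)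
    exact ⟨q, h1, Or.inl ⟨t, c, hm, rfl, h2, h3, h4⟩⟩
  · obtain ⟨M, M', hT⟩ := h.mf.tri_mn hm
    obtain ⟨c, q, h1, h2, h3, h4⟩ := ext_mn h.ext.1 h.mf h.bd hT (h.mn_neg hm hn) (by
      refine lt_of_le_of_ne (h.adj hT) fun he => hne ⟨_, _, Or.inr ⟨M, t, M', hT, rfl, rfl, rfl, ?_, he.symm⟩⟩
      intro hMM
      have : bb f M M' = φ M := by
        rw [bb_per (rfl : sphPt M = sphPt M) hMM.symm, ← h.bd]; exact B_self h.cf (sphPt_norm M).le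
      linarith [(hT.mono h.mf.sm).1])
    exact ⟨q, h1, Or.inr ⟨t, c, hm, rfl, h2, h3, h4⟩⟩

lemma Rl.inj {φ f} (hfin : (critPts f).Finite) {p p' q : E2} (hq : ‖q‖ < 1) (h1 : Rl φ f p q) (h2 : Rl φ f p' q) : p = p' := by
  rcases h1 with ⟨M, c, hM, rfl, l, j, a⟩ | ⟨M, c, hM, rfl, l, j, a⟩ <;>
    rcases h2 with ⟨M', c', hM', rfl, l', j', a'⟩ | ⟨M', c', hM', rfl, l', j', a'⟩
  · by_contra hne
    have b1 := a M' hM' (Ne.symm hne)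
    have b2 := a' M hM hne
    rw [bb_symm] at b2
    exact absurd (lt_min b1 b2) (not_lt.2 (j.trans' j'.symm).le_B)
  · exact (crit_inf hq l l' hfin).elim
  · exact (crit_inf hq l' l hfin).elim
  · by_contra hne
    have b1 := a M' hM' (Ne.symm hne)
    have b2 := a' M hM hne
    rw [bb_symm] at b2
    exact absurd (lt_min b1 b2) (not_lt.2 (j.trans' j'.symm).le_B)

lemma Rl.crit {φ f} {p q : E2} (hq : ‖q‖ < 1) (h : Rl φ f p q) : q ∈ critPts f ∧ (IsLocalMax f q ∨ IsLocalMin f q) := by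
  rcases h with ⟨M, c, hM, -, l, -⟩ | ⟨M, c, hM, -, l, -⟩
  · exact ⟨⟨by simpa using hq, l.fderiv_eq_zero⟩, Or.inl l⟩
  · exact ⟨⟨by simpa using hq, l.fderiv_eq_zero⟩, Or.inr l⟩

open Classical in
lemma Su.count {φ ν f} (h : Su φ ν f) {T : Finset E2} (hT : ∀ p, p ∈ T ↔ ∃ t, deriv φ t = 0 ∧ p = sphPt t)
    (hfin : (critPts f).Finite) (hcard : 2 * ((critPts f).ncard : ℤ) = 4 - ∑ p ∈ T, ν p) {z : E2} (hz : z ∈ critPts f)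
    (hzx : ¬ IsLocalMax f z) (hzn : ¬ IsLocalMin f z) :
    (T.filter (MxP φ)).card ≤ (T.filter fun p => ∃ u v, Edge φ f p u v).card + 1 := by
  set N := T.filter fun p => ∃ u v, Edge φ f p u v with hN
  set T' := T.filter fun p => ν p = -1 ∧ ¬ ∃ u v, Edge φ f p u v with hT'
  have e1 : T'.card + 1 ≤ (critPts f).ncard := by
    have hq : ∀ p : E2, ∃ q, p ∈ T' → ‖q‖ < 1 ∧ Rl φ f p q := by
      intro p
      by_cases hp : p ∈ T'
      · rw [hT', Finset.mem_filter] at hp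
        obtain ⟨q, hq⟩ := Rl.exists h ((hT p).1 hp.1) hp.2.1 hp.2.2
        exact ⟨q, fun _ => hq⟩
      · exact ⟨0, fun h => absurd h hp⟩
    choose q hq using hq
    rw [Set.ncard_eq_toFinset_card _ hfin, ← Finset.card_erase_add_one (hfin.mem_toFinset.2 hz)]
    refine Nat.succ_le_succ (Finset.card_le_card_of_injOn q ?_ ?_)
    · intro p hp
      obtain ⟨a1, a2⟩ := hq p hp
      have a3 := a2.crit a1
      refine Finset.mem_coe.2 (Finset.mem_erase.2 ⟨?_, hfin.mem_toFinset.2 a3.1⟩)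
      rintro he
      rw [he] at a3
      exact a3.2.elim hzx hzn
    · intro p hp p' hp' he
      obtain ⟨a1, a2⟩ := hq p hp
      obtain ⟨b1, b2⟩ := hq p' hp'
      rw [← he] at b2
      exact a2.inj hfin a1 b2
  have e2 : ∑ p ∈ T, ν p = T.card - 2 * (T'.card + N.card) := by
    have : ∀ p ∈ T, ν p = 1 - 2 * ((if (ν p = -1 ∧ ¬ ∃ u v, Edge φ f p u v) then 1 else 0) + (if (∃ u v, Edge φ f p u v) then 1 else 0)) := by
      intro p _
      by_cases hE : ∃ u v, Edge φ f p u v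
      · have : ν p = -1 := by obtain ⟨u, v, he⟩ := hE; exact he.neg h
        simp [hE, this]
      · rcases h.νs p with h1 | h1 <;> simp [hE, h1]
    rw [Finset.sum_congr rfl this, Finset.sum_sub_distrib, ← Finset.mul_sum, Finset.sum_add_distrib, hT', hN]
    simp only [Finset.card_filter, Nat.cast_sum, Nat.cast_ite]
    simp
  have e3 : 2 * (T.filter (MxP φ)).card ≤ T.card := by
    rw [← Finset.card_filter_add_card_filter_not (s := T) (MxP φ)]
    rw [two_mul]
    refine Nat.add_le_add_left ?_ _
    have hl : ∀ p : E2, ∃ q, p ∈ T.filter (MxP φ) → ∃ M L M', Tri φ M L M' ∧ p = sphPt M ∧ q = sphPt L := by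
      intro p
      by_cases hp : p ∈ T.filter (MxP φ)
      · obtain ⟨-, t, ht, rfl⟩ := Finset.mem_filter.1 hp
        obtain ⟨L, M', hT⟩ := h.mf.tri_mx ht
        exact ⟨sphPt L, fun _ => ⟨t, L, M', hT, rfl, rfl⟩⟩
      · exact ⟨0, fun h => absurd h hp⟩
    choose q hq using hl
    refine Finset.card_le_card_of_injOn q ?_ ?_
    · intro p hp
      obtain ⟨M, L, M', a1, a2, a3⟩ := hq p hp
      refine Finset.mem_coe.2 (Finset.mem_filter.2 ⟨(hT _).2 ⟨L, a1.mn.1, a3⟩, ?_⟩)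
      rintro ⟨t, ht, he⟩
      obtain ⟨k, hk⟩ := sphPt_eq_iff.1 (a3.symm.trans he)
      exact mx_not_mn (ht.shift h.mf.per k) (hk ▸ a1.mn)
    · intro p hp p' hp' he
      obtain ⟨M, L, M', a1, a2, a3⟩ := hq p hp
      obtain ⟨N, K, N', b1, b2, b3⟩ := hq p' hp'
      rw [a3, b3] at he
      obtain ⟨k, hk⟩ := sphPt_eq_iff.1 he
      have b4 := b1.shift h.mf.per k
      rw [← hk] at b4
      rw [a2, b2]
      exact sphPt_eq_iff.2 ⟨k, (a1.uniq b4).1⟩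
  omega

open Classical in
lemma Su.p0_2 {φ ν f} (h : Su φ ν f) {T : Finset E2} (hT : ∀ p, p ∈ T ↔ ∃ t, deriv φ t = 0 ∧ p = sphPt t)
    (hfin : (critPts f).Finite) (hcard : 2 * ((critPts f).ncard : ℤ) = 4 - ∑ p ∈ T, ν p) {z : E2} (hz : z ∈ critPts f)
    (hzx : ¬ IsLocalMax f z) (hzn : ¬ IsLocalMin f z) : P0 φ (bb f) := by
  have hc := h.count hT hfin hcard hz hzx hzn
  set K := T.filter (MxP φ) with hK
  set N := T.filter fun p => ∃ u v, Edge φ f p u v with hN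
  have hKn : ∀ p : K, ‖(p : E2)‖ ≤ 1 := by
    rintro ⟨p, hp⟩
    obtain ⟨-, t, ht, rfl⟩ := Finset.mem_filter.1 hp
    exact (sphPt_norm t).le
  have hKm : ∀ t, IsMx φ t → sphPt t ∈ K := fun t ht => Finset.mem_filter.2 ⟨(hT _).2 ⟨t, ht.1, rfl⟩, t, ht, rfl⟩
  have hed : ∀ p : N, ∃ u v : K, Edge φ f p u v := by
    rintro ⟨p, hp⟩
    obtain ⟨-, u, v, he⟩ := Finset.mem_filter.1 hp
    have hu : u ∈ K ∧ v ∈ K := by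
      rcases he with ⟨V, Q, hV, hQ, rfl, rfl, -⟩ | ⟨M, L, M', hT, rfl, rfl, -⟩
      · exact ⟨hKm _ hV, hKm _ hQ⟩
      · exact ⟨hKm _ hT.mx, hKm _ hT.mx'⟩
    exact ⟨⟨u, hu.1⟩, ⟨v, hu.2⟩, he⟩
  choose u v hE using hed
  intro x y hx hy hxy
  obtain ⟨⟨p, hp⟩, hb, hor⟩ := AL (α := K) (ι := N) (fun a b => Bp f a b) (fun a b => B_symm _ _ _)
    (fun a b c => B_ultra h.cf (hKn a) (hKn b) (hKn c)) u v (fun p => f p)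
    (by
      intro p he
      rcases hE p with ⟨_, _, _, _, _, _, _, hne, _⟩ | ⟨_, _, _, _, _, _, _, hne, _⟩
      · exact hne (by rw [he])
      · exact hne (by rw [he]))
    (fun p => (hE p).val h)
    (by
      rintro ⟨p, hp⟩ ⟨p', hp'⟩ he
      obtain ⟨t, ht, rfl⟩ := (hT p).1 (Finset.mem_filter.1 hp).1
      obtain ⟨t', ht', rfl⟩ := (hT p').1 (Finset.mem_filter.1 hp').1
      dsimp only at he
      rw [h.bd, h.bd] at he
      exact Subtype.ext (h.mf.inj _ _ ht ht' he))
    (by simpa using hc) ⟨sphPt x, hKm x hx⟩ ⟨sphPt y, hKm y hy⟩ (fun he => hxy (congrArg Subtype.val he))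
  have hEp := hE ⟨p, hp⟩
  generalize u ⟨p, hp⟩ = u0 at hEp hor
  generalize v ⟨p, hp⟩ = v0 at hEp hor
  obtain ⟨u0, hu0⟩ := u0
  obtain ⟨v0, hv0⟩ := v0
  simp only [Subtype.mk.injEq] at hEp hor hb
  change bb f x y = f p at hb
  rcases hEp with ⟨V, Q, hV, hQ, rfl, rfl, rfl, hne, h1⟩ | ⟨M, L, M', hTr, rfl, rfl, rfl, hne, h1⟩
  · have aux : ∀ s, (sphPt s = sphPt V ∨ f (sphPt V) < Bp f (sphPt s) (sphPt V)) → sphPt s = sphPt V := by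
      rintro s (e | e)
      · exact e
      · have := h.b_le V s
        rw [bb_symm] at this
        rw [h.bd] at e
        exact absurd e (not_lt.2 this)
    rcases hor with ⟨o, -⟩ | ⟨o, -⟩
    · left; rw [hb, ← aux x o, h.bd]
    · right; left; rw [hb, ← aux y o, h.bd]
  · rw [h.bd] at hb hor
    have mo := hTr.mono h.mf.sm
    have aux : ∀ s M, φ L < φ M → (sphPt s = sphPt M ∨ φ L < Bp f (sphPt s) (sphPt M)) → φ L < bb f s M := by
      rintro s M hM (e | e)
      · have : bb f s M = φ M := by
          rw [bb_per e (rfl : sphPt M = sphPt M), ← h.bd]; exact B_self h.cf (sphPt_norm M).le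
        rw [this]; exact hM
      · exact e
    rcases hor with ⟨o, o'⟩ | ⟨o, o'⟩
    · exact Or.inr (Or.inr (Or.inl ⟨M, L, M', hTr, h1, hb, aux x M mo.1 o, aux y M' mo.2 o'⟩))
    · exact Or.inr (Or.inr (Or.inr ⟨M, L, M', hTr, h1, by rw [bb_symm]; exact hb, aux y M mo.1 o, aux x M' mo.2 o'⟩))

lemma strict_mx {f : E2 → ℝ} (hfin : (critPts f).Finite) {q : E2} (hq : ‖q‖ < 1) (h : IsLocalMax f q) :
    ∀ᶠ w in nhds q, w ≠ q → f w < f q := by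
  have h1 : ∀ᶠ w in nhds q, w ∉ critPts f \ {q} :=
    (hfin.subset Set.diff_subset).isClosed.isOpen_compl.mem_nhds (by simp)
  filter_upwards [h1, h.eventually_nhds, Metric.isOpen_ball.mem_nhds (show q ∈ Metric.ball (0:E2) 1 by simpa using hq), h]
    with w a1 a2 a3 a4 hne
  refine lt_of_le_of_ne a4 fun he => a1 ⟨⟨a3, ?_⟩, hne⟩
  have : IsLocalMax f w := a2.mono fun u hu => by rw [he]; exact hu
  exact this.fderiv_eq_zero

lemma crit_neg (f : E2 → ℝ) : critPts (fun w => - f w) = critPts f := by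
  ext w; simp [critPts]

lemma strict_mn {f : E2 → ℝ} (hfin : (critPts f).Finite) {q : E2} (hq : ‖q‖ < 1) (h : IsLocalMin f q) :
    ∀ᶠ w in nhds q, w ≠ q → f q < f w := by
  have := strict_mx (f := fun w => - f w) (by rw [crit_neg]; exact hfin) hq h.neg
  simpa using this

open Classical in
def νE {n : ℕ} (a : Ribbon n) (p : E2) : ℤ := if h : ∃ i, sphPt (a.θ i) = p then a.ν h.choose else 1

lemma Ribbon.inj {n : ℕ} (a : Ribbon n) : Function.Injective fun i => sphPt (a.θ i) := by
  intro i j hij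
  by_contra hne
  have h1 := a.theta_mem i
  have h2 := a.theta_mem j
  refine sph_ne (fun h => hne (a.theta_mono.injective h)) ?_ hij
  rw [abs_lt]; constructor <;> linarith [h1.1, h1.2, h2.1, h2.2]

lemma νE_node {n : ℕ} (a : Ribbon n) (i : Fin n) : νE a (sphPt (a.θ i)) = a.ν i := by
  have h : ∃ j, sphPt (a.θ j) = sphPt (a.θ i) := ⟨i, rfl⟩
  rw [νE, dif_pos h]
  exact congrArg a.ν (a.inj h.choose_spec)

lemma νE_s {n : ℕ} (a : Ribbon n) (p : E2) : νE a p = 1 ∨ νE a p = -1 := by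
  unfold νE; split_ifs
  · exact a.nu_sign _
  · exact Or.inl rfl

lemma Ribbon.node {n : ℕ} (a : Ribbon n) {t : ℝ} (ht : deriv a.g t = 0) : ∃ i, ∃ k : ℤ, a.θ i = t + k * τ := by
  obtain ⟨k, hk⟩ := exists_shift 0 t
  rw [zero_add] at hk
  obtain ⟨i, hi⟩ := a.crit_only _ hk (by rw [(deriv_per a.periodic_g).int_mul k t]; exact ht)
  exact ⟨i, k, hi.symm⟩

lemma Ribbon.mf {n : ℕ} (a : Ribbon n) : MF a.g := by
  refine ⟨a.smooth_g, a.periodic_g, fun t ht => ?_, fun s t hs ht he => ?_⟩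
  · obtain ⟨i, k, hi⟩ := a.node ht
    have := a.node_nondeg i
    rwa [hi, (deriv_per (deriv_per a.periodic_g)).int_mul k t] at this
  · obtain ⟨i, k, hi⟩ := a.node hs
    obtain ⟨j, l, hj⟩ := a.node ht
    have e : i = j := a.values_distinct i j (by
      rw [hi, hj, Function.Periodic.int_mul a.periodic_g k s, Function.Periodic.int_mul a.periodic_g l t]; exact he)
    rw [← sphPt_periodic.int_mul k s, ← sphPt_periodic.int_mul l t]
    change sphPt (s + k * τ) = sphPt (t + l * τ)
    rw [← hi, ← hj, e]

lemma grad_pr {f : E2 → ℝ} (t : ℝ) : ⟪gradient f (sphPt t), sphPt t⟫ = pr f 1 t := by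
  rw [pr, one_smul, gradient, InnerProductSpace.toDual_symm_apply]

lemma ext_iff {n : ℕ} (a : Ribbon n) (f : E2 → ℝ) : IsExtension a f ↔ ExtR a.g (fun t => νE a (sphPt t)) f := by
  constructor
  · rintro ⟨h1, h2, -, h4⟩
    refine ⟨h1, h2, fun t ht => ?_⟩
    obtain ⟨i, k, hi⟩ := a.node ht
    have e1 : sphPt (a.θ i) = sphPt t := by rw [hi]; exact sphPt_periodic.int_mul k t
    have e2 : deriv (deriv a.g) (a.θ i) = deriv (deriv a.g) t := by rw [hi, (deriv_per (deriv_per a.periodic_g)).int_mul k t]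
    obtain ⟨h5, h6⟩ := h4 i
    rw [e1, e2, grad_pr, ← νE_node, e1] at h5 h6
    rcases lt_or_gt_of_ne (a.mf.nd t ht) with h7 | h7
    · have := h5 h7; beta_reduce; nlinarith
    · have := h6 h7; beta_reduce; nlinarith
  · rintro ⟨h1, h2, h3⟩
    refine ⟨h1, h2, fun x hx h0 => ?_, fun i => ?_⟩
    · obtain ⟨t, -, rfl⟩ := exists_sphPt (by simpa using hx)
      have := (crit_iff (f := f) (t := t) one_pos).1 (by rw [one_smul]; exact h0)
      rw [pt_one h1 h2] at this
      have h4 := h3 t this.2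
      rw [this.1, mul_zero] at h4
      exact lt_irrefl _ h4
    · have := h3 _ (a.node_crit i)
      beta_reduce at this
      rw [νE_node] at this
      rw [grad_pr]
      constructor
      · intro h5; by_contra hc; push Not at hc; nlinarith
      · intro h5; by_contra hc; push Not at hc; nlinarith

open Classical in
/-- There is no ribbon with signature σ < 0 and γ = 2 − σ/2. -/
theorem main_thm (n : ℕ) (a : Ribbon n) (h : a.sigma < 0) :
    gammaR a ≠ (((2 - a.sigma / 2).toNat : ℕ) : ℕ∞) := by
  intro hg
  set T : Finset E2 := Finset.univ.image fun i => sphPt (a.θ i) with hTd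
  have hT : ∀ p, p ∈ T ↔ ∃ t, deriv a.g t = 0 ∧ p = sphPt t := by
    intro p
    simp only [hTd, Finset.mem_image, Finset.mem_univ, true_and]
    constructor
    · rintro ⟨i, rfl⟩; exact ⟨_, a.node_crit i, rfl⟩
    · rintro ⟨t, ht, rfl⟩
      obtain ⟨i, k, hi⟩ := a.node ht
      exact ⟨i, by rw [hi]; exact sphPt_periodic.int_mul k t⟩
  have hsum : ∑ p ∈ T, νE a p = a.sigma := by
    rw [hTd, Finset.sum_image (fun i _ j _ hij => a.inj hij)]
    exact Finset.sum_congr rfl fun i _ => νE_node a i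
  have heven : Even a.sigma := by
    have h1 : Even (∑ i, (a.ν i + 1)) := Finset.even_sum _ fun i _ => by
      rcases a.nu_sign i with h | h <;> rw [h] <;> decide
    rw [Finset.sum_add_distrib] at h1
    have h2 : Even (∑ _i : Fin n, (1:ℤ)) := by simpa using a.n_even
    exact (Int.even_add.1 h1).2 h2
  obtain ⟨s, hs⟩ := heven
  have hne : {k : ℕ∞ | ∃ f : E2 → ℝ, IsExtension a f ∧ (critPts f).encard = k}.Nonempty := by
    by_contra hcon
    rw [Set.not_nonempty_iff_eq_empty] at hcon
    rw [gammaR, hcon, sInf_empty] at hg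
    exact ENat.top_ne_coe _ hg
  obtain ⟨f, hf, hfe⟩ := csInf_mem hne
  change _ = gammaR a at hfe
  rw [hg] at hfe
  rw [ext_iff] at hf
  have hSu : Su a.g (νE a) f := ⟨a.mf, νE_s a, hf⟩
  have hfin : (critPts f).Finite := Set.finite_of_encard_eq_coe hfe
  have hnc : (critPts f).ncard = (2 - a.sigma / 2).toNat := by
    rw [Set.ncard, hfe, ENat.toNat_coe]
  have hcard : 2 * ((critPts f).ncard : ℤ) = 4 - ∑ p ∈ T, νE a p := by
    rw [hnc, hsum]; omega
  have hP : P0 a.g (bb f) := by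
    by_cases hE : ∀ z ∈ critPts f, IsLocalMax f z ∨ IsLocalMin f z
    · refine hSu.p0_1 fun z hz h0 => ?_
      rcases hE z ⟨by simpa using hz, h0⟩ with h1 | h1
      · exact Or.inr (strict_mx hfin hz h1)
      · exact Or.inl (strict_mn hfin hz h1)
    · push Not at hE
      obtain ⟨z, hz, h1, h2⟩ := hE
      exact hSu.p0_2 hT hfin hcard hz h1 h2
  obtain ⟨q, hq, f', hf', hle⟩ := main_ind _ _ _ _ T (hSu.good hP) hT rfl
  rw [← ext_iff] at hf'
  have h1 : gammaR a ≤ (critPts f').encard := sInf_le ⟨f', hf', rfl⟩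
  have h2 := h1.trans hle
  rw [hg, Nat.cast_le] at h2
  rw [hsum] at hq
  omega

/-- There is no ribbon `a` with `σ(a) < 0` and `γ(a) = 2 − σ(a)/2`; that is, for every ribbon
`a` with `σ(a) < 0` one has `γ(a) ≠ 2 − σ(a)/2`. -/
theorem stmt_11 (n : ℕ) (a : Ribbon n) (h : a.sigma < 0) :
    gammaR a ≠ (((2 - a.sigma / 2).toNat : ℕ) : ℕ∞) := by
  exact main_thm n a h
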